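/- arXiv:2305.09926 — 4 statements merged into one kernel-verified Lean document; each statement's English description precedes it below -/
import Mathlib

section
/- Assume N = 2 and p > 6. Then there exists η₂ > 0 such that: (i) for every c with 0 < c < η₂ there exist λ, λ̃ > -λ₁ with λ ≠ λ̃ and positive radial solutions u of (NLS_λ) and ũ of (NLS_{λ̃}) with m(u) = m(ũ) = c; (ii) there exist λ > -λ₁ and a positive radial solution u of (NLS_λ) with m(u) = η₂; and (iii) for every c > η₂ there is no λ > -λ₁ for which (NLS_λ) admits a positive radial solution u with m(u) = c. -/
open Set MeasureTheory Filter Topology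

noncomputable section

/-- `u` is a positive radial solution of (NLS_lam) on the annulus
`T = {x ∈ ℝ^N : 1 < |x| < 2}`: `u ∈ C²([1,2])`, `u > 0` on `(1,2)`,
`u(1) = u(2) = 0`, and `-(u'' + ((N-1)/r) u') + lam u = u^(p-1)` on `(1,2)`. -/
def IsPosRadSol (N : ℕ) (p lam : ℝ) (u : ℝ → ℝ) : Prop :=
  ContDiffOn ℝ 2 u (Icc 1 2) ∧
  (∀ r ∈ Ioo (1:ℝ) 2, 0 < u r) ∧
  u 1 = 0 ∧ u 2 = 0 ∧
  ∀ r ∈ Ioo (1:ℝ) 2,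
    -(deriv (deriv u) r + (((N : ℝ) - 1) / r) * deriv u r) + lam * u r = u r ^ (p - 1)

/-- The radial mass `m(u) = ∫₁² u(r)² r^(N-1) dr`. -/
def mass (N : ℕ) (u : ℝ → ℝ) : ℝ := ∫ r in (1:ℝ)..2, (u r) ^ 2 * r ^ (N - 1)

/-- The first radial Dirichlet eigenvalue of `-Δ` on the annulus. -/
def lambda1 (N : ℕ) : ℝ :=
  sInf { q : ℝ | ∃ φ : ℝ → ℝ, ContDiffOn ℝ 1 φ (Icc 1 2) ∧ φ 1 = 0 ∧ φ 2 = 0 ∧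
    (∃ r ∈ Icc (1:ℝ) 2, φ r ≠ 0) ∧
    q = (∫ r in (1:ℝ)..2, (deriv φ r) ^ 2 * r ^ (N - 1)) /
        (∫ r in (1:ℝ)..2, (φ r) ^ 2 * r ^ (N - 1)) }

abbrev TT : ℝ := Real.log 2

lemma TT_pos : 0 < TT := Real.log_pos (by norm_num)
lemma TT_lt : TT < 7/10 := by have := Real.log_two_lt_d9; unfold TT; linarith
lemma TT_gt : 69/100 < TT := by have := Real.log_two_gt_d9; unfold TT; linarith

/-- nonlinearity extended by zero to the negative half line -/
def gp (p x : ℝ) : ℝ := (max x 0) ^ (p - 1)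

/-- solutions (in the variable t = log r) of the radial equation as a first order system -/
structure IsSol (p lam mu : ℝ) (v q : ℝ → ℝ) : Prop where
  cv : ContinuousOn v (Icc 0 TT)
  cq : ContinuousOn q (Icc 0 TT)
  dv : ∀ t ∈ Ioo 0 TT, HasDerivAt v (q t) t
  dq : ∀ t ∈ Ioo 0 TT, HasDerivAt q (Real.exp (2 * t) * (lam * v t - mu * gp p (v t))) t

lemma gp_lip (p : ℝ) (hp : 6 < p) (B : ℝ) (hB : 0 ≤ B) :
    ∃ L : ℝ, 0 ≤ L ∧ ∀ x y, x ≤ B → y ≤ B → |gp p x - gp p y| ≤ L * |x - y| := by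
  refine ⟨(p - 1) * B ^ (p - 2), by have := Real.rpow_nonneg hB (p-2); nlinarith, ?_⟩
  intro x y hx hy
  have hd : ∀ z ∈ Icc (0:ℝ) B, HasDerivWithinAt (fun z : ℝ => z ^ (p - 1))
      ((p - 1) * z ^ (p - 1 - 1)) (Icc 0 B) z := fun z hz =>
    (Real.hasDerivAt_rpow_const (Or.inr (by linarith))).hasDerivWithinAt
  have hb : ∀ z ∈ Icc (0:ℝ) B, ‖(p - 1) * z ^ (p - 1 - 1)‖ ≤ (p - 1) * B ^ (p - 2) := by
    intro z hz
    have h1 : 0 ≤ z ^ (p - 1 - 1) := Real.rpow_nonneg hz.1 _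
    rw [Real.norm_of_nonneg (mul_nonneg (by linarith) h1), show p - 1 - 1 = p - 2 by ring]
    exact mul_le_mul_of_nonneg_left (Real.rpow_le_rpow hz.1 hz.2 (by linarith)) (by linarith)
  have h := (convex_Icc (0:ℝ) B).norm_image_sub_le_of_norm_hasDerivWithin_le hd hb
    (x := max y 0) (y := max x 0) ⟨le_max_right _ _, max_le hy hB⟩ ⟨le_max_right _ _, max_le hx hB⟩
  simp only [Real.norm_eq_abs] at h
  refine h.trans ?_
  refine mul_le_mul_of_nonneg_left (abs_max_sub_max_le_abs x y 0) ?_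
  have := Real.rpow_nonneg hB (p-2); nlinarith

lemma gp_nonneg (p x : ℝ) : 0 ≤ gp p x := Real.rpow_nonneg (le_max_right _ _) _

lemma gp_le (p : ℝ) (hp : 6 < p) (B x : ℝ) (hB : 0 ≤ B) (hx : x ≤ B) : gp p x ≤ B ^ (p - 1) :=
  Real.rpow_le_rpow (le_max_right _ _) (max_le hx hB) (by linarith)

lemma gp_of_nonneg (p x : ℝ) (hx : 0 ≤ x) : gp p x = x ^ (p - 1) := by
  unfold gp; rw [max_eq_left hx]

lemma gp_cont (p : ℝ) (hp : 6 < p) : Continuous (gp p) :=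
  (continuous_id.max continuous_const).rpow_const (fun _ => Or.inr (by linarith))

lemma exp2_le {t : ℝ} (ht : t ≤ TT) : Real.exp (2 * t) ≤ 4 := by
  calc Real.exp (2 * t) ≤ Real.exp (2 * TT) := Real.exp_le_exp.2 (by linarith)
    _ = 4 := by rw [two_mul, Real.exp_add, Real.exp_log (by norm_num)]; norm_num

lemma exp2_ge {t : ℝ} (ht : 0 ≤ t) : 1 ≤ Real.exp (2 * t) := by
  rw [Real.one_le_exp_iff]; linarith

set_option maxHeartbeats 1000000 in
/-- Gronwall estimate -/
lemma gronwall_two (p : ℝ) (hp : 6 < p) (Lam M B : ℝ) (hB : 0 ≤ B) (hLam : 0 ≤ Lam) (hM : 0 ≤ M) :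
    ∃ K : ℝ, 0 ≤ K ∧ ∀ l1 l2 m1 m2 : ℝ, ∀ v1 q1 v2 q2 : ℝ → ℝ,
      |l1| ≤ Lam → |m1| ≤ M →
      IsSol p l1 m1 v1 q1 → IsSol p l2 m2 v2 q2 →
      (∀ t ∈ Icc 0 TT, |v1 t| ≤ B) → (∀ t ∈ Icc 0 TT, |v2 t| ≤ B) →
      ∀ s ∈ Icc 0 TT, ∀ t ∈ Icc 0 TT,
        (v1 t - v2 t) ^ 2 + (q1 t - q2 t) ^ 2 ≤
          K * ((v1 s - v2 s) ^ 2 + (q1 s - q2 s) ^ 2 + (|l1 - l2| + |m1 - m2|) ^ 2) := by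
  obtain ⟨L, hL, hLip⟩ := gp_lip p hp B hB
  set K1 := Lam + M * L with hK1
  set K2 := B + B ^ (p - 1) with hK2
  have hK1' : 0 ≤ K1 := by positivity
  have hBp : 0 ≤ B ^ (p - 1) := Real.rpow_nonneg hB _
  have hK2' : 0 ≤ K2 := by positivity
  set K := 1 + 4 * K1 + 4 * K2 with hK
  have hKpos : 0 ≤ K := by positivity
  refine ⟨Real.exp K, (Real.exp_pos _).le, ?_⟩
  intro l1 l2 m1 m2 v1 q1 v2 q2 hl1 hm1 h1 h2 hb1 hb2 s hs t ht
  set e := |l1 - l2| + |m1 - m2| with he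
  have he0 : 0 ≤ e := by positivity
  set D : ℝ → ℝ := fun t => (v1 t - v2 t) ^ 2 + (q1 t - q2 t) ^ 2 + e ^ 2 with hD
  set D' : ℝ → ℝ := fun t => 2 * (v1 t - v2 t) * (q1 t - q2 t) + 2 * (q1 t - q2 t) *
    (Real.exp (2 * t) * (l1 * v1 t - m1 * gp p (v1 t)) -
      Real.exp (2 * t) * (l2 * v2 t - m2 * gp p (v2 t))) with hD'
  have hDc : ContinuousOn D (Icc 0 TT) :=
    (((h1.cv.sub h2.cv).pow 2).add ((h1.cq.sub h2.cq).pow 2)).add continuousOn_const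
  have hDd : ∀ x ∈ Ioo 0 TT, HasDerivAt D (D' x) x := by
    intro x hx
    have := ((((h1.dv x hx).sub (h2.dv x hx)).pow 2).add
      (((h1.dq x hx).sub (h2.dq x hx)).pow 2)).add_const (e ^ 2)
    refine this.congr_deriv ?_
    simp [hD']
  have hDnn : ∀ x, 0 ≤ D x := fun x => by simp only [hD]; positivity
  have hDb : ∀ x ∈ Ioo 0 TT, |D' x| ≤ K * D x := by
    intro x hx
    have hxI : x ∈ Icc 0 TT := Ioo_subset_Icc_self hx
    have hr1 := exp2_ge hx.1.le
    have hr2 := exp2_le hx.2.le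
    set r := Real.exp (2 * x)
    set a := |v1 x - v2 x| with ha
    set b := |q1 x - q2 x| with hb
    have ha0 : 0 ≤ a := abs_nonneg _
    have hb0 : 0 ≤ b := abs_nonneg _
    have hH : |(l1 * v1 x - m1 * gp p (v1 x)) - (l2 * v2 x - m2 * gp p (v2 x))| ≤ K1 * a + K2 * e := by
      have e1 : (l1 * v1 x - m1 * gp p (v1 x)) - (l2 * v2 x - m2 * gp p (v2 x)) =
        l1 * (v1 x - v2 x) + (l1 - l2) * v2 x - m1 * (gp p (v1 x) - gp p (v2 x))
          - (m1 - m2) * gp p (v2 x) := by ring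
      rw [e1]
      have t1 : |l1 * (v1 x - v2 x)| ≤ Lam * a := by
        rw [abs_mul]; exact mul_le_mul_of_nonneg_right hl1 ha0
      have t2 : |(l1 - l2) * v2 x| ≤ |l1 - l2| * B := by
        rw [abs_mul]; exact mul_le_mul_of_nonneg_left (hb2 x hxI) (abs_nonneg _)
      have t3 : |m1 * (gp p (v1 x) - gp p (v2 x))| ≤ M * (L * a) := by
        rw [abs_mul]
        exact mul_le_mul hm1 (hLip _ _ (le_of_abs_le (hb1 x hxI)) (le_of_abs_le (hb2 x hxI)))
          (abs_nonneg _) hM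
      have t4 : |(m1 - m2) * gp p (v2 x)| ≤ |m1 - m2| * B ^ (p - 1) := by
        rw [abs_mul, abs_of_nonneg (gp_nonneg p _)]
        exact mul_le_mul_of_nonneg_left (gp_le p hp B _ hB (le_of_abs_le (hb2 x hxI))) (abs_nonneg _)
      have a1 := abs_nonneg (l1 - l2)
      have a2 := abs_nonneg (m1 - m2)
      have t5 : |l1 * (v1 x - v2 x) + (l1 - l2) * v2 x - m1 * (gp p (v1 x) - gp p (v2 x))
          - (m1 - m2) * gp p (v2 x)| ≤ Lam * a + |l1 - l2| * B + M * (L * a) + |m1 - m2| * B ^ (p - 1) := by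
        rw [abs_le] at t1 t2 t3 t4 ⊢
        constructor <;> linarith
      refine t5.trans ?_
      rw [hK1, hK2, he]
      nlinarith [mul_nonneg a1 hBp, mul_nonneg a2 hB]
    have h3 : |D' x| ≤ 2 * a * b + 2 * b * (4 * (K1 * a + K2 * e)) := by
      have e2 : D' x = 2 * ((v1 x - v2 x) * (q1 x - q2 x)) + 2 * ((q1 x - q2 x) *
        (r * ((l1 * v1 x - m1 * gp p (v1 x)) - (l2 * v2 x - m2 * gp p (v2 x))))) := by
        simp only [hD']; ring
      rw [e2]
      refine (abs_add_le _ _).trans ?_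
      rw [abs_mul, abs_mul, abs_mul, abs_mul, abs_mul, abs_of_pos (show (0:ℝ) < 2 by norm_num),
        abs_of_nonneg (show 0 ≤ r by linarith)]
      have : r * |(l1 * v1 x - m1 * gp p (v1 x)) - (l2 * v2 x - m2 * gp p (v2 x))| ≤ 4 * (K1 * a + K2 * e) :=
        mul_le_mul hr2 hH (abs_nonneg _) (by norm_num)
      have := mul_le_mul_of_nonneg_left this hb0
      nlinarith
    refine h3.trans ?_
    have hDx : D x = a ^ 2 + b ^ 2 + e ^ 2 := by simp only [hD, ha, hb, sq_abs]
    rw [hDx, hK]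
    nlinarith [sq_nonneg (a - b), sq_nonneg (b - e), mul_nonneg hK1' (sq_nonneg (a - b)),
      mul_nonneg hK2' (sq_nonneg (b - e)), mul_nonneg hK1' (sq_nonneg e), mul_nonneg hK2' (sq_nonneg a)]
  have hanti : AntitoneOn (fun x => D x * Real.exp (-K * x)) (Icc 0 TT) := by
    apply antitoneOn_of_hasDerivWithinAt_nonpos (convex_Icc _ _)
      (f' := fun x => D' x * Real.exp (-K * x) + D x * (Real.exp (-K * x) * (-K)))
    · exact hDc.mul (by fun_prop)
    · intro x hx
      rw [interior_Icc] at hx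
      have he : HasDerivAt (fun x => Real.exp (-K * x)) (Real.exp (-K * x) * (-K)) x := by
        simpa using ((hasDerivAt_id x).const_mul (-K)).exp
      exact ((hDd x hx).mul he).hasDerivWithinAt
    · intro x hx
      rw [interior_Icc] at hx
      have := le_of_abs_le (hDb x hx)
      have e0 := mul_nonneg (sub_nonneg.2 this) (Real.exp_pos (-K * x)).le
      linarith [e0]
  have hmono : MonotoneOn (fun x => D x * Real.exp (K * x)) (Icc 0 TT) := by
    apply monotoneOn_of_hasDerivWithinAt_nonneg (convex_Icc _ _)
      (f' := fun x => D' x * Real.exp (K * x) + D x * (Real.exp (K * x) * K))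
    · exact hDc.mul (by fun_prop)
    · intro x hx
      rw [interior_Icc] at hx
      have he : HasDerivAt (fun x => Real.exp (K * x)) (Real.exp (K * x) * (K)) x := by
        simpa using ((hasDerivAt_id x).const_mul (K)).exp
      exact ((hDd x hx).mul he).hasDerivWithinAt
    · intro x hx
      rw [interior_Icc] at hx
      have := neg_le_of_abs_le (hDb x hx)
      have e0 := mul_nonneg (neg_le_iff_add_nonneg.1 this) (Real.exp_pos (K * x)).le
      linarith [e0]
  have hT1 : TT ≤ 1 := by have := TT_lt; linarith
  have hfin : D t ≤ Real.exp K * D s := by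
    rcases le_total s t with hst | hst
    · have := hanti hs ht hst
      simp only at this
      have h5 : D t = (D t * Real.exp (-K * t)) * Real.exp (K * t) := by
        rw [mul_assoc, ← Real.exp_add]; simp
      rw [h5]
      calc D t * Real.exp (-K * t) * Real.exp (K * t)
          ≤ D s * Real.exp (-K * s) * Real.exp (K * t) :=
            mul_le_mul_of_nonneg_right this (Real.exp_pos _).le
        _ = D s * Real.exp (-K * s + K * t) := by rw [Real.exp_add]; ring
        _ ≤ D s * Real.exp K := by
          refine mul_le_mul_of_nonneg_left (Real.exp_le_exp.2 ?_) (hDnn s)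
          nlinarith [hs.1, ht.2]
        _ = _ := mul_comm _ _
    · have := hmono ht hs hst
      simp only at this
      have h5 : D t = (D t * Real.exp (K * t)) * Real.exp (-K * t) := by
        rw [mul_assoc, ← Real.exp_add]; simp
      rw [h5]
      calc D t * Real.exp (K * t) * Real.exp (-K * t)
          ≤ D s * Real.exp (K * s) * Real.exp (-K * t) :=
            mul_le_mul_of_nonneg_right this (Real.exp_pos _).le
        _ = D s * Real.exp (K * s + -K * t) := by rw [Real.exp_add]; ring
        _ ≤ D s * Real.exp K := by
          refine mul_le_mul_of_nonneg_left (Real.exp_le_exp.2 ?_) (hDnn s)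
          nlinarith [hs.2, ht.1]
        _ = _ := mul_comm _ _
  simp only [hD] at hfin
  linarith [sq_nonneg e]

lemma IsSol.bdd {p lam mu : ℝ} {v q : ℝ → ℝ} (h : IsSol p lam mu v q) :
    ∃ B, 0 ≤ B ∧ ∀ t ∈ Icc 0 TT, |v t| ≤ B := by
  obtain ⟨B, hB⟩ := isCompact_Icc.exists_bound_of_continuousOn h.cv
  exact ⟨max B 0, le_max_right _ _, fun t ht => (hB t ht).trans (le_max_left _ _)⟩

lemma IsSol.unique {p lam mu : ℝ} (hp : 6 < p) {v1 q1 v2 q2 : ℝ → ℝ} (h1 : IsSol p lam mu v1 q1)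
    (h2 : IsSol p lam mu v2 q2) {s : ℝ} (hs : s ∈ Icc 0 TT) (hv : v1 s = v2 s) (hq : q1 s = q2 s) :
    ∀ t ∈ Icc 0 TT, v1 t = v2 t ∧ q1 t = q2 t := by
  obtain ⟨B1, hB1, hb1⟩ := h1.bdd
  obtain ⟨B2, hB2, hb2⟩ := h2.bdd
  obtain ⟨K, hK, H⟩ := gronwall_two p hp |lam| |mu| (max B1 B2) (le_max_of_le_left hB1)
    (abs_nonneg _) (abs_nonneg _)
  intro t ht
  have := H lam lam mu mu v1 q1 v2 q2 le_rfl le_rfl h1 h2 (fun t ht => (hb1 t ht).trans (le_max_left _ _))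
    (fun t ht => (hb2 t ht).trans (le_max_right _ _)) s hs t ht
  simp only [hv, hq, sub_self, abs_zero] at this
  norm_num at this
  constructor <;> nlinarith [sq_nonneg (v1 t - v2 t), sq_nonneg (q1 t - q2 t)]

lemma IsSol.zero (p : ℝ) (hp : 6 < p) (lam mu : ℝ) : IsSol p lam mu (fun _ => 0) (fun _ => 0) where
  cv := continuousOn_const
  cq := continuousOn_const
  dv := fun t _ => hasDerivAt_const t 0
  dq := fun t _ => by
    have : gp p 0 = 0 := by rw [gp_of_nonneg p 0 le_rfl, Real.zero_rpow (by linarith)]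
    simpa [this] using hasDerivAt_const t (0:ℝ)

lemma flow_trunc (p : ℝ) (hp : 6 < p) (h : ℝ → ℝ) (Hm Lh : ℝ) (hHm0 : 0 ≤ Hm) (hLh0 : 0 ≤ Lh)
    (hHm : ∀ x, |h x| ≤ Hm) (hLh : ∀ x y, |h x - h y| ≤ Lh * |x - y|) :
    ∃ v q : ℝ → ℝ, v 0 = 0 ∧ q 0 = 1 ∧
      (∀ t ∈ Ioo (-1/10 : ℝ) (8/10), HasDerivAt v (q t) t) ∧
      (∀ t ∈ Ioo (-1/10 : ℝ) (8/10), HasDerivAt q (Real.exp (2 * t) * h (v t)) t) := by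
  set C := Real.exp 2 with hC
  have hC0 : 0 < C := Real.exp_pos _
  have hexp : ∀ t ∈ Icc (-1/10 : ℝ) (8/10), Real.exp (2 * t) ≤ C := fun t ht =>
    Real.exp_le_exp.2 (by linarith [ht.2])
  have hCH : 0 ≤ C * Hm := by positivity
  have hCL : 0 ≤ C * Lh := by positivity
  let f : ℝ → ℝ × ℝ → ℝ × ℝ := fun t x => (x.2, Real.exp (2 * t) * h x.1)
  let t0 : Icc (-1/10 : ℝ) (8/10) := ⟨0, by norm_num, by norm_num⟩
  have hPL : IsPicardLindelof f t0 ((0, 1) : ℝ × ℝ) (Real.toNNReal (4 * (1 + C * Hm))) 0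
      (Real.toNNReal (5 * (1 + C * Hm))) (Real.toNNReal (1 + C * Lh)) := by
    constructor
    · intro t ht
      apply LipschitzWith.lipschitzOnWith
      apply LipschitzWith.of_dist_le_mul
      intro x y
      rw [Real.coe_toNNReal _ (by positivity)]
      rw [Prod.dist_eq, Prod.dist_eq]
      have h1 : dist x.1 y.1 ≤ max (dist x.1 y.1) (dist x.2 y.2) := le_max_left _ _
      have h2 : dist x.2 y.2 ≤ max (dist x.1 y.1) (dist x.2 y.2) := le_max_right _ _
      set m := max (dist x.1 y.1) (dist x.2 y.2)
      have hm : 0 ≤ m := dist_nonneg.trans h1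
      apply max_le
      · simp only [f]; nlinarith
      · simp only [f]
        rw [Real.dist_eq, ← mul_sub, abs_mul, abs_of_pos (Real.exp_pos _)]
        have h3 : |h x.1 - h y.1| ≤ Lh * m :=
          (hLh _ _).trans (mul_le_mul_of_nonneg_left (by rwa [← Real.dist_eq]) hLh0)
        have := mul_le_mul (hexp t ht) h3 (abs_nonneg _) hC0.le
        nlinarith
    · intro x _
      apply Continuous.continuousOn
      simp only [f]
      fun_prop
    · intro t ht x hx
      rw [Real.coe_toNNReal _ (by positivity)]
      rw [Metric.mem_closedBall, Real.coe_toNNReal _ (by positivity), Prod.dist_eq] at hx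
      have hx2 := (le_max_right _ _).trans hx
      rw [Real.dist_eq] at hx2
      rw [Prod.norm_def]
      apply max_le
      · simp only [f, Real.norm_eq_abs]
        have := abs_sub_abs_le_abs_sub x.2 1
        simp only [abs_one] at this
        linarith
      · simp only [f, Real.norm_eq_abs]
        rw [abs_mul, abs_of_pos (Real.exp_pos _)]
        have := mul_le_mul (hexp t ht) (hHm x.1) (abs_nonneg _) hC0.le
        linarith
    · rw [Real.coe_toNNReal _ (by positivity), Real.coe_toNNReal _ (by positivity)]
      have : max ((8/10 : ℝ) - (t0 : ℝ)) ((t0 : ℝ) - (-1/10)) = 8/10 := by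
        simp only [t0]; norm_num
      rw [this]; simp only [NNReal.coe_zero]; linarith
  obtain ⟨α, hα0, hα⟩ := hPL.exists_eq_forall_mem_Icc_hasDerivWithinAt₀
  have hα' : ∀ t ∈ Ioo (-1/10 : ℝ) (8/10), HasDerivAt α (f t (α t)) t := fun t ht =>
    (hα t (Ioo_subset_Icc_self ht)).hasDerivAt (Icc_mem_nhds ht.1 ht.2)
  refine ⟨fun t => (α t).1, fun t => (α t).2, ?_, ?_, ?_, ?_⟩
  · have : α 0 = (0, 1) := hα0
    simp [this]
  · have : α 0 = (0, 1) := hα0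
    simp [this]
  · intro t ht
    exact (hasFDerivAt_fst.comp_hasDerivAt t (hα' t ht))
  · intro t ht
    exact (hasFDerivAt_snd.comp_hasDerivAt t (hα' t ht))

lemma Icc_sub_ext {t : ℝ} (ht : t ∈ Icc 0 TT) : t ∈ Ioo (-1/10 : ℝ) (8/10) :=
  ⟨by linarith [ht.1], by linarith [ht.2, TT_lt]⟩

lemma flow_exists (p : ℝ) (hp : 6 < p) (lam mu : ℝ) (hmu : 0 ≤ mu) :
    ∃ v q h : ℝ → ℝ, Continuous h ∧ v 0 = 0 ∧ q 0 = 1 ∧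
      (∀ t ∈ Ioo (-1/10 : ℝ) (8/10), HasDerivAt v (q t) t) ∧
      (∀ t ∈ Ioo (-1/10 : ℝ) (8/10), HasDerivAt q (Real.exp (2 * t) * h (v t)) t) ∧
      (∀ t ∈ Icc 0 TT, |v t| ≤ Real.exp (|lam| + 1)) ∧
      (∀ t ∈ Icc 0 TT, h (v t) = lam * v t - mu * gp p (v t)) := by
  set B := Real.exp (|lam| + 1) with hB
  have hB0 : 0 < B := Real.exp_pos _
  let k : ℝ → ℝ := fun x => max (-B) (min x B)
  have hkB : ∀ x, |k x| ≤ B := fun x => by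
    simp only [k, abs_le]
    exact ⟨le_max_left _ _, max_le (by linarith) (min_le_right _ _)⟩
  have hklip : ∀ x y, |k x - k y| ≤ |x - y| := fun x y => by
    simp only [k]
    refine (abs_max_sub_max_le_max _ _ _ _).trans ?_
    simp only [sub_self, abs_zero]
    refine max_le (abs_nonneg _) ?_
    refine (abs_min_sub_min_le_max _ _ _ _).trans ?_
    simp
  have hk0 : k 0 = 0 := by
    simp only [k]; rw [min_eq_left hB0.le, max_eq_right (by linarith)]
  have hkabs : ∀ x, |k x| ≤ |x| := fun x => by simpa [hk0] using hklip x 0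
  have hkneg : ∀ x, x ≤ 0 → k x ≤ 0 := fun x hx =>
    max_le (by linarith) ((min_le_left _ _).trans hx)
  have hkid : ∀ x, |x| ≤ B → k x = x := fun x hx => by
    simp only [k]; rw [abs_le] at hx
    rw [min_eq_left hx.2, max_eq_right hx.1]
  have hkc : Continuous k := by fun_prop
  obtain ⟨L, hL, hLip⟩ := gp_lip p hp B hB0.le
  have hBp : 0 ≤ B ^ (p - 1) := Real.rpow_nonneg hB0.le _
  let h : ℝ → ℝ := fun x => lam * k x - mu * gp p (k x)
  have hgc : Continuous (fun x => gp p (k x)) := (gp_cont p hp).comp hkc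
  have hhc : Continuous h := by
    exact (continuous_const.mul hkc).sub (continuous_const.mul hgc)
  have hgb : ∀ x, |gp p (k x)| ≤ B ^ (p - 1) := fun x => by
    rw [abs_of_nonneg (gp_nonneg _ _)]
    exact gp_le p hp B _ hB0.le (le_of_abs_le (hkB x))
  obtain ⟨v, q, hv0, hq0, hdv, hdq⟩ := flow_trunc p hp h (|lam| * B + mu * B ^ (p - 1))
    (|lam| + mu * L) (by positivity) (by positivity)
    (fun x => by
      simp only [h]
      refine (abs_sub _ _).trans ?_
      rw [abs_mul, abs_mul, abs_of_nonneg hmu]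
      exact add_le_add (mul_le_mul_of_nonneg_left (hkB x) (abs_nonneg _))
        (mul_le_mul_of_nonneg_left (hgb x) hmu))
    (fun x y => by
      simp only [h]
      have e : lam * k x - mu * gp p (k x) - (lam * k y - mu * gp p (k y)) =
        lam * (k x - k y) - mu * (gp p (k x) - gp p (k y)) := by ring
      rw [e]
      refine (abs_sub _ _).trans ?_
      rw [abs_mul, abs_mul, abs_of_nonneg hmu, add_mul, mul_assoc]
      refine add_le_add (mul_le_mul_of_nonneg_left (hklip x y) (abs_nonneg _))
        (mul_le_mul_of_nonneg_left ?_ hmu)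
      exact (hLip _ _ (le_of_abs_le (hkB x)) (le_of_abs_le (hkB y))).trans
        (mul_le_mul_of_nonneg_left (hklip x y) hL))
  let G : ℝ → ℝ := fun x => ∫ s in (0:ℝ)..x, gp p (k s)
  have hG0 : G 0 = 0 := by simp [G]
  have hGd : ∀ x, HasDerivAt G (gp p (k x)) x := fun x =>
    (hgc.integral_hasStrictDerivAt 0 x).hasDerivAt
  have hGn : ∀ x, 0 ≤ G x := by
    intro x
    rcases le_total 0 x with hx | hx
    · exact intervalIntegral.integral_nonneg hx (fun s _ => gp_nonneg _ _)
    · have : G x = 0 := by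
        simp only [G]
        rw [intervalIntegral.integral_symm, intervalIntegral.integral_congr (g := fun _ => 0)]
        · simp
        · intro s hs
          rw [uIcc_of_le hx] at hs
          simp only [gp, max_eq_right (hkneg s hs.2)]
          exact Real.zero_rpow (by linarith)
      rw [this]
  let H : ℝ → ℝ := fun t => q t ^ 2 * Real.exp (-2 * t) / 2 + mu * G (v t) + v t ^ 2 / 2
  let H' : ℝ → ℝ := fun t => lam * k (v t) * q t + v t * q t - q t ^ 2 * Real.exp (-2 * t)
  have hee : ∀ t : ℝ, Real.exp (2 * t) * Real.exp (-2 * t) = 1 := fun t => by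
    rw [← Real.exp_add]; simp
  have hHd : ∀ t ∈ Icc 0 TT, HasDerivAt H (H' t) t := by
    intro t ht
    have ht' := Icc_sub_ext ht
    have he : HasDerivAt (fun x => Real.exp (-2 * x)) (Real.exp (-2 * t) * (-2)) t := by
      simpa using ((hasDerivAt_id t).const_mul (-2)).exp
    have := (((((hdq t ht').pow 2).mul he).div_const 2).add
      (((hGd (v t)).comp t (hdv t ht')).const_mul mu)).add (((hdv t ht').pow 2).div_const 2)
    refine this.congr_deriv ?_
    simp only [H', h, Pi.pow_apply]
    have e1 := hee t
    push_cast
    linear_combination (q t * (lam * k (v t) - mu * gp p (k (v t)))) * e1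
  have hHb : ∀ t ∈ Icc 0 TT, H' t ≤ 2 * (|lam| + 1) * H t := by
    intro t ht
    have hr : 1 / 4 ≤ Real.exp (-2 * t) := by
      have h1 := exp2_le ht.2
      have h2 := hee t
      have h3 := Real.exp_pos (-2 * t)
      nlinarith
    have h1 : lam * k (v t) * q t ≤ |lam| * (|v t| * |q t|) := by
      refine (le_abs_self _).trans ?_
      rw [abs_mul, abs_mul, mul_assoc]
      exact mul_le_mul_of_nonneg_left (mul_le_mul_of_nonneg_right (hkabs _) (abs_nonneg _)) (abs_nonneg _)
    have h2 : v t * q t ≤ |v t| * |q t| := by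
      rw [← abs_mul]; exact le_abs_self _
    have h3 : |v t| * |q t| ≤ v t ^ 2 + q t ^ 2 * Real.exp (-2 * t) := by
      have : q t ^ 2 * (1/4) ≤ q t ^ 2 * Real.exp (-2 * t) :=
        mul_le_mul_of_nonneg_left hr (sq_nonneg _)
      nlinarith [sq_nonneg (|v t| - |q t| / 2), sq_abs (v t), sq_abs (q t)]
    have h4 : v t ^ 2 + q t ^ 2 * Real.exp (-2 * t) ≤ 2 * H t := by
      simp only [H]
      have := mul_nonneg hmu (hGn (v t))
      linarith
    have h5 : 0 ≤ q t ^ 2 * Real.exp (-2 * t) := by positivity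
    have h6 := mul_le_mul_of_nonneg_left (h3.trans h4) (show 0 ≤ |lam| + 1 by positivity)
    simp only [H']
    linarith
  have hanti : AntitoneOn (fun x => H x * Real.exp (-(2 * (|lam| + 1)) * x)) (Icc 0 TT) := by
    apply antitoneOn_of_hasDerivWithinAt_nonpos (convex_Icc _ _)
      (f' := fun x => H' x * Real.exp (-(2 * (|lam| + 1)) * x) +
        H x * (Real.exp (-(2 * (|lam| + 1)) * x) * (-(2 * (|lam| + 1)))))
    · intro x hx
      exact ((hHd x hx).continuousAt.mul (by fun_prop)).continuousWithinAt
    · intro x hx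
      rw [interior_Icc] at hx
      have he : HasDerivAt (fun x => Real.exp (-(2 * (|lam| + 1)) * x))
          (Real.exp (-(2 * (|lam| + 1)) * x) * (-(2 * (|lam| + 1)))) x := by
        simpa using ((hasDerivAt_id x).const_mul (-(2 * (|lam| + 1)))).exp
      exact ((hHd x (Ioo_subset_Icc_self hx)).mul he).hasDerivWithinAt
    · intro x hx
      rw [interior_Icc] at hx
      have e0 := mul_nonneg (sub_nonneg.2 (hHb x (Ioo_subset_Icc_self hx)))
        (Real.exp_pos (-(2 * (|lam| + 1)) * x)).le
      linarith [e0]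
  have hvB : ∀ t ∈ Icc 0 TT, |v t| ≤ B := by
    intro t ht
    have h1 := hanti ⟨le_rfl, TT_pos.le⟩ ht ht.1
    have hH0 : H 0 = 1 / 2 := by simp [H, hq0, hv0, hG0]
    simp only [mul_zero, Real.exp_zero, hH0] at h1
    have h2 : H t ≤ 1 / 2 * Real.exp (2 * (|lam| + 1) * t) := by
      have : H t = (H t * Real.exp (-(2 * (|lam| + 1)) * t)) * Real.exp (2 * (|lam| + 1) * t) := by
        rw [mul_assoc, ← Real.exp_add]; simp
      rw [this]
      exact mul_le_mul_of_nonneg_right (by linarith) (Real.exp_pos _).le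
    have h3 : Real.exp (2 * (|lam| + 1) * t) ≤ B ^ 2 := by
      rw [hB, ← Real.exp_nat_mul]
      apply Real.exp_le_exp.2
      push_cast
      have : t ≤ 1 := by linarith [ht.2, TT_lt]
      have := abs_nonneg lam
      nlinarith
    have h4 : v t ^ 2 / 2 ≤ H t := by
      simp only [H]
      have := mul_nonneg hmu (hGn (v t))
      have h5 : 0 ≤ q t ^ 2 * Real.exp (-2 * t) := by positivity
      linarith
    exact abs_le_of_sq_le_sq (by linarith) hB0.le
  refine ⟨v, q, h, hhc, hv0, hq0, hdv, hdq, hvB, ?_⟩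
  intro t ht
  simp only [h, hkid _ (hvB t ht)]

structure IsFlow (p lam mu : ℝ) (v q : ℝ → ℝ) : Prop where
  sol : IsSol p lam mu v q
  v0 : v 0 = 0
  q0 : q 0 = 1
  bd : ∀ t ∈ Icc 0 TT, |v t| ≤ Real.exp (|lam| + 1)
  dvI : ∀ t ∈ Icc 0 TT, HasDerivAt v (q t) t
  dqI : ∀ t ∈ Icc 0 TT, HasDerivAt q (Real.exp (2 * t) * (lam * v t - mu * gp p (v t))) t
  smooth : ContDiffOn ℝ 2 v (Ioo (-1/10 : ℝ) (8/10))

lemma isFlow_exists (p : ℝ) (hp : 6 < p) (lam mu : ℝ) (hmu : 0 ≤ mu) :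
    ∃ v q : ℝ → ℝ, IsFlow p lam mu v q := by
  obtain ⟨v, q, h, hc, hv0, hq0, hdv, hdq, hb, hh⟩ := flow_exists p hp lam mu hmu
  have hdv' : ∀ t ∈ Icc 0 TT, HasDerivAt v (q t) t := fun t ht => hdv t (Icc_sub_ext ht)
  have hdq' : ∀ t ∈ Icc 0 TT, HasDerivAt q (Real.exp (2 * t) * (lam * v t - mu * gp p (v t))) t :=
    fun t ht => by rw [← hh t ht]; exact hdq t (Icc_sub_ext ht)
  refine ⟨v, q, ⟨⟨?_, ?_, ?_, ?_⟩, hv0, hq0, hb, hdv', hdq', ?_⟩⟩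
  · exact fun t ht => (hdv' t ht).continuousAt.continuousWithinAt
  · exact fun t ht => (hdq' t ht).continuousAt.continuousWithinAt
  · exact fun t ht => hdv' t (Ioo_subset_Icc_self ht)
  · exact fun t ht => hdq' t (Ioo_subset_Icc_self ht)
  · have hvc : ContinuousOn v (Ioo (-1/10 : ℝ) (8/10)) :=
      fun t ht => (hdv t ht).continuousAt.continuousWithinAt
    have hq1 : ContDiffOn ℝ 1 q (Ioo (-1/10 : ℝ) (8/10)) := by
      rw [show (1 : WithTop ℕ∞) = 0 + 1 by norm_num, contDiffOn_succ_iff_deriv_of_isOpen isOpen_Ioo]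
      refine ⟨fun t ht => (hdq t ht).differentiableAt.differentiableWithinAt, by simp, ?_⟩
      rw [contDiffOn_zero]
      have : ContinuousOn (fun t => Real.exp (2 * t) * h (v t)) (Ioo (-1/10 : ℝ) (8/10)) := by
        refine ContinuousOn.mul (by fun_prop) (hc.comp_continuousOn hvc)
      exact this.congr (fun t ht => (hdq t ht).deriv)
    rw [show (2 : WithTop ℕ∞) = 1 + 1 by norm_num, contDiffOn_succ_iff_deriv_of_isOpen isOpen_Ioo]
    refine ⟨fun t ht => (hdv t ht).differentiableAt.differentiableWithinAt, by simp, ?_⟩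
    exact hq1.congr (fun t ht => (hdv t ht).deriv)

open Classical in
def FV (p lam mu : ℝ) : ℝ → ℝ :=
  if h : 6 < p ∧ 0 ≤ mu then (isFlow_exists p h.1 lam mu h.2).choose else 0

open Classical in
def FQ (p lam mu : ℝ) : ℝ → ℝ :=
  if h : 6 < p ∧ 0 ≤ mu then (isFlow_exists p h.1 lam mu h.2).choose_spec.choose else 0

lemma flow_spec (p : ℝ) (hp : 6 < p) (lam mu : ℝ) (hmu : 0 ≤ mu) :
    IsFlow p lam mu (FV p lam mu) (FQ p lam mu) := by
  have h : 6 < p ∧ 0 ≤ mu := ⟨hp, hmu⟩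
  rw [FV, FQ, dif_pos h, dif_pos h]
  exact (isFlow_exists p h.1 lam mu h.2).choose_spec.choose_spec

lemma flow_cont (p : ℝ) (hp : 6 < p) (l0 m0 : ℝ) (hm0 : 0 ≤ m0) (e : ℝ) (he : 0 < e) :
    ∃ d > 0, ∀ l m : ℝ, 0 ≤ m → |l - l0| < d → |m - m0| < d →
      ∀ t ∈ Icc 0 TT, |FV p l m t - FV p l0 m0 t| < e ∧ |FQ p l m t - FQ p l0 m0 t| < e := by
  obtain ⟨K, hK, H⟩ := gronwall_two p hp |l0| m0 (Real.exp (|l0| + 2)) (Real.exp_pos _).le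
    (abs_nonneg _) hm0
  refine ⟨min 1 (e / (4 * (K + 1))), by positivity, ?_⟩
  intro l m hm hl hmm t ht
  have F0 := flow_spec p hp l0 m0 hm0
  have F := flow_spec p hp l m hm
  have hd1 : |l - l0| < 1 := hl.trans_le (min_le_left _ _)
  have hd2 : |l - l0| < e / (4 * (K + 1)) := hl.trans_le (min_le_right _ _)
  have hd3 : |m - m0| < e / (4 * (K + 1)) := hmm.trans_le (min_le_right _ _)
  have hll : |l| ≤ |l0| + 1 := by
    have := abs_sub_abs_le_abs_sub l l0; linarith
  have key := H l0 l m0 m _ _ _ _ le_rfl (abs_of_nonneg hm0).le F0.sol F.sol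
    (fun t ht => (F0.bd t ht).trans (Real.exp_le_exp.2 (by linarith)))
    (fun t ht => (F.bd t ht).trans (Real.exp_le_exp.2 (by linarith)))
    0 ⟨le_rfl, TT_pos.le⟩ t ht
  rw [F0.v0, F.v0, F0.q0, F.q0, abs_sub_comm l0 l, abs_sub_comm m0 m] at key
  have h1 : |l - l0| + |m - m0| < e / (2 * (K + 1)) := by
    have : e / (2 * (K + 1)) = e / (4 * (K + 1)) + e / (4 * (K + 1)) := by field_simp; norm_num
    linarith
  have h2 : (|l - l0| + |m - m0|) ^ 2 ≤ (e / (2 * (K + 1))) ^ 2 :=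
    pow_le_pow_left₀ (by positivity) h1.le 2
  have h3 : K * (e / (2 * (K + 1))) ^ 2 < e ^ 2 := by
    rw [div_pow, mul_div_assoc', div_lt_iff₀ (by positivity)]
    have : 0 < e ^ 2 := by positivity
    nlinarith [mul_nonneg hK this.le, mul_nonneg (mul_nonneg hK hK) this.le]
  have h4 := mul_le_mul_of_nonneg_left h2 hK
  have h5 : (FV p l0 m0 t - FV p l m t) ^ 2 + (FQ p l0 m0 t - FQ p l m t) ^ 2 < e ^ 2 := by
    simp only [sub_self] at key
    nlinarith
  constructor
  · rw [abs_sub_comm]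
    exact abs_lt_of_sq_lt_sq (by nlinarith [sq_nonneg (FQ p l0 m0 t - FQ p l m t)]) he.le
  · rw [abs_sub_comm]
    exact abs_lt_of_sq_lt_sq (by nlinarith [sq_nonneg (FV p l0 m0 t - FV p l m t)]) he.le

def PosP (p lam mu : ℝ) : Prop := ∀ t ∈ Ioc 0 TT, 0 < FV p lam mu t
def SolP (p lam mu : ℝ) : Prop := (∀ t ∈ Ioo 0 TT, 0 < FV p lam mu t) ∧ FV p lam mu TT = 0
def NegP (p lam mu : ℝ) : Prop := ∃ t ∈ Ioc 0 TT, FV p lam mu t < 0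

lemma trichotomy_flow (p : ℝ) (hp : 6 < p) (lam mu : ℝ) (hmu : 0 ≤ mu) (hn : ¬ NegP p lam mu) :
    PosP p lam mu ∨ SolP p lam mu := by
  have F := flow_spec p hp lam mu hmu
  have hnn : ∀ t ∈ Ioc 0 TT, 0 ≤ FV p lam mu t := by
    intro t ht
    by_contra hc
    exact hn ⟨t, ht, not_le.1 hc⟩
  have hpos : ∀ t ∈ Ioo 0 TT, 0 < FV p lam mu t := by
    intro t ht
    rcases (hnn t ⟨ht.1, ht.2.le⟩).lt_or_eq with h | h
    · exact h
    exfalso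
    have hmin : IsLocalMin (FV p lam mu) t := by
      filter_upwards [Ioo_mem_nhds ht.1 ht.2] with s hs
      rw [← h]; exact hnn s ⟨hs.1, hs.2.le⟩
    have hq : FQ p lam mu t = 0 := hmin.hasDerivAt_eq_zero (F.sol.dv t ht)
    have := (F.sol.unique hp (IsSol.zero p hp lam mu) (Ioo_subset_Icc_self ht) h.symm hq
      0 ⟨le_rfl, TT_pos.le⟩).2
    rw [F.q0] at this
    exact one_ne_zero this
  rcases (hnn TT ⟨TT_pos, le_rfl⟩).lt_or_eq with h | h
  · left
    intro t ht
    rcases ht.2.lt_or_eq with h2 | h2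
    · exact hpos t ⟨ht.1, h2⟩
    · rw [h2]; exact h
  · right; exact ⟨hpos, h.symm⟩

lemma posP_open (p : ℝ) (hp : 6 < p) (l0 m0 : ℝ) (hm0 : 0 ≤ m0) (h : PosP p l0 m0) :
    ∃ d > 0, ∀ l m : ℝ, 0 ≤ m → |l - l0| < d → |m - m0| < d → PosP p l m := by
  have F := flow_spec p hp l0 m0 hm0
  have hc : ContinuousAt (FQ p l0 m0) 0 := (F.dqI 0 ⟨le_rfl, TT_pos.le⟩).continuousAt
  have h1 : ∀ᶠ t in 𝓝 (0:ℝ), 1 / 2 < FQ p l0 m0 t := by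
    apply hc.eventually_const_lt
    rw [F.q0]; norm_num
  obtain ⟨r, hr, hrq⟩ := Metric.eventually_nhds_iff.1 h1
  set s := min (r / 2) TT with hs
  have hs0 : 0 < s := lt_min (by linarith) TT_pos
  have hsT : s ≤ TT := min_le_right _ _
  have hsr : s < r := (min_le_left _ _).trans_lt (by linarith)
  obtain ⟨x, hx, hxm⟩ := isCompact_Icc.exists_isMinOn (nonempty_Icc.2 hsT)
    (F.sol.cv.mono (Icc_subset_Icc hs0.le le_rfl))
  have hvx : 0 < FV p l0 m0 x := h x ⟨hs0.trans_le hx.1, hx.2⟩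
  obtain ⟨d, hd, H⟩ := flow_cont p hp l0 m0 hm0 (min (FV p l0 m0 x) (1/4)) (by positivity)
  refine ⟨d, hd, ?_⟩
  intro l m hm hl hmm t ht
  have F2 := flow_spec p hp l m hm
  have H' := H l m hm hl hmm
  rcases le_total s t with hst | hst
  · have h2 := (H' t ⟨ht.1.le, ht.2⟩).1.trans_le (min_le_left _ _)
    have h3 : FV p l0 m0 x ≤ FV p l0 m0 t := hxm ⟨hst, ht.2⟩
    rw [abs_lt] at h2
    linarith [h2.1]
  · have hmono : StrictMonoOn (FV p l m) (Icc 0 s) := by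
      apply strictMonoOn_of_hasDerivWithinAt_pos (convex_Icc _ _) (f' := FQ p l m)
        (F2.sol.cv.mono (Icc_subset_Icc le_rfl hsT))
      · intro y hy
        rw [interior_Icc] at hy
        exact (F2.dvI y ⟨hy.1.le, hy.2.le.trans hsT⟩).hasDerivWithinAt
      · intro y hy
        rw [interior_Icc] at hy
        have h4 := (H' y ⟨hy.1.le, hy.2.le.trans hsT⟩).2.trans_le (min_le_right _ _)
        have h5 : 1 / 2 < FQ p l0 m0 y := hrq (by
          rw [Real.dist_eq, sub_zero, abs_of_pos hy.1]; linarith [hy.2])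
        rw [abs_lt] at h4
        linarith [h4.1]
    have := hmono ⟨le_rfl, hs0.le⟩ ⟨ht.1.le, hst⟩ ht.1
    rwa [F2.v0] at this

lemma negP_open (p : ℝ) (hp : 6 < p) (l0 m0 : ℝ) (hm0 : 0 ≤ m0) (h : NegP p l0 m0) :
    ∃ d > 0, ∀ l m : ℝ, 0 ≤ m → |l - l0| < d → |m - m0| < d → NegP p l m := by
  obtain ⟨t, ht, hneg⟩ := h
  obtain ⟨d, hd, H⟩ := flow_cont p hp l0 m0 hm0 (-FV p l0 m0 t) (by linarith)
  refine ⟨d, hd, fun l m hm hl hmm => ⟨t, ht, ?_⟩⟩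
  have := (abs_lt.1 (H l m hm hl hmm t ⟨ht.1.le, ht.2⟩).1).2
  linarith

lemma path_sol (p : ℝ) (hp : 6 < p) (l m : ℝ → ℝ) (hl : Continuous l) (hm : Continuous m)
    (hm0 : ∀ s, 0 ≤ m s) (h0 : PosP p (l 0) (m 0)) (h1 : ¬ PosP p (l 1) (m 1)) :
    ∃ s ∈ Icc (0:ℝ) 1, SolP p (l s) (m s) := by
  by_contra hc
  push Not at hc
  have hopen : ∀ P : ℝ → ℝ → Prop, (∀ l0 m0 : ℝ, 0 ≤ m0 → P l0 m0 →
      ∃ d > 0, ∀ l m : ℝ, 0 ≤ m → |l - l0| < d → |m - m0| < d → P l m) →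
      IsOpen {s | P (l s) (m s)} := by
    intro P hP
    rw [isOpen_iff_mem_nhds]
    intro s hs
    obtain ⟨d, hd, H⟩ := hP _ _ (hm0 s) hs
    have e1 := Metric.tendsto_nhds.1 (hl.tendsto s) d hd
    have e2 := Metric.tendsto_nhds.1 (hm.tendsto s) d hd
    filter_upwards [e1, e2] with x hx1 hx2
    exact H _ _ (hm0 x) hx1 hx2
  have oP := hopen (PosP p) (posP_open p hp)
  have oN := hopen (NegP p) (negP_open p hp)
  have hcov : Icc (0:ℝ) 1 ⊆ {s | PosP p (l s) (m s)} ∪ {s | NegP p (l s) (m s)} := by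
    intro s hs
    by_cases hN : NegP p (l s) (m s)
    · right; exact hN
    · left
      rcases trichotomy_flow p hp _ _ (hm0 s) hN with h | h
      · exact h
      · exact absurd h (hc s hs)
  have hN1 : NegP p (l 1) (m 1) := by
    rcases hcov (right_mem_Icc.2 zero_le_one) with h | h
    · exact absurd h h1
    · exact h
  obtain ⟨s, _, hsP, hsN⟩ := isPreconnected_Icc _ _ oP oN hcov
    ⟨0, left_mem_Icc.2 zero_le_one, h0⟩ ⟨1, right_mem_Icc.2 zero_le_one, hN1⟩
  obtain ⟨t, ht, htn⟩ := hsN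
  exact absurd (hsP t ht) (not_lt.2 htn.le)

/-- limits of solutions are solutions -/
lemma solP_limit (p : ℝ) (hp : 6 < p) (l m : ℕ → ℝ) (l0 m0 : ℝ) (hl : Tendsto l atTop (𝓝 l0))
    (hm : Tendsto m atTop (𝓝 m0)) (hm0 : ∀ n, 0 ≤ m n) (h : ∀ n, SolP p (l n) (m n)) :
    SolP p l0 m0 := by
  have hm00 : 0 ≤ m0 := ge_of_tendsto' hm hm0
  have ev : ∀ d > 0, ∃ n, |l n - l0| < d ∧ |m n - m0| < d := by
    intro d hd
    have e1 := Metric.tendsto_nhds.1 hl d hd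
    have e2 := Metric.tendsto_nhds.1 hm d hd
    obtain ⟨n, hn⟩ := (e1.and e2).exists
    exact ⟨n, hn⟩
  have hN : ¬ NegP p l0 m0 := by
    intro hN
    obtain ⟨d, hd, H⟩ := negP_open p hp l0 m0 hm00 hN
    obtain ⟨n, h1, h2⟩ := ev d hd
    obtain ⟨t, ht, htn⟩ := H _ _ (hm0 n) h1 h2
    rcases ht.2.lt_or_eq with h3 | h3
    · exact absurd ((h n).1 t ⟨ht.1, h3⟩) (not_lt.2 htn.le)
    · rw [h3, (h n).2] at htn; exact lt_irrefl _ htn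
  rcases trichotomy_flow p hp _ _ hm00 hN with h1 | h1
  · obtain ⟨d, hd, H⟩ := posP_open p hp l0 m0 hm00 h1
    obtain ⟨n, h3, h2⟩ := ev d hd
    have := H _ _ (hm0 n) h3 h2 TT ⟨TT_pos, le_rfl⟩
    rw [(h n).2] at this
    exact absurd this (lt_irrefl _)
  · exact h1

lemma rpow_split1 (p x : ℝ) (hx : 0 < x) : x ^ (p - 1) = x ^ (p - 2) * x := by
  conv_rhs => rw [← Real.rpow_add_one hx.ne']
  congr 1; ring

lemma rpow_split2 (p x : ℝ) (hx : 0 < x) : x ^ p = x ^ (p - 2) * x ^ 2 := by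
  rw [← Real.rpow_two, ← Real.rpow_add hx]
  congr 1; ring

lemma gp_split (p x : ℝ) (hx : 0 < x) : gp p x = x ^ (p - 2) * x := by
  rw [gp_of_nonneg p x hx.le, rpow_split1 p x hx]

/-- Picone type estimate: a solution cannot stay large on a long interval -/
lemma osc (p : ℝ) (hp : 6 < p) {lam : ℝ} {u q : ℝ → ℝ} (h : IsSol p lam 1 u q) {x y m : ℝ}
    (hx : 0 ≤ x) (hxy : x ≤ y) (hy : y ≤ TT) (hm : 0 < m) (hum : ∀ t ∈ Icc x y, m ≤ u t) :
    (m ^ (p - 2) - lam) * (y - x) ^ 2 ≤ 10 := by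
  rcases le_or_gt (m ^ (p - 2) - lam) 0 with hc | hc
  · nlinarith [sq_nonneg (y - x)]
  rcases hxy.eq_or_lt with he | hlt
  · rw [he]; norm_num
  set c := m ^ (p - 2) - lam with hcdef
  set l := y - x with hl
  have hl0 : 0 < l := by linarith
  let φ : ℝ → ℝ := fun t => (t - x) * (y - t)
  let F : ℝ → ℝ := fun t => φ t ^ 2 * q t / u t
  let P : ℝ → ℝ := fun t => (l ^ 2 * (t - x) - 2 * l * (t - x) ^ 2 + 4 / 3 * (t - x) ^ 3) -
    c * (l ^ 2 / 3 * (t - x) ^ 3 - l / 2 * (t - x) ^ 4 + 1 / 5 * (t - x) ^ 5)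
  have hsub : Icc x y ⊆ Icc 0 TT := Icc_subset_Icc hx hy
  have hupos : ∀ t ∈ Icc x y, 0 < u t := fun t ht => hm.trans_le (hum t ht)
  have hmono : MonotoneOn (fun t => P t - F t) (Icc x y) := by
    apply monotoneOn_of_hasDerivWithinAt_nonneg (convex_Icc _ _)
      (f' := fun t => ((y + x - 2 * t) ^ 2 - c * φ t ^ 2) -
        (((2 * φ t * (y + x - 2 * t)) * q t + φ t ^ 2 *
          (Real.exp (2 * t) * (lam * u t - 1 * gp p (u t)))) * u t - φ t ^ 2 * q t * q t) / u t ^ 2)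
    · refine ContinuousOn.sub (by fun_prop) ?_
      refine ContinuousOn.div (ContinuousOn.mul (by fun_prop) (h.cq.mono hsub)) (h.cv.mono hsub) ?_
      intro t ht; exact (hupos t ht).ne'
    · intro t ht
      rw [interior_Icc] at ht
      have htI : t ∈ Ioo 0 TT := ⟨hx.trans_lt ht.1, ht.2.trans_le hy⟩
      have hs : HasDerivAt (fun t : ℝ => t - x) 1 t := (hasDerivAt_id t).sub_const x
      have hφ : HasDerivAt φ (y + x - 2 * t) t := by
        have := hs.mul ((hasDerivAt_id t).const_sub y)
        refine this.congr_deriv ?_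
        simp; ring
      have hP : HasDerivAt P ((y + x - 2 * t) ^ 2 - c * φ t ^ 2) t := by
        have := (((hs.const_mul (l ^ 2)).sub ((hs.pow 2).const_mul (2 * l))).add
          ((hs.pow 3).const_mul (4 / 3))).sub ((((((hs.pow 3).const_mul (l ^ 2 / 3)).sub
          ((hs.pow 4).const_mul (l / 2))).add ((hs.pow 5).const_mul (1 / 5)))).const_mul c)
        refine this.congr_deriv ?_
        simp only [φ, hl]; push_cast; ring
      have hF := ((hφ.pow 2).mul (h.dq t htI)).div (h.dv t htI) (hupos t (Ioo_subset_Icc_self ht)).ne'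
      refine (hP.sub hF).hasDerivWithinAt.congr_deriv ?_
      simp
    · intro t ht
      rw [interior_Icc] at ht
      have hu := hupos t (Ioo_subset_Icc_self ht)
      have hr := exp2_ge (hx.trans ht.1.le)
      have hmu : m ^ (p - 2) ≤ u t ^ (p - 2) :=
        Real.rpow_le_rpow hm.le (hum t (Ioo_subset_Icc_self ht)) (by linarith)
      rw [gp_split p _ hu]
      set r := Real.exp (2 * t)
      set w := u t ^ (p - 2)
      have e : ((y + x - 2 * t) ^ 2 - c * φ t ^ 2) -
        (((2 * φ t * (y + x - 2 * t)) * q t + φ t ^ 2 *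
          (r * (lam * u t - 1 * (w * u t)))) * u t - φ t ^ 2 * q t * q t) / u t ^ 2 =
        ((y + x - 2 * t) - φ t * (q t / u t)) ^ 2 + φ t ^ 2 * (r * (w - lam) - c) := by
        field_simp; ring
      rw [e]
      have : 0 ≤ r * (w - lam) - c := by nlinarith
      positivity
  have := hmono (left_mem_Icc.2 hxy) (right_mem_Icc.2 hxy) hxy
  simp only [P, F, φ] at this
  rw [← hl] at this
  simp only [sub_self] at this
  have h3 : c * l ^ 5 / 30 ≤ l ^ 3 / 3 := by
    ring_nf at this ⊢
    linarith
  have h4 : c * l ^ 2 * l ^ 3 ≤ 10 * l ^ 3 := by nlinarith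
  exact le_of_mul_le_mul_right h4 (by positivity)

lemma ge_between {u q : ℝ → ℝ} {x y A : ℝ} (hxy : x ≤ y) (hc : ContinuousOn u (Icc x y))
    (hd : ∀ t ∈ Ioo x y, HasDerivAt u (q t) t) (hne : ∀ t ∈ Ioo x y, u t < A → q t ≠ 0)
    (hx : A ≤ u x) (hy : A ≤ u y) : ∀ t ∈ Icc x y, A ≤ u t := by
  obtain ⟨z, hz, hzm⟩ := isCompact_Icc.exists_isMinOn (nonempty_Icc.2 hxy) hc
  intro t ht
  refine le_trans ?_ (hzm ht)
  by_contra hlt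
  push Not at hlt
  have hzx : z ≠ x := by rintro rfl; linarith
  have hzy : z ≠ y := by rintro rfl; linarith
  have hzI : z ∈ Ioo x y := ⟨lt_of_le_of_ne hz.1 hzx.symm, lt_of_le_of_ne hz.2 hzy⟩
  have hloc : IsLocalMin u z := hzm.isLocalMin (Icc_mem_nhds hzI.1 hzI.2)
  exact hne z hzI hlt (hloc.hasDerivAt_eq_zero (hd z hzI))

set_option maxHeartbeats 1000000 in
lemma bound_slope (p : ℝ) (hp : 6 < p) (Lam : ℝ) (hLam : 0 ≤ Lam) :
    ∃ A0 : ℝ, 0 < A0 ∧ ∀ lam : ℝ, |lam| ≤ Lam → ∀ u q : ℝ → ℝ, IsSol p lam 1 u q → u 0 = 0 →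
      (∀ t ∈ Ioo 0 TT, 0 < u t) → q 0 ≤ A0 := by
  set M := p * Lam + 251 with hM
  have hpL : 6 * Lam ≤ p * Lam := mul_le_mul_of_nonneg_right hp.le hLam
  have hM1 : 1 ≤ M := by linarith
  have hM0 : 0 < M := by linarith
  have hMp : 0 < M ^ p := Real.rpow_pos_of_pos hM0 p
  have hMM : M ≤ M ^ (p - 2) := by
    conv_lhs => rw [← Real.rpow_one M]
    exact Real.rpow_le_rpow_of_exponent_le hM1 (by linarith)
  refine ⟨12 * Lam * M ^ 2 + 8 * M ^ p + 25 * M ^ 2 + 1, by positivity, ?_⟩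
  intro lam hlam u q h hu0 hpos
  by_contra hcon
  push Not at hcon
  have hl1 := le_of_abs_le hlam
  have hl2 := neg_le_of_abs_le hlam
  set a := q 0 with ha
  have ha2 : 12 * Lam * M ^ 2 + 8 * M ^ p + 25 * M ^ 2 < a ^ 2 := by
    have : 0 ≤ 12 * Lam * M ^ 2 + 8 * M ^ p + 25 * M ^ 2 := by positivity
    nlinarith
  let S : ℝ → ℝ := fun t => q t ^ 2 / 2 + Real.exp (2 * t) * (-lam * u t ^ 2 / 2 + u t ^ p / p)
  have hT := TT_pos
  have hT1 := TT_lt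
  have hT2 := TT_gt
  have hmono : MonotoneOn (fun t => S t + 4 * Lam * M ^ 2 * t) (Icc 0 TT) := by
    apply monotoneOn_of_hasDerivWithinAt_nonneg (convex_Icc _ _)
      (f' := fun t => 2 * Real.exp (2 * t) * (-lam * u t ^ 2 / 2 + u t ^ p / p) + 4 * Lam * M ^ 2)
    · refine ContinuousOn.add (ContinuousOn.add ((h.cq.pow 2).div_const 2)
        (ContinuousOn.mul (by fun_prop) (ContinuousOn.add ((continuousOn_const.mul (h.cv.pow 2)).div_const 2)
        ((h.cv.rpow_const (fun _ _ => Or.inr (by linarith))).div_const p)))) (by fun_prop)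
    · intro t ht
      rw [interior_Icc] at ht
      have hup := hpos t ht
      have he : HasDerivAt (fun x => Real.exp (2 * x)) (Real.exp (2 * t) * 2) t := by
        simpa using ((hasDerivAt_id t).const_mul 2).exp
      have hd := ((((h.dq t ht).pow 2).div_const 2).add (he.mul (((((h.dv t ht).pow 2).const_mul
        (-lam)).div_const 2).add (((h.dv t ht).rpow_const (p := p) (Or.inl hup.ne')).div_const p)))).add
        ((hasDerivAt_id t).const_mul (4 * Lam * M ^ 2))
      refine hd.hasDerivWithinAt.congr_deriv ?_
      rw [gp_of_nonneg p _ hup.le]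
      simp only [Pi.pow_apply, Pi.add_apply]
      have hp0 : p ≠ 0 := by linarith
      field_simp
      push_cast
      ring
    · intro t ht
      rw [interior_Icc] at ht
      have hup := hpos t ht
      have hr1 := exp2_le ht.2.le
      have hr2 := exp2_ge ht.1.le
      have key : -(Lam * M ^ 2 / 2) ≤ -lam * u t ^ 2 / 2 + u t ^ p / p := by
        rcases le_total (u t) M with hle | hge
        · have h1 : 0 ≤ u t ^ p / p := div_nonneg (Real.rpow_nonneg hup.le _) (by linarith)
          have h2 : u t ^ 2 ≤ M ^ 2 := pow_le_pow_left₀ hup.le hle 2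
          nlinarith [mul_le_mul_of_nonneg_right hl1 (sq_nonneg (u t)), mul_le_mul_of_nonneg_left h2 hLam]
        · rw [rpow_split2 p _ hup]
          have h3 : M ≤ u t ^ (p - 2) := hMM.trans (Real.rpow_le_rpow hM0.le hge (by linarith))
          have h4 : Lam ≤ u t ^ (p - 2) / p := by
            rw [le_div_iff₀ (by linarith)]; linarith
          have e : u t ^ (p - 2) * u t ^ 2 / p = (u t ^ (p - 2) / p) * u t ^ 2 := by ring
          rw [e]
          have h5 := mul_le_mul_of_nonneg_right h4 (sq_nonneg (u t))
          have h6 := mul_le_mul_of_nonneg_right hl1 (sq_nonneg (u t))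
          have : 0 ≤ Lam * M ^ 2 / 2 := by positivity
          nlinarith [sq_nonneg (u t), mul_nonneg hLam (sq_nonneg (u t))]
      have h0 : 0 ≤ Lam * M ^ 2 / 2 := by positivity
      nlinarith
  have hqbig : ∀ t ∈ Ioo 0 TT, u t ≤ M → 5 * M < |q t| := by
    intro t ht hut
    have hup := hpos t ht
    have h1 := hmono ⟨le_rfl, hT.le⟩ (Ioo_subset_Icc_self ht) ht.1.le
    have hS0 : S 0 = a ^ 2 / 2 := by
      simp only [S, hu0]; rw [Real.zero_rpow (by linarith)]; simp [ha]
    simp only [hS0, S] at h1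
    have hr1 := exp2_le ht.2.le
    have hr2 := exp2_ge ht.1.le
    have hLM : 0 ≤ Lam * M ^ 2 := by positivity
    have h2 : -lam * u t ^ 2 / 2 + u t ^ p / p ≤ Lam * M ^ 2 / 2 + M ^ p := by
      have h2 : u t ^ 2 ≤ M ^ 2 := pow_le_pow_left₀ hup.le hut 2
      have h3 : u t ^ p ≤ M ^ p := Real.rpow_le_rpow hup.le hut (by linarith)
      have h4 : u t ^ p / p ≤ M ^ p := by
        rw [div_le_iff₀ (by linarith)]; nlinarith
      nlinarith [mul_le_mul_of_nonneg_right hl2 (sq_nonneg (u t)), mul_le_mul_of_nonneg_left h2 hLam]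
    have h3 : Real.exp (2 * t) * (-lam * u t ^ 2 / 2 + u t ^ p / p) ≤ 4 * (Lam * M ^ 2 / 2 + M ^ p) := by
      have := mul_le_mul_of_nonneg_left h2 (show 0 ≤ Real.exp (2 * t) by linarith)
      have h5 := mul_le_mul_of_nonneg_right hr1 (show 0 ≤ Lam * M ^ 2 / 2 + M ^ p by positivity)
      linarith
    have ht1 : t ≤ 1 := by linarith [ht.2]
    have h6 : 4 * Lam * M ^ 2 * t ≤ 4 * Lam * M ^ 2 := by nlinarith
    have h7 : (5 * M) ^ 2 < q t ^ 2 := by nlinarith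
    have := sq_lt_sq.1 h7
    rwa [abs_of_pos (by linarith)] at this
  have hex : ∀ x y, 0 ≤ x → x + 3 / 10 * TT ≤ y → y < TT → 0 ≤ u x → ∃ r ∈ Icc x y, M ≤ u r := by
    intro x y hx hxy hy hux
    by_contra hcc
    push Not at hcc
    have hlt : x < y := by linarith
    obtain ⟨ξ, hξ, he⟩ := exists_hasDerivAt_eq_slope u q hlt (h.cv.mono (Icc_subset_Icc hx hy.le))
      (fun t ht => h.dv t ⟨hx.trans_lt ht.1, ht.2.trans hy⟩)
    have h1 := hqbig ξ ⟨hx.trans_lt hξ.1, hξ.2.trans hy⟩ (hcc ξ (Ioo_subset_Icc_self hξ)).le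
    rw [he, abs_div, abs_of_pos (show 0 < y - x by linarith), lt_div_iff₀ (by linarith)] at h1
    have h2 : |u y - u x| ≤ M := by
      have a1 := hcc x (left_mem_Icc.2 hlt.le)
      have a2 := hcc y (right_mem_Icc.2 hlt.le)
      have a3 := hpos y ⟨by linarith, hy⟩
      rw [abs_le]; constructor <;> linarith
    nlinarith
  obtain ⟨r1, hr1, hur1⟩ := hex 0 (TT / 3) le_rfl (by linarith) (by linarith) hu0.ge
  obtain ⟨r2, hr2, hur2⟩ := hex (2 * TT / 3) (29 / 30 * TT) (by linarith) (by linarith) (by linarith)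
    (hpos _ ⟨by linarith, by linarith⟩).le
  have hr12 : r1 ≤ r2 := by linarith [hr1.2, hr2.1]
  have hbet := ge_between hr12 (h.cv.mono (Icc_subset_Icc hr1.1 (by linarith [hr2.2])))
    (fun t ht => h.dv t ⟨hr1.1.trans_lt ht.1, by linarith [ht.2, hr2.2]⟩)
    (fun t ht hlt hq => by
      have := hqbig t ⟨hr1.1.trans_lt ht.1, by linarith [ht.2, hr2.2]⟩ hlt.le
      rw [hq, abs_zero] at this; linarith) hur1 hur2
  have := osc p hp h hr1.1 hr12 (by linarith [hr2.2]) hM0 hbet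
  have h8 : 23 / 100 ≤ r2 - r1 := by linarith [hr1.2, hr2.1]
  have h9 : 251 ≤ M ^ (p - 2) - lam := by linarith
  nlinarith [mul_le_mul h9 (pow_le_pow_left₀ (by norm_num) h8 2) (by norm_num) (by linarith)]

lemma IsSol.scale {p lam mu : ℝ} {v q : ℝ → ℝ} (h : IsSol p lam mu v q) {a : ℝ}
    (ha : 0 < a) (ham : a ^ (p - 2) = mu) : IsSol p lam 1 (fun t => a * v t) (fun t => a * q t) where
  cv := continuousOn_const.mul h.cv
  cq := continuousOn_const.mul h.cq
  dv := fun t ht => (h.dv t ht).const_mul a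
  dq := fun t ht => by
    refine ((h.dq t ht).const_mul a).congr_deriv ?_
    have : gp p (a * v t) = mu * a * gp p (v t) := by
      unfold gp
      have : max (a * v t) 0 = a * max (v t) 0 := by
        rw [mul_max_of_nonneg _ _ ha.le, mul_zero]
      rw [this, Real.mul_rpow ha.le (le_max_right _ _), rpow_split1 p a ha, ham]
    rw [this]; ring

lemma bound_mu (p : ℝ) (hp : 6 < p) (Lam : ℝ) (hLam : 0 ≤ Lam) :
    ∃ M0 : ℝ, 0 < M0 ∧ ∀ lam mu : ℝ, |lam| ≤ Lam → M0 < mu →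
      ¬ (∀ t ∈ Ioo 0 TT, 0 < FV p lam mu t) := by
  obtain ⟨A0, hA0, H⟩ := bound_slope p hp Lam hLam
  refine ⟨A0 ^ (p - 2), Real.rpow_pos_of_pos hA0 _, ?_⟩
  intro lam mu hlam hmu hpos
  have hmu0 : 0 < mu := (Real.rpow_pos_of_pos hA0 _).trans hmu
  have F := flow_spec p hp lam mu hmu0.le
  set a := mu ^ (1 / (p - 2)) with ha
  have ha0 : 0 < a := Real.rpow_pos_of_pos hmu0 _
  have ham : a ^ (p - 2) = mu := by
    rw [ha, ← Real.rpow_mul hmu0.le, one_div, inv_mul_cancel₀ (by linarith), Real.rpow_one]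
  have := H lam hlam _ _ (F.sol.scale ha0 ham) (by simp [F.v0]) (fun t ht => mul_pos ha0 (hpos t ht))
  simp only [F.q0, mul_one] at this
  have h2 := Real.rpow_le_rpow ha0.le this (show 0 ≤ p - 2 by linarith)
  linarith

def bt (p : ℝ) : ℝ := 2 / (p + 2)

def Jf (p lam : ℝ) (u q : ℝ → ℝ) (t : ℝ) : ℝ :=
  Real.exp (-(2 * bt p) * t) * (q t ^ 2 / 2 + bt p * (u t * q t) + bt p ^ 2 * u t ^ 2 +
    Real.exp (2 * t) * (-lam * u t ^ 2 / 2 + u t ^ p / p))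

def Gf (p lam : ℝ) (t : ℝ) : ℝ :=
  Real.exp (-(2 * bt p) * t) * (-2 * bt p ^ 3 - lam * ((p - 2) / (p + 2)) * Real.exp (2 * t))

/-- Dirichlet positive solutions -/
structure IsDir (p lam : ℝ) (u q : ℝ → ℝ) : Prop where
  sol : IsSol p lam 1 u q
  u0 : u 0 = 0
  uT : u TT = 0
  pos : ∀ t ∈ Ioo 0 TT, 0 < u t

lemma exp2_deriv (t : ℝ) : HasDerivAt (fun x => Real.exp (2 * x)) (Real.exp (2 * t) * 2) t := by
  simpa using ((hasDerivAt_id t).const_mul 2).exp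

lemma Jf_deriv (p : ℝ) (hp : 6 < p) {lam : ℝ} {u q : ℝ → ℝ} (h : IsDir p lam u q) {t : ℝ}
    (ht : t ∈ Ioo 0 TT) : HasDerivAt (Jf p lam u q) (Gf p lam t * u t ^ 2) t := by
  have hup := h.pos t ht
  have h1 : HasDerivAt (fun x => Real.exp (-(2 * bt p) * x))
      (Real.exp (-(2 * bt p) * t) * (-(2 * bt p))) t := by
    simpa using ((hasDerivAt_id t).const_mul (-(2 * bt p))).exp
  have hv := h.sol.dv t ht
  have hq := h.sol.dq t ht
  have hd := h1.mul (((((hq.pow 2).div_const 2).add ((hv.mul hq).const_mul (bt p))).add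
    ((hv.pow 2).const_mul (bt p ^ 2))).add ((exp2_deriv t).mul ((((hv.pow 2).const_mul
        (-lam)).div_const 2).add ((hv.rpow_const (p := p) (Or.inl hup.ne')).div_const p))))
  refine hd.congr_deriv ?_
  simp only [Pi.pow_apply, Pi.add_apply, Pi.mul_apply, Gf]
  rw [gp_split p _ hup, rpow_split2 p _ hup, rpow_split1 p _ hup]
  set E := Real.exp (-(2 * bt p) * t)
  set r := Real.exp (2 * t)
  set w := u t ^ (p - 2)
  have hb : bt p * (p + 2) = 2 := by
    unfold bt; rw [div_mul_cancel₀]; linarith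
  have hb2 : (p - 2) / (p + 2) = 1 - 2 * bt p := by
    unfold bt; have : p + 2 ≠ 0 := by linarith
    field_simp; ring
  rw [hb2]
  have hp0 : p ≠ 0 := by linarith
  have hpb : 1 / p = bt p / (2 - 2 * bt p) := by
    have : p * bt p = 2 - 2 * bt p := by linarith
    rw [← this]; have : bt p ≠ 0 := by unfold bt; apply div_ne_zero <;> linarith
    field_simp
  have e : (2 - 2 * bt p) * (1 / p) = bt p := by
    have : p * bt p = 2 - 2 * bt p := by linarith
    rw [← this]; field_simp
  have e2 : w * u t * q t * p / p = w * u t * q t := by field_simp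
  have key : ∀ z : ℝ, z / p = z * (1 / p) := fun z => by ring
  have e3 : p * (1 / p) = 1 := by field_simp
  rw [key, key]
  set k := 1 / p
  push_cast
  simp only [pow_one]
  linear_combination (E * r * w * u t ^ 2) * e + (E * r * q t * (w * u t)) * e3

lemma Jf_cont (p : ℝ) (hp : 6 < p) {lam : ℝ} {u q : ℝ → ℝ} (h : IsDir p lam u q) :
    ContinuousOn (Jf p lam u q) (Icc 0 TT) := by
  have h1 := h.sol.cv
  have h2 := h.sol.cq
  have h3 : ContinuousOn (fun t => u t ^ p) (Icc 0 TT) := h1.rpow_const (fun _ _ => Or.inr (by linarith))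
  unfold Jf
  fun_prop

lemma Jf_zero (p : ℝ) (hp : 6 < p) {lam : ℝ} {u q : ℝ → ℝ} {t : ℝ} (h : u t = 0) :
    Jf p lam u q t = Real.exp (-(2 * bt p) * t) * (q t ^ 2 / 2) := by
  unfold Jf; rw [h, Real.zero_rpow (by linarith)]; simp

lemma bt_pos (p : ℝ) (hp : 6 < p) : 0 < bt p := by unfold bt; apply div_pos <;> linarith

lemma Jf_pos (p : ℝ) (hp : 6 < p) {lam : ℝ} {u q : ℝ → ℝ} (h : IsDir p lam u q) {t : ℝ}
    (ht : t ∈ Ioo 0 TT) : 0 < Jf p lam u q t := by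
  have hb := bt_pos p hp
  rcases le_or_gt lam 0 with hl | hl
  · have hup := h.pos t ht
    unfold Jf
    apply mul_pos (Real.exp_pos _)
    have h1 : 0 ≤ Real.exp (2 * t) * (-lam * u t ^ 2 / 2 + u t ^ p / p) := by
      apply mul_nonneg (Real.exp_pos _).le
      have : 0 ≤ u t ^ p / p := div_nonneg (Real.rpow_nonneg hup.le _) (by linarith)
      have : 0 ≤ -lam * u t ^ 2 := mul_nonneg (by linarith) (sq_nonneg _)
      linarith
    have h2 : 0 < bt p ^ 2 * u t ^ 2 := by positivity
    nlinarith [sq_nonneg (q t + bt p * u t)]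
  · have hanti : StrictAntiOn (Jf p lam u q) (Icc 0 TT) := by
      apply strictAntiOn_of_deriv_neg (convex_Icc _ _) (Jf_cont p hp h)
      intro s hs
      rw [interior_Icc] at hs
      rw [(Jf_deriv p hp h hs).deriv]
      have hup := h.pos s hs
      apply mul_neg_of_neg_of_pos _ (by positivity)
      unfold Gf
      apply mul_neg_of_pos_of_neg (Real.exp_pos _)
      have h1 : 0 < lam * ((p - 2) / (p + 2)) * Real.exp (2 * s) := by
        apply mul_pos (mul_pos hl (div_pos (by linarith) (by linarith))) (Real.exp_pos _)
      have : 0 < bt p ^ 3 := by positivity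
      linarith
    have := hanti (Ioo_subset_Icc_self ht) (right_mem_Icc.2 TT_pos.le) ht.2
    rw [Jf_zero p hp h.uT] at this
    have h0 : 0 ≤ Real.exp (-(2 * bt p) * TT) * (q TT ^ 2 / 2) := by positivity
    linarith

lemma IsDir.q0_pos {p : ℝ} (hp : 6 < p) {lam : ℝ} {u q : ℝ → ℝ} (h : IsDir p lam u q) : 0 < q 0 := by
  have hT := TT_pos
  have hne : q 0 ≠ 0 := by
    intro h0
    have := (h.sol.unique hp (IsSol.zero p hp lam 1) (left_mem_Icc.2 hT.le) h.u0 h0 (TT / 2)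
      ⟨by linarith, by linarith⟩).1
    have h2 := h.pos (TT / 2) ⟨by linarith, by linarith⟩
    linarith
  rcases lt_or_gt_of_ne hne with hlt | hgt
  · exfalso
    have hev : ∀ᶠ t in 𝓝[Icc 0 TT] 0, q t < 0 :=
      (h.sol.cq 0 (left_mem_Icc.2 hT.le)).eventually_lt_const hlt
    rw [nhdsWithin_Icc_eq_nhdsGE hT] at hev
    obtain ⟨d, hd, hd2⟩ := mem_nhdsGE_iff_exists_Ico_subset.1 hev
    have hd0 : (0:ℝ) < d := hd
    set e := min (d / 2) (TT / 2)
    have he : 0 < e := lt_min (by linarith) (by linarith)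
    have he1 : e ≤ d / 2 := min_le_left _ _
    have he2 : e ≤ TT / 2 := min_le_right _ _
    have hanti : StrictAntiOn u (Icc 0 e) := by
      apply strictAntiOn_of_deriv_neg (convex_Icc _ _) (h.sol.cv.mono (Icc_subset_Icc le_rfl (by linarith)))
      intro s hs
      rw [interior_Icc] at hs
      rw [(h.sol.dv s ⟨hs.1, by linarith [hs.2]⟩).deriv]
      exact hd2 ⟨hs.1.le, by linarith [hs.2]⟩
    have := hanti (left_mem_Icc.2 he.le) (right_mem_Icc.2 he.le) he
    rw [h.u0] at this
    linarith [h.pos e ⟨he, by linarith⟩]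
  · exact hgt

lemma IsDir.qT_ne {p : ℝ} (hp : 6 < p) {lam : ℝ} {u q : ℝ → ℝ} (h : IsDir p lam u q) : q TT ≠ 0 := by
  have hT := TT_pos
  intro h0
  have := (h.sol.unique hp (IsSol.zero p hp lam 1) (right_mem_Icc.2 hT.le) h.uT h0 (TT / 2)
    ⟨by linarith, by linarith⟩).1
  have h2 := h.pos (TT / 2) ⟨by linarith, by linarith⟩
  linarith

lemma nhdsGT_le_Icc : 𝓝[>] (0:ℝ) ≤ 𝓝[Icc 0 TT] 0 := by
  rw [nhdsWithin_Icc_eq_nhdsGE TT_pos]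
  exact nhdsWithin_mono _ Ioi_subset_Ici_self

lemma nhdsLT_le_Icc : 𝓝[<] TT ≤ 𝓝[Icc 0 TT] TT := by
  rw [nhdsWithin_Icc_eq_nhdsLE TT_pos]
  exact nhdsWithin_mono _ Iio_subset_Iic_self

lemma ratio0 {p : ℝ} (hp : 6 < p) {lam : ℝ} {u1 q1 u2 q2 : ℝ → ℝ} (h1 : IsDir p lam u1 q1)
    (h2 : IsDir p lam u2 q2) : Tendsto (fun t => u2 t / u1 t) (𝓝[>] 0) (𝓝 (q2 0 / q1 0)) := by
  have hT := TT_pos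
  have hI := left_mem_Icc.2 hT.le
  have hev : ∀ᶠ t in 𝓝[>] (0:ℝ), t ∈ Ioo 0 TT := Ioo_mem_nhdsGT hT
  have c1 : Tendsto q1 (𝓝[>] 0) (𝓝 (q1 0)) := (h1.sol.cq 0 hI).mono_left nhdsGT_le_Icc
  have c2 : Tendsto q2 (𝓝[>] 0) (𝓝 (q2 0)) := (h2.sol.cq 0 hI).mono_left nhdsGT_le_Icc
  have d1 : Tendsto u1 (𝓝[>] 0) (𝓝 0) := by
    have := (h1.sol.cv 0 hI).mono_left nhdsGT_le_Icc; rwa [h1.u0] at this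
  have d2 : Tendsto u2 (𝓝[>] 0) (𝓝 0) := by
    have := (h2.sol.cv 0 hI).mono_left nhdsGT_le_Icc; rwa [h2.u0] at this
  exact HasDerivAt.lhopital_zero_nhdsGT (hev.mono fun t ht => h2.sol.dv t ht)
    (hev.mono fun t ht => h1.sol.dv t ht) (c1.eventually_ne (h1.q0_pos hp).ne') d2 d1
    (c2.div c1 (h1.q0_pos hp).ne')

lemma ratioT {p : ℝ} (hp : 6 < p) {lam : ℝ} {u1 q1 u2 q2 : ℝ → ℝ} (h1 : IsDir p lam u1 q1)
    (h2 : IsDir p lam u2 q2) : Tendsto (fun t => u2 t / u1 t) (𝓝[<] TT) (𝓝 (q2 TT / q1 TT)) := by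
  have hT := TT_pos
  have hI := right_mem_Icc.2 hT.le
  have hev : ∀ᶠ t in 𝓝[<] TT, t ∈ Ioo 0 TT := Ioo_mem_nhdsLT hT
  have c1 : Tendsto q1 (𝓝[<] TT) (𝓝 (q1 TT)) := (h1.sol.cq TT hI).mono_left nhdsLT_le_Icc
  have c2 : Tendsto q2 (𝓝[<] TT) (𝓝 (q2 TT)) := (h2.sol.cq TT hI).mono_left nhdsLT_le_Icc
  have d1 : Tendsto u1 (𝓝[<] TT) (𝓝 0) := by
    have := (h1.sol.cv TT hI).mono_left nhdsLT_le_Icc; rwa [h1.uT] at this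
  have d2 : Tendsto u2 (𝓝[<] TT) (𝓝 0) := by
    have := (h2.sol.cv TT hI).mono_left nhdsLT_le_Icc; rwa [h2.uT] at this
  exact HasDerivAt.lhopital_zero_nhdsLT (hev.mono fun t ht => h2.sol.dv t ht)
    (hev.mono fun t ht => h1.sol.dv t ht) (c1.eventually_ne (h1.qT_ne hp)) d2 d1
    (c2.div c1 (h1.qT_ne hp))

set_option maxHeartbeats 1000000 in
lemma no_two {p : ℝ} (hp : 6 < p) {lam : ℝ} {u1 q1 u2 q2 : ℝ → ℝ} (h1 : IsDir p lam u1 q1)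
    (h2 : IsDir p lam u2 q2) (hlt : q2 0 < q1 0) : False := by
  have hT := TT_pos
  have hI0 := left_mem_Icc.2 hT.le
  have hIT := right_mem_Icc.2 hT.le
  have hq10 := h1.q0_pos hp
  let w : ℝ → ℝ := fun t => u2 t / u1 t
  let W : ℝ → ℝ := fun t => q2 t * u1 t - q1 t * u2 t
  let X : ℝ → ℝ := fun t => Jf p lam u2 q2 t - w t ^ 2 * Jf p lam u1 q1 t
  have hw : ∀ t ∈ Ioo 0 TT, HasDerivAt w (W t / u1 t ^ 2) t := by
    intro t ht
    refine ((h2.sol.dv t ht).div (h1.sol.dv t ht) (h1.pos t ht).ne').congr_deriv ?_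
    simp only [W]; ring
  have hW : ∀ t ∈ Ioo 0 TT, HasDerivAt W
      (Real.exp (2 * t) * (u1 t * u2 t) * (u1 t ^ (p - 2) - u2 t ^ (p - 2))) t := by
    intro t ht
    refine (((h2.sol.dq t ht).mul (h1.sol.dv t ht)).sub
      ((h1.sol.dq t ht).mul (h2.sol.dv t ht))).congr_deriv ?_
    rw [gp_split p _ (h1.pos t ht), gp_split p _ (h2.pos t ht)]; ring
  have hX : ∀ t ∈ Ioo 0 TT, HasDerivAt X (-(2 * w t * (W t / u1 t ^ 2) * Jf p lam u1 q1 t)) t := by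
    intro t ht
    refine ((Jf_deriv p hp h2 ht).sub (((hw t ht).pow 2).mul (Jf_deriv p hp h1 ht))).congr_deriv ?_
    have := (h1.pos t ht).ne'
    simp only [Pi.pow_apply, w]
    push_cast
    simp only [pow_one]
    field_simp
    ring
  have cW : ContinuousOn W (Icc 0 TT) := (h2.sol.cq.mul h1.sol.cv).sub (h1.sol.cq.mul h2.sol.cv)
  have hW0 : W 0 = 0 := by simp [W, h1.u0, h2.u0]
  have X0 : Tendsto X (𝓝[>] 0) (𝓝 0) := by
    have a1 := ((Jf_cont p hp h1) 0 hI0).mono_left nhdsGT_le_Icc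
    have a2 := ((Jf_cont p hp h2) 0 hI0).mono_left nhdsGT_le_Icc
    have := a2.sub (((ratio0 hp h1 h2).pow 2).mul a1)
    convert this using 2
    rw [Jf_zero p hp h1.u0, Jf_zero p hp h2.u0]
    field_simp; ring
  have XT : Tendsto X (𝓝[<] TT) (𝓝 0) := by
    have a1 := ((Jf_cont p hp h1) TT hIT).mono_left nhdsLT_le_Icc
    have a2 := ((Jf_cont p hp h2) TT hIT).mono_left nhdsLT_le_Icc
    have := a2.sub (((ratioT hp h1 h2).pow 2).mul a1)
    convert this using 2
    rw [Jf_zero p hp h1.uT, Jf_zero p hp h2.uT]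
    have := h1.qT_ne hp
    field_simp; ring
  -- W is positive near zero
  obtain ⟨d, hd0, hd⟩ : ∃ d > 0, ∀ t ∈ Ioo 0 d, w t < 1 := by
    have : ∀ᶠ t in 𝓝[>] (0:ℝ), w t < 1 :=
      (ratio0 hp h1 h2).eventually_lt_const ((div_lt_one hq10).2 hlt)
    obtain ⟨d, hd, hd2⟩ := mem_nhdsGT_iff_exists_Ioo_subset.1 this
    exact ⟨d, hd, fun t ht => hd2 ht⟩
  -- if w < 1 on (0,s) then W s > 0
  have hWpos : ∀ s, 0 < s → s ≤ TT → (∀ t ∈ Ioo 0 s, w t < 1) → 0 < W s := by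
    intro s hs0 hs1 hws
    have hm : StrictMonoOn W (Icc 0 s) := by
      apply strictMonoOn_of_deriv_pos (convex_Icc _ _) (cW.mono (Icc_subset_Icc le_rfl hs1))
      intro t ht
      rw [interior_Icc] at ht
      have htI : t ∈ Ioo 0 TT := ⟨ht.1, ht.2.trans_le hs1⟩
      rw [(hW t htI).deriv]
      have b1 := h1.pos t htI
      have b2 := h2.pos t htI
      have b3 := (div_lt_one b1).1 (hws t ht)
      have := Real.rpow_lt_rpow b2.le b3 (show 0 < p - 2 by linarith)
      have := Real.exp_pos (2 * t)
      apply mul_pos (by positivity) (by linarith)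
    have := hm (left_mem_Icc.2 hs0.le) (right_mem_Icc.2 hs0.le) hs0
    rwa [hW0] at this
  -- consequences of W>0 on (0,s)
  have hXanti : ∀ s, s ≤ TT → (∀ t ∈ Ioo 0 s, 0 < W t) → StrictAntiOn X (Ioc 0 s ∩ Ioo 0 TT) := by
    intro s hs hpos
    apply strictAntiOn_of_deriv_neg ((convex_Ioc _ _).inter (convex_Ioo _ _))
    · intro t ht; exact (hX t ht.2).continuousAt.continuousWithinAt
    · intro t ht
      rw [interior_inter, interior_Ioc, interior_Ioo] at ht
      rw [(hX t ht.2).deriv]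
      have := hpos t ht.1
      have := h1.pos t ht.2
      have h2p := h2.pos t ht.2
      have := Jf_pos p hp h1 ht.2
      have : 0 < w t := div_pos h2p (h1.pos t ht.2)
      have : 0 < 2 * w t * (W t / u1 t ^ 2) * Jf p lam u1 q1 t := by positivity
      linarith
  have hXneg : ∀ s, s ≤ TT → (∀ t ∈ Ioo 0 s, 0 < W t) → ∀ t ∈ Ioc 0 s ∩ Ioo 0 TT, X t < 0 := by
    intro s hs hpos t ht
    have ha := hXanti s hs hpos
    have ht2 : t / 2 ∈ Ioc 0 s ∩ Ioo 0 TT :=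
      ⟨⟨by linarith [ht.1.1], by linarith [ht.1.1, ht.1.2]⟩, ⟨by linarith [ht.1.1], by linarith [ht.2.2, ht.2.1]⟩⟩
    have h3 : X t < X (t / 2) := ha ht2 ht (by linarith [ht.1.1])
    have h4 : X (t / 2) ≤ 0 := by
      refine ge_of_tendsto X0 ?_
      filter_upwards [Ioo_mem_nhdsGT (show (0:ℝ) < t / 2 by linarith [ht.1.1])] with r hr
      refine (ha ⟨⟨hr.1, ?_⟩, ⟨hr.1, ?_⟩⟩ ht2 hr.2).le
      · linarith [hr.2, ht2.1.2]
      · linarith [hr.2, ht2.2.2]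
    linarith
  by_cases hall : ∀ t ∈ Ioo 0 TT, 0 < W t
  · have hs : TT / 2 ∈ Ioc 0 TT ∩ Ioo 0 TT := ⟨⟨by linarith, by linarith⟩, ⟨by linarith, by linarith⟩⟩
    have hn := hXneg TT le_rfl hall _ hs
    have ha := hXanti TT le_rfl hall
    have : 0 ≤ X (TT / 2) := by
      refine le_of_tendsto XT ?_
      filter_upwards [Ioo_mem_nhdsLT (show TT / 2 < TT by linarith)] with r hr
      exact (ha hs ⟨⟨by linarith [hr.1], hr.2.le⟩, ⟨by linarith [hr.1], hr.2⟩⟩ hr.1).le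
    linarith
  · push Not at hall
    obtain ⟨s, hs, hWs⟩ := hall
    set e := min (d / 2) (s / 2) with he
    have he0 : 0 < e := lt_min (by linarith) (by linarith [hs.1])
    have hed : e < d := (min_le_left _ _).trans_lt (by linarith)
    have hes : e < s := (min_le_right _ _).trans_lt (by linarith [hs.1])
    let S := Icc e s ∩ W ⁻¹' (Iic 0)
    have hSc : IsClosed S := ContinuousOn.preimage_isClosed_of_isClosed
      (cW.mono (Icc_subset_Icc he0.le hs.2.le)) isClosed_Icc isClosed_Iic
    have hSne : S.Nonempty := ⟨s, ⟨hes.le, le_rfl⟩, hWs⟩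
    have hSb : BddBelow S := ⟨e, fun x hx => hx.1.1⟩
    have hmem := hSc.csInf_mem hSne hSb
    set τ := sInf S with hτ
    have hτ0 : 0 < τ := he0.trans_le hmem.1.1
    have hτT : τ < TT := hmem.1.2.trans_lt hs.2
    have hpre : ∀ t ∈ Ioo 0 τ, 0 < W t := by
      intro t ht
      by_contra hc
      push Not at hc
      rcases lt_or_ge t e with hte | hte
      · have := hWpos t ht.1 (by linarith [ht.2]) (fun r hr => hd r ⟨hr.1, by linarith [hr.2]⟩)
        linarith
      · have : τ ≤ t := csInf_le hSb ⟨⟨hte, by linarith [ht.2, hmem.1.2]⟩, hc⟩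
        linarith [ht.2]
    have hτI : τ ∈ Ioo 0 TT := ⟨hτ0, hτT⟩
    have hWτ : W τ = 0 := by
      apply le_antisymm hmem.2
      have : Tendsto W (𝓝[<] τ) (𝓝 (W τ)) := (hW τ hτI).continuousAt.continuousWithinAt
      refine ge_of_tendsto this ?_
      filter_upwards [Ioo_mem_nhdsLT hτ0] with r hr using (hpre r hr).le
    have hwm : StrictMonoOn w (Ioc 0 τ) := by
      apply strictMonoOn_of_deriv_pos (convex_Ioc _ _)
      · intro t ht; exact (hw t ⟨ht.1, ht.2.trans_lt hτT⟩).continuousAt.continuousWithinAt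
      · intro t ht
        rw [interior_Ioc] at ht
        have htI : t ∈ Ioo 0 TT := ⟨ht.1, ht.2.trans hτT⟩
        rw [(hw t htI).deriv]
        have := hpre t ht
        have := h1.pos t htI
        positivity
    have hw1 : 1 < w τ := by
      by_contra hc
      push Not at hc
      have := hWpos τ hτ0 hτT.le (fun t ht =>
        (hwm ⟨ht.1, ht.2.le⟩ ⟨hτ0, le_rfl⟩ ht.2).trans_le hc)
      linarith
    have hXτ := hXneg τ hτT.le hpre τ ⟨⟨hτ0, le_rfl⟩, hτI⟩
    have b1 := h1.pos τ hτI
    have b2 := h2.pos τ hτI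
    have b3 : u1 τ < u2 τ := (one_lt_div b1).1 hw1
    have b4 := Real.rpow_lt_rpow b1.le b3 (show 0 < p - 2 by linarith)
    have e1 : q2 τ = q1 τ * w τ := by
      simp only [w, W] at hWτ ⊢; field_simp; linarith
    have e2 : u2 τ = u1 τ * w τ := by simp only [w]; field_simp
    have : X τ = Real.exp (-(2 * bt p) * τ) * Real.exp (2 * τ) / p * u2 τ ^ 2 *
        (u2 τ ^ (p - 2) - u1 τ ^ (p - 2)) := by
      simp only [X, Jf]
      rw [rpow_split2 p _ b1, rpow_split2 p _ b2]
      generalize u2 τ ^ (p - 2) = A2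
      generalize u1 τ ^ (p - 2) = A1
      rw [e1, e2]
      ring
    have h9 : 0 < X τ := by
      rw [this]
      have : 0 < p := by linarith
      have := Real.exp_pos (-(2 * bt p) * τ)
      have := Real.exp_pos (2 * τ)
      apply mul_pos (by positivity) (by linarith)
    linarith

lemma IsDir.uniq {p : ℝ} (hp : 6 < p) {lam : ℝ} {u1 q1 u2 q2 : ℝ → ℝ} (h1 : IsDir p lam u1 q1)
    (h2 : IsDir p lam u2 q2) : q1 0 = q2 0 ∧ ∀ t ∈ Icc 0 TT, u1 t = u2 t := by
  have : q1 0 = q2 0 := by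
    rcases lt_trichotomy (q1 0) (q2 0) with h | h | h
    · exact (no_two hp h2 h1 h).elim
    · exact h
    · exact (no_two hp h1 h2 h).elim
  refine ⟨this, fun t ht => (h1.sol.unique hp h2.sol (left_mem_Icc.2 TT_pos.le) ?_ this t ht).1⟩
  rw [h1.u0, h2.u0]

lemma side_bound {u q : ℝ → ℝ} {x y A k : ℝ} (hxy : x ≤ y) (hk : 0 < k) (hA : 0 ≤ A)
    (cu : ContinuousOn u (Icc x y)) (cq : ContinuousOn q (Icc x y))
    (hd : ∀ t ∈ Ioo x y, HasDerivAt u (q t) t) (hpos : ∀ t ∈ Ioo x y, 0 < u t)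
    (hle : ∀ t ∈ Ioo x y, u t ≤ A) (hq : ∀ t ∈ Ioo x y, k * u t ≤ |q t|) :
    ∫ t in x..y, u t ^ 2 ≤ A ^ 2 / (2 * k) := by
  rcases hxy.eq_or_lt with he | hlt
  · rw [he, intervalIntegral.integral_same]; positivity
  have hcl : closure (Ioo x y) = Icc x y := closure_Ioo hlt.ne
  have hle' : ∀ t ∈ Icc x y, u t ≤ A := by
    intro t ht
    rw [← hcl] at ht cu
    exact le_on_closure hle cu continuousOn_const ht
  have hpos' : ∀ t ∈ Icc x y, 0 ≤ u t := by
    intro t ht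
    rw [← hcl] at ht cu
    exact le_on_closure (fun t ht => (hpos t ht).le) continuousOn_const cu ht
  have hne : ∀ t ∈ Ioo x y, q t ≠ 0 := by
    intro t ht h0
    have := hq t ht
    rw [h0, abs_zero] at this
    have := mul_pos hk (hpos t ht)
    linarith
  have hu2 : IntervalIntegrable (fun t => u t ^ 2) volume x y :=
    ContinuousOn.intervalIntegrable_of_Icc hxy (cu.pow 2)
  have huq : IntervalIntegrable (fun t => 2 * u t * q t) volume x y :=
    ContinuousOn.intervalIntegrable_of_Icc hxy ((continuousOn_const.mul cu).mul cq)
  have hIntEq : ∫ t in x..y, 2 * u t * q t = u y ^ 2 - u x ^ 2 := by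
    refine intervalIntegral.integral_eq_sub_of_hasDerivAt_of_le (f := fun t => u t ^ 2) hxy
      (cu.pow 2) ?_ huq
    intro t ht
    refine ((hd t ht).pow 2).congr_deriv ?_
    push_cast; ring
  have hsq : ∀ t ∈ Icc x y, u t ^ 2 ≤ A ^ 2 := fun t ht => pow_le_pow_left₀ (hpos' t ht) (hle' t ht) 2
  have hsy := hsq y (right_mem_Icc.2 hxy)
  have hsx := hsq x (left_mem_Icc.2 hxy)
  have hsign : (∀ t ∈ Ioo x y, 0 < q t) ∨ (∀ t ∈ Ioo x y, q t < 0) := by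
    by_contra hc
    push Not at hc
    obtain ⟨⟨s, hs, hs0⟩, r, hr, hr0⟩ := hc
    have hpre : IsPreconnected (Ioo x y) := isPreconnected_Ioo
    obtain ⟨z, hz, hz0⟩ := hpre.intermediate_value hs hr (cq.mono Ioo_subset_Icc_self) ⟨hs0, hr0⟩
    exact hne z hz hz0
  rw [le_div_iff₀ (by positivity)]
  rcases hsign with h | h
  · have : ∫ t in x..y, u t ^ 2 * (2 * k) ≤ ∫ t in x..y, 2 * u t * q t := by
      refine intervalIntegral.integral_mono_on_of_le_Ioo hxy (hu2.mul_const _) huq ?_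
      intro t ht
      have h1 := hq t ht
      rw [abs_of_pos (h t ht)] at h1
      nlinarith [mul_le_mul_of_nonneg_left h1 (hpos t ht).le]
    rw [intervalIntegral.integral_mul_const] at this
    nlinarith [sq_nonneg (u x)]
  · have : ∫ t in x..y, u t ^ 2 * (2 * k) ≤ ∫ t in x..y, -(2 * u t * q t) := by
      refine intervalIntegral.integral_mono_on_of_le_Ioo hxy (hu2.mul_const _) huq.neg ?_
      intro t ht
      have h1 := hq t ht
      rw [abs_of_neg (h t ht)] at h1
      nlinarith [mul_le_mul_of_nonneg_left h1 (hpos t ht).le]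
    rw [intervalIntegral.integral_mul_const, intervalIntegral.integral_neg] at this
    nlinarith [sq_nonneg (u y)]

lemma energy_nonneg (p : ℝ) (hp : 6 < p) {lam : ℝ} {u q : ℝ → ℝ} (h : IsDir p lam u q) {t : ℝ}
    (ht : t ∈ Ioo 0 TT) : 0 ≤ Real.exp (-2 * t) * q t ^ 2 / 2 + (-lam * u t ^ 2 / 2 + u t ^ p / p) := by
  let E : ℝ → ℝ := fun t => Real.exp (-2 * t) * q t ^ 2 / 2 + (-lam * u t ^ 2 / 2 + u t ^ p / p)
  have hanti : AntitoneOn E (Icc 0 TT) := by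
    apply antitoneOn_of_hasDerivWithinAt_nonpos (convex_Icc _ _)
      (f' := fun t => - (Real.exp (-2 * t) * q t ^ 2))
    · have h1 := h.sol.cv
      have h2 := h.sol.cq
      have h3 : ContinuousOn (fun t => u t ^ p) (Icc 0 TT) :=
        h1.rpow_const (fun _ _ => Or.inr (by linarith))
      simp only [E]
      fun_prop
    · intro s hs
      rw [interior_Icc] at hs
      have hup := h.pos s hs
      have hv := h.sol.dv s hs
      have hq := h.sol.dq s hs
      have he : HasDerivAt (fun x => Real.exp (-2 * x)) (Real.exp (-2 * s) * (-2)) s := by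
        simpa using ((hasDerivAt_id s).const_mul (-2)).exp
      have hd := ((he.mul (hq.pow 2)).div_const 2).add ((((hv.pow 2).const_mul
        (-lam)).div_const 2).add ((hv.rpow_const (p := p) (Or.inl hup.ne')).div_const p))
      refine hd.hasDerivWithinAt.congr_deriv ?_
      simp only [Pi.pow_apply]
      rw [gp_split p _ hup, rpow_split1 p _ hup]
      push_cast
      simp only [pow_one]
      have e1 : Real.exp (-2 * s) * Real.exp (2 * s) = 1 := by
        rw [← Real.exp_add, ← Real.exp_zero]; congr 1; ring
      have e3 : p * p⁻¹ = 1 := mul_inv_cancel₀ (by linarith)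
      generalize u s ^ (p - 2) = w
      rw [div_eq_mul_inv _ p]
      generalize Real.exp (-2 * s) = a at *
      generalize Real.exp (2 * s) = b at *
      linear_combination (q s * (lam * u s - w * u s)) * e1 + (q s * w * u s) * e3
    · intro s hs
      have : 0 ≤ Real.exp (-2 * s) * q s ^ 2 := by positivity
      linarith
  have := hanti (Ioo_subset_Icc_self ht) (right_mem_Icc.2 TT_pos.le) ht.2.le
  have h2 : 0 ≤ E TT := by
    simp only [E]; rw [h.uT, Real.zero_rpow (by linarith)]
    have : 0 ≤ Real.exp (-2 * TT) * q TT ^ 2 := by positivity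
    norm_num
    norm_num at this
    linarith
  exact h2.trans this

lemma slope_low (p : ℝ) (hp : 6 < p) {lam : ℝ} (hl : 1 ≤ lam) {u q : ℝ → ℝ} (h : IsDir p lam u q)
    {t : ℝ} (ht : t ∈ Ioo 0 TT) (hu : u t ^ (p - 2) ≤ 2 * lam) :
    Real.sqrt (lam / 3) * u t ≤ |q t| := by
  have hup := h.pos t ht
  have hE := energy_nonneg p hp h ht
  rw [rpow_split2 p _ hup] at hE
  have h1 : u t ^ (p - 2) * u t ^ 2 / p ≤ lam / 3 * u t ^ 2 := by
    have : u t ^ (p - 2) / p ≤ lam / 3 := by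
      rw [div_le_iff₀ (by linarith)]; nlinarith
    calc u t ^ (p - 2) * u t ^ 2 / p = u t ^ (p - 2) / p * u t ^ 2 := by ring
      _ ≤ _ := mul_le_mul_of_nonneg_right this (sq_nonneg _)
  have h2 : Real.exp (-2 * t) ≤ 1 := by
    rw [Real.exp_le_one_iff]; linarith [ht.1]
  have h3 : Real.exp (-2 * t) * q t ^ 2 ≤ q t ^ 2 := by nlinarith [sq_nonneg (q t)]
  have h4 : lam / 3 * u t ^ 2 ≤ q t ^ 2 := by linarith
  apply abs_le_of_sq_le_sq' _ (abs_nonneg _) |>.2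
  rw [mul_pow, Real.sq_sqrt (by linarith), sq_abs]
  exact h4

lemma mid_third {u : ℝ → ℝ} {x y z s : ℝ} (hc : ConcaveOn ℝ (Icc x y) u) (hz : z ∈ Icc x y)
    (hux : 0 ≤ u x) (huy : 0 ≤ u y) (huz : 0 ≤ u z) (hs : s ∈ Icc (x + (y - x) / 3) (x + 2 * (y - x) / 3))
    (hxy : x < y) : u z / 3 ≤ u s := by
  rcases le_total s z with h | h
  · have h0 : 0 < z - x := by linarith [hs.1]
    set θ := (s - x) / (z - x) with hθ
    have h1 : 1 / 3 ≤ θ := by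
      rw [hθ, le_div_iff₀ h0]; linarith [hs.1, hz.2]
    have h2 : θ ≤ 1 := by rw [hθ, div_le_one h0]; linarith
    have := hc.2 hz (left_mem_Icc.2 hxy.le) (show 0 ≤ θ by linarith) (show 0 ≤ 1 - θ by linarith) (by ring)
    simp only [smul_eq_mul] at this
    have e : θ * z + (1 - θ) * x = s := by
      have : θ * (z - x) = s - x := by rw [hθ]; field_simp
      linarith
    rw [e] at this
    nlinarith [mul_nonneg (show 0 ≤ 1 - θ by linarith) hux]
  · have h0 : 0 < y - z := by linarith [hs.2]
    set θ := (y - s) / (y - z) with hθ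
    have h1 : 1 / 3 ≤ θ := by
      rw [hθ, le_div_iff₀ h0]; linarith [hs.2, hz.1]
    have h2 : θ ≤ 1 := by rw [hθ, div_le_one h0]; linarith
    have := hc.2 hz (right_mem_Icc.2 hxy.le) (show 0 ≤ θ by linarith) (show 0 ≤ 1 - θ by linarith) (by ring)
    simp only [smul_eq_mul] at this
    have e : θ * z + (1 - θ) * y = s := by
      have : θ * (y - z) = y - s := by rw [hθ]; field_simp
      linarith
    rw [e] at this
    nlinarith [mul_nonneg (show 0 ≤ 1 - θ by linarith) huy]

lemma mid_bound (p : ℝ) (hp : 6 < p) {lam : ℝ} (hl : 1 ≤ lam) {u q : ℝ → ℝ} (h : IsSol p lam 1 u q)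
    {x y A : ℝ} (hA : 0 < A) (hA2 : A ^ (p - 2) = 2 * lam) (hx : 0 ≤ x) (hxy : x ≤ y) (hy : y ≤ TT)
    (hu : ∀ t ∈ Icc x y, A ≤ u t) :
    ∫ t in x..y, u t ^ 2 ≤ 9 * 100 ^ (2 / (p - 2)) * 10 ^ (1 / 2 - 2 / (p - 2)) *
      lam ^ (2 / (p - 2) - 1 / 2) := by
  have hp2 : 0 < p - 2 := by linarith
  set θ := 2 / (p - 2) with hθ
  have hθ0 : 0 < θ := by positivity
  have hθ1 : θ < 1 / 2 := by rw [hθ, div_lt_iff₀ hp2]; linarith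
  rcases hxy.eq_or_lt with he | hlt
  · rw [he, intervalIntegral.integral_same]; positivity
  have hsub : Icc x y ⊆ Icc 0 TT := Icc_subset_Icc hx hy
  have hsubo : Ioo x y ⊆ Ioo 0 TT := Ioo_subset_Ioo hx hy
  have hup : ∀ t ∈ Icc x y, 0 < u t := fun t ht => hA.trans_le (hu t ht)
  have hqa : AntitoneOn q (Icc x y) := by
    apply antitoneOn_of_hasDerivWithinAt_nonpos (convex_Icc _ _) (h.cq.mono hsub)
      (f' := fun t => Real.exp (2 * t) * (lam * u t - 1 * gp p (u t)))
    · intro t ht; rw [interior_Icc] at ht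
      exact (h.dq t (hsubo ht)).hasDerivWithinAt
    · intro t ht; rw [interior_Icc] at ht
      have h1 := hup t (Ioo_subset_Icc_self ht)
      rw [gp_split p _ h1]
      have h2 := Real.rpow_le_rpow hA.le (hu t (Ioo_subset_Icc_self ht)) hp2.le
      rw [hA2] at h2
      apply mul_nonpos_of_nonneg_of_nonpos (Real.exp_pos _).le
      nlinarith
  have hconc : ConcaveOn ℝ (Icc x y) u := by
    apply AntitoneOn.concaveOn_of_deriv (convex_Icc _ _) (h.cv.mono hsub)
    · intro t ht; rw [interior_Icc] at ht
      exact (h.dv t (hsubo ht)).differentiableAt.differentiableWithinAt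
    · rw [interior_Icc]
      intro s hs t ht hst
      rw [(h.dv s (hsubo hs)).deriv, (h.dv t (hsubo ht)).deriv]
      exact hqa (Ioo_subset_Icc_self hs) (Ioo_subset_Icc_self ht) hst
  obtain ⟨z, hz, hzm⟩ := isCompact_Icc.exists_isMaxOn (nonempty_Icc.2 hxy) (h.cv.mono hsub)
  have huz := hup z hz
  have ho1 := osc p hp h hx hxy hy hA hu
  rw [hA2] at ho1
  set l := y - x with hll
  have hl0 : 0 < l := by linarith
  have ho2 := osc p hp h (x := x + l / 3) (y := x + 2 * l / 3) (m := u z / 3) (by linarith)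
    (by linarith) (by linarith) (by linarith)
    (fun t ht => mid_third hconc hz (hup x (left_mem_Icc.2 hxy)).le
      (hup y (right_mem_Icc.2 hxy)).le huz.le ht hlt)
  set B := (u z / 3) ^ (p - 2) with hB
  have hB0 : 0 < B := Real.rpow_pos_of_pos (by linarith) _
  have hBl : B ≤ 100 * l⁻¹ ^ 2 := by
    have : B * l ^ 2 ≤ 100 := by nlinarith
    rw [inv_pow, ← div_eq_mul_inv, le_div_iff₀ (by positivity)]; exact this
  have hB2 : B ^ θ = (u z / 3) ^ 2 := by
    rw [hB, ← Real.rpow_mul (by linarith), hθ, mul_div_cancel₀ _ hp2.ne', Real.rpow_two]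
  have hz2 : u z ^ 2 ≤ 9 * (100 ^ θ * l ^ (-2 * θ)) := by
    have h1 := Real.rpow_le_rpow hB0.le hBl hθ0.le
    rw [hB2, Real.mul_rpow (by norm_num) (by positivity), ← Real.rpow_two l⁻¹, ← Real.rpow_mul (by positivity),
      Real.inv_rpow hl0.le, ← Real.rpow_neg hl0.le] at h1
    rw [show -2 * θ = -(2 * θ) by ring]
    have e : (u z / 3) ^ 2 = u z ^ 2 / 9 := by ring
    rw [e] at h1
    linarith
  have hIntEq : ∫ t in x..y, u t ^ 2 ≤ ∫ t in x..y, u z ^ 2 := by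
    apply intervalIntegral.integral_mono_on hxy
      (ContinuousOn.intervalIntegrable_of_Icc hxy ((h.cv.mono hsub).pow 2)) (by simp)
    intro t ht
    exact pow_le_pow_left₀ (hup t ht).le (hzm ht) 2
  rw [intervalIntegral.integral_const, smul_eq_mul, ← hll] at hIntEq
  have hl2 : l ^ (1 - 2 * θ) ≤ (10 / lam) ^ (1 / 2 - θ) := by
    have h1 : l ^ 2 ≤ 10 / lam := by rw [le_div_iff₀ (by linarith)]; nlinarith
    have h2 := Real.rpow_le_rpow (by positivity) h1 (show 0 ≤ 1 / 2 - θ by linarith)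
    rw [← Real.rpow_two, ← Real.rpow_mul hl0.le] at h2
    rwa [show 1 - 2 * θ = 2 * (1 / 2 - θ) by ring]
  have e1 : l * l ^ (-2 * θ) = l ^ (1 - 2 * θ) := by
    rw [show 1 - 2 * θ = 1 + -2 * θ by ring, Real.rpow_add hl0, Real.rpow_one]
  have e2 : (10 / lam) ^ (1 / 2 - θ) = 10 ^ (1 / 2 - θ) * lam ^ (θ - 1 / 2) := by
    rw [Real.div_rpow (by norm_num) (by linarith), div_eq_mul_inv, ← Real.rpow_neg (by linarith)]
    congr 2; ring
  calc ∫ t in x..y, u t ^ 2 ≤ l * u z ^ 2 := hIntEq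
    _ ≤ l * (9 * (100 ^ θ * l ^ (-2 * θ))) := mul_le_mul_of_nonneg_left hz2 hl0.le
    _ = 9 * 100 ^ θ * (l * l ^ (-2 * θ)) := by ring
    _ ≤ 9 * 100 ^ θ * (10 ^ (1 / 2 - θ) * lam ^ (θ - 1 / 2)) := by
        rw [e1, ← e2]; exact mul_le_mul_of_nonneg_left hl2 (by positivity)
    _ = _ := by ring

def tmass (u : ℝ → ℝ) : ℝ := ∫ t in (0:ℝ)..TT, u t ^ 2 * Real.exp (2 * t)

lemma decay (p : ℝ) (hp : 6 < p) : ∃ C : ℝ, 0 < C ∧ ∀ lam : ℝ, 1 ≤ lam → ∀ u q : ℝ → ℝ,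
    IsDir p lam u q → tmass u ≤ C * lam ^ (2 / (p - 2) - 1 / 2) := by
  have hp2 : 0 < p - 2 := by linarith
  set θ := 2 / (p - 2) with hθ
  refine ⟨4 * (9 * 100 ^ θ * 10 ^ (1 / 2 - θ) + 2 ^ θ * Real.sqrt 3), by positivity, ?_⟩
  intro lam hl u q h
  have hT := TT_pos
  have hl0 : 0 < lam := by linarith
  set A := (2 * lam) ^ (1 / (p - 2)) with hA
  have hA0 : 0 < A := Real.rpow_pos_of_pos (by linarith) _
  have hA2 : A ^ (p - 2) = 2 * lam := by
    rw [hA, ← Real.rpow_mul (by linarith), one_div, inv_mul_cancel₀ hp2.ne', Real.rpow_one]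
  have hAsq : A ^ 2 = 2 ^ θ * lam ^ θ := by
    rw [← Real.mul_rpow (by norm_num) hl0.le, hA, ← Real.rpow_two, ← Real.rpow_mul (by linarith), hθ]
    congr 1; ring
  have hslope : ∀ t ∈ Ioo 0 TT, u t ≤ A → Real.sqrt (lam / 3) * u t ≤ |q t| := by
    intro t ht htA
    apply slope_low p hp hl h ht
    rw [← hA2]
    exact Real.rpow_le_rpow (h.pos t ht).le htA hp2.le
  have hk : 0 < Real.sqrt (lam / 3) := Real.sqrt_pos.2 (by linarith)
  have hqne : ∀ t ∈ Ioo 0 TT, u t < A → q t ≠ 0 := by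
    intro t ht hA hq
    have h1 := hslope t ht hA.le
    rw [hq, abs_zero] at h1
    have := mul_pos hk (h.pos t ht)
    linarith
  let K := Icc 0 TT ∩ u ⁻¹' (Ici A)
  have hKc : IsClosed K := ContinuousOn.preimage_isClosed_of_isClosed h.sol.cv isClosed_Icc isClosed_Ici
  have hKne : K.Nonempty := by
    obtain ⟨z, hz, hzm⟩ := isCompact_Icc.exists_isMaxOn (nonempty_Icc.2 hT.le) h.sol.cv
    have huz : 0 < u z := (h.pos (TT / 2) ⟨by linarith, by linarith⟩).trans_le
      (hzm (⟨by linarith, by linarith⟩ : TT / 2 ∈ Icc 0 TT))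
    have hz0 : z ≠ 0 := by rintro rfl; linarith [h.u0]
    have hzT : z ≠ TT := by intro hh; rw [hh, h.uT] at huz; linarith
    have hzI : z ∈ Ioo 0 TT := ⟨lt_of_le_of_ne hz.1 hz0.symm, lt_of_le_of_ne hz.2 hzT⟩
    have hloc : IsLocalMax u z := hzm.isLocalMax (Icc_mem_nhds hzI.1 hzI.2)
    have := hloc.hasDerivAt_eq_zero (h.sol.dv z hzI)
    refine ⟨z, hz, ?_⟩
    by_contra hc
    exact hqne z hzI (not_le.1 hc) this
  have hKb : BddBelow K := ⟨0, fun x hx => hx.1.1⟩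
  have hKa : BddAbove K := ⟨TT, fun x hx => hx.1.2⟩
  have m1 := hKc.csInf_mem hKne hKb
  have m2 := hKc.csSup_mem hKne hKa
  set t1 := sInf K with ht1
  set t2 := sSup K with ht2
  have h12 : t1 ≤ t2 := csInf_le hKb m2
  have hcv := h.sol.cv
  have hI : ∀ a b, 0 ≤ a → a ≤ b → b ≤ TT → IntervalIntegrable (fun t => u t ^ 2) volume a b :=
    fun a b ha hab hb => ContinuousOn.intervalIntegrable_of_Icc hab
      ((hcv.mono (Icc_subset_Icc ha hb)).pow 2)
  have s1 : ∫ t in (0:ℝ)..t1, u t ^ 2 ≤ A ^ 2 / (2 * Real.sqrt (lam / 3)) := by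
    have hin : ∀ t ∈ Ioo 0 t1, t ∈ Ioo 0 TT := fun t ht => ⟨ht.1, ht.2.trans_le m1.1.2⟩
    have hle : ∀ t ∈ Ioo 0 t1, u t ≤ A := by
      intro t ht
      by_contra hc
      have : t1 ≤ t := csInf_le hKb ⟨Ioo_subset_Icc_self (hin t ht), (not_le.1 hc).le⟩
      linarith [ht.2]
    have hs := Icc_subset_Icc (le_refl (0:ℝ)) m1.1.2
    exact side_bound m1.1.1 hk hA0.le (hcv.mono hs) (h.sol.cq.mono hs) (fun t ht => h.sol.dv t (hin t ht))
      (fun t ht => h.pos t (hin t ht)) hle (fun t ht => hslope t (hin t ht) (hle t ht))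
  have s2 : ∫ t in t2..TT, u t ^ 2 ≤ A ^ 2 / (2 * Real.sqrt (lam / 3)) := by
    have hin : ∀ t ∈ Ioo t2 TT, t ∈ Ioo 0 TT := fun t ht => ⟨m2.1.1.trans_lt ht.1, ht.2⟩
    have hle : ∀ t ∈ Ioo t2 TT, u t ≤ A := by
      intro t ht
      by_contra hc
      have : t ≤ t2 := le_csSup hKa ⟨Ioo_subset_Icc_self (hin t ht), (not_le.1 hc).le⟩
      linarith [ht.1]
    have hs := Icc_subset_Icc m2.1.1 (le_refl TT)
    exact side_bound m2.1.2 hk hA0.le (hcv.mono hs) (h.sol.cq.mono hs) (fun t ht => h.sol.dv t (hin t ht))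
      (fun t ht => h.pos t (hin t ht)) hle (fun t ht => hslope t (hin t ht) (hle t ht))
  have s3 := mid_bound p hp hl h.sol hA0 hA2 m1.1.1 h12 m2.1.2
    (ge_between h12 (hcv.mono (Icc_subset_Icc m1.1.1 m2.1.2))
      (fun t ht => h.sol.dv t ⟨m1.1.1.trans_lt ht.1, ht.2.trans_le m2.1.2⟩)
      (fun t ht => hqne t ⟨m1.1.1.trans_lt ht.1, ht.2.trans_le m2.1.2⟩) m1.2 m2.2)
  rw [← hθ] at s3
  have hsum : ∫ t in (0:ℝ)..TT, u t ^ 2 = (∫ t in (0:ℝ)..t1, u t ^ 2) + (∫ t in t1..t2, u t ^ 2) +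
      ∫ t in t2..TT, u t ^ 2 := by
    rw [intervalIntegral.integral_add_adjacent_intervals (hI _ _ le_rfl m1.1.1 m1.1.2)
      (hI _ _ m1.1.1 h12 m2.1.2), intervalIntegral.integral_add_adjacent_intervals
      (hI _ _ le_rfl m2.1.1 m2.1.2) (hI _ _ m2.1.1 m2.1.2 le_rfl)]
  have hm : tmass u ≤ ∫ t in (0:ℝ)..TT, u t ^ 2 * 4 := by
    apply intervalIntegral.integral_mono_on hT.le
    · exact ContinuousOn.intervalIntegrable_of_Icc hT.le ((hcv.pow 2).mul (by fun_prop))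
    · exact (hI _ _ le_rfl hT.le le_rfl).mul_const _
    · intro t ht
      exact mul_le_mul_of_nonneg_left (exp2_le ht.2) (sq_nonneg _)
  rw [intervalIntegral.integral_mul_const] at hm
  have e : A ^ 2 / (2 * Real.sqrt (lam / 3)) + A ^ 2 / (2 * Real.sqrt (lam / 3)) =
      2 ^ θ * Real.sqrt 3 * lam ^ (θ - 1 / 2) := by
    rw [hAsq, Real.rpow_sub hl0, ← Real.sqrt_eq_rpow, Real.sqrt_div hl0.le]
    have : Real.sqrt lam ≠ 0 := (Real.sqrt_pos.2 hl0).ne'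
    have : Real.sqrt 3 ≠ 0 := (Real.sqrt_pos.2 (by norm_num)).ne'
    field_simp
    ring
  have : ∫ t in (0:ℝ)..TT, u t ^ 2 ≤
    (9 * 100 ^ θ * 10 ^ (1 / 2 - θ) + 2 ^ θ * Real.sqrt 3) * lam ^ (θ - 1 / 2) := by
    rw [hsum, add_mul, ← e]; linarith
  calc tmass u ≤ _ := hm
    _ ≤ _ := mul_le_mul_of_nonneg_right this (by norm_num)
    _ = _ := by ring

lemma exp_TT : Real.exp TT = 2 := Real.exp_log (by norm_num)

lemma exp_mem_Icc {t : ℝ} (ht : t ∈ Icc 0 TT) : Real.exp t ∈ Icc (1:ℝ) 2 :=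
  ⟨by rw [Real.one_le_exp_iff]; exact ht.1, by rw [← exp_TT]; exact Real.exp_le_exp.2 ht.2⟩

lemma exp_mem_Ioo {t : ℝ} (ht : t ∈ Ioo 0 TT) : Real.exp t ∈ Ioo (1:ℝ) 2 :=
  ⟨by rw [Real.one_lt_exp_iff]; exact ht.1, by rw [← exp_TT]; exact Real.exp_lt_exp.2 ht.2⟩

lemma log_mem_Icc {r : ℝ} (hr : r ∈ Icc (1:ℝ) 2) : Real.log r ∈ Icc 0 TT :=
  ⟨Real.log_nonneg hr.1, Real.log_le_log (by linarith [hr.1]) hr.2⟩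

lemma log_mem_Ioo {r : ℝ} (hr : r ∈ Ioo (1:ℝ) 2) : Real.log r ∈ Ioo 0 TT :=
  ⟨Real.log_pos hr.1, Real.log_lt_log (by linarith [hr.1]) hr.2⟩

lemma int_subst {f : ℝ → ℝ} (hf : ContinuousOn f (Icc 1 2)) :
    ∫ r in (1:ℝ)..2, f r = ∫ t in (0:ℝ)..TT, f (Real.exp t) * Real.exp t := by
  have h := intervalIntegral.integral_comp_mul_deriv' (a := 0) (b := TT) (f := Real.exp)
    (f' := Real.exp) (g := f) (fun t _ => Real.hasDerivAt_exp t) (by fun_prop) (by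
      refine hf.mono ?_
      rintro _ ⟨t, ht, rfl⟩
      rw [uIcc_of_le TT_pos.le] at ht
      exact exp_mem_Icc ht)
  rw [exp_TT, Real.exp_zero] at h
  rw [← h]
  rfl

/-- replacing a function by one equal on the open interval -/
lemma int_congr_Ioo {f g : ℝ → ℝ} {a b : ℝ} (hab : a ≤ b) (h : ∀ t ∈ Ioo a b, f t = g t) :
    ∫ t in a..b, f t = ∫ t in a..b, g t := by
  rw [intervalIntegral.integral_of_le hab, intervalIntegral.integral_of_le hab,
    
    integral_Ioc_eq_integral_Ioo, integral_Ioc_eq_integral_Ioo]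
  exact setIntegral_congr_fun measurableSet_Ioo h

lemma FV_pos_near (p : ℝ) (hp : 6 < p) (lam mu : ℝ) (hmu : 0 ≤ mu) :
    ∃ d > 0, ∀ t ∈ Ioo 0 d, 0 < FV p lam mu t := by
  have F := flow_spec p hp lam mu hmu
  have h0 := F.dvI 0 (left_mem_Icc.2 TT_pos.le)
  rw [F.q0] at h0
  have h1 := (hasDerivWithinAt_iff_tendsto_slope' (s := Ioi (0:ℝ)) (by simp)).1 h0.hasDerivWithinAt
  have h2 : ∀ᶠ t in 𝓝[>] (0:ℝ), 0 < slope (FV p lam mu) 0 t := h1.eventually_const_lt (by norm_num)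
  obtain ⟨d, hd, hd2⟩ := mem_nhdsGT_iff_exists_Ioo_subset.1 h2
  refine ⟨d, hd, fun t ht => ?_⟩
  have := hd2 ht
  simp only [mem_ofPred_eq, slope_def_field, F.v0, sub_zero] at this
  exact (div_pos_iff_of_pos_right ht.1).1 this

lemma first_zero (p : ℝ) (hp : 6 < p) (lam mu : ℝ) (hmu : 0 ≤ mu) (h : ¬ PosP p lam mu) :
    ∃ s ∈ Ioc 0 TT, FV p lam mu s = 0 ∧ ∀ t ∈ Ioo 0 s, 0 < FV p lam mu t := by
  have F := flow_spec p hp lam mu hmu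
  obtain ⟨d, hd0, hd⟩ := FV_pos_near p hp lam mu hmu
  unfold PosP at h
  push Not at h
  obtain ⟨s, hs, hvs⟩ := h
  set v := FV p lam mu
  set e := min (d / 2) (s / 2) with he
  have he0 : 0 < e := lt_min (by linarith) (by linarith [hs.1])
  have hed : e < d := (min_le_left _ _).trans_lt (by linarith)
  have hes : e < s := (min_le_right _ _).trans_lt (by linarith [hs.1])
  let S := Icc e s ∩ v ⁻¹' (Iic 0)
  have hSc : IsClosed S := ContinuousOn.preimage_isClosed_of_isClosed
    (F.sol.cv.mono (Icc_subset_Icc he0.le hs.2)) isClosed_Icc isClosed_Iic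
  have hSne : S.Nonempty := ⟨s, ⟨hes.le, le_rfl⟩, hvs⟩
  have hSb : BddBelow S := ⟨e, fun x hx => hx.1.1⟩
  have hmem := hSc.csInf_mem hSne hSb
  set τ := sInf S with hτ
  have hτ0 : 0 < τ := he0.trans_le hmem.1.1
  have hτT : τ ≤ TT := hmem.1.2.trans hs.2
  have hpre : ∀ t ∈ Ioo 0 τ, 0 < v t := by
    intro t ht
    by_contra hc
    push Not at hc
    rcases lt_or_ge t e with hte | hte
    · linarith [hd t ⟨ht.1, by linarith⟩]
    · have : τ ≤ t := csInf_le hSb ⟨⟨hte, by linarith [ht.2, hmem.1.2]⟩, hc⟩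
      linarith [ht.2]
  refine ⟨τ, ⟨hτ0, hτT⟩, ?_, hpre⟩
  apply le_antisymm hmem.2
  have : Tendsto v (𝓝[<] τ) (𝓝 (v τ)) := (F.dvI τ ⟨hτ0.le, hτT⟩).continuousAt.continuousWithinAt
  refine ge_of_tendsto this ?_
  filter_upwards [Ioo_mem_nhdsLT hτ0] with r hr using (hpre r hr).le

lemma slope_at_zero {v : ℝ → ℝ} {q s : ℝ} (hs : 0 < s) (h : HasDerivAt v q s) (h0 : v s = 0)
    (hpos : ∀ t ∈ Ioo 0 s, 0 < v t) : q ≤ 0 := by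
  have h1 := (hasDerivWithinAt_iff_tendsto_slope' (s := Iio s) (by simp)).1 h.hasDerivWithinAt
  refine le_of_tendsto h1 ?_
  filter_upwards [Ioo_mem_nhdsLT hs] with r hr
  rw [slope_def_field, h0, sub_zero]
  exact div_nonpos_of_nonneg_of_nonpos (hpos r hr).le (by linarith [hr.2])

lemma posP_of_nonneg (p : ℝ) (hp : 6 < p) (lam : ℝ) (hl : 0 ≤ lam) : PosP p lam 0 := by
  by_contra hc
  obtain ⟨s, hs, hs0, hpos⟩ := first_zero p hp lam 0 le_rfl hc
  have F := flow_spec p hp lam 0 le_rfl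
  set v := FV p lam 0
  set q := FQ p lam 0
  have hsub : Icc 0 s ⊆ Icc 0 TT := Icc_subset_Icc le_rfl hs.2
  have hq : MonotoneOn q (Icc 0 s) := by
    apply monotoneOn_of_hasDerivWithinAt_nonneg (convex_Icc _ _) (F.sol.cq.mono hsub)
      (f' := fun t => Real.exp (2 * t) * (lam * v t - 0 * gp p (v t)))
    · intro t ht
      rw [interior_Icc] at ht
      exact (F.dqI t (hsub (Ioo_subset_Icc_self ht))).hasDerivWithinAt
    · intro t ht
      rw [interior_Icc] at ht
      have := hpos t ht
      have := Real.exp_pos (2 * t)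
      rw [zero_mul, sub_zero]
      positivity
  have h1 := hq (left_mem_Icc.2 hs.1.le) (right_mem_Icc.2 hs.1.le) hs.1.le
  have h2 := slope_at_zero hs.1 (F.dvI s ⟨hs.1.le, hs.2⟩) hs0 hpos
  rw [show q 0 = 1 from F.q0] at h1
  change q s ≤ 0 at h2
  linarith

lemma sturm (p : ℝ) (hp : 6 < p) (lam mu : ℝ) (hmu : 0 < mu) (h : SolP p lam mu) : PosP p lam 0 := by
  by_contra hc
  obtain ⟨s, hs, hs0, hpos⟩ := first_zero p hp lam 0 le_rfl hc
  have F0 := flow_spec p hp lam 0 le_rfl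
  have F := flow_spec p hp lam mu hmu.le
  have h2 := slope_at_zero hs.1 (F0.dvI s ⟨hs.1.le, hs.2⟩) hs0 hpos
  have hpv := h.1
  have hvT := h.2
  set v0 := FV p lam 0
  set q0 := FQ p lam 0
  set v := FV p lam mu
  set q := FQ p lam mu
  have hsub : Icc 0 s ⊆ Icc 0 TT := Icc_subset_Icc le_rfl hs.2
  have hm : StrictMonoOn (fun t => q0 t * v t - v0 t * q t) (Icc 0 s) := by
    apply strictMonoOn_of_deriv_pos (convex_Icc _ _)
    · exact (((F0.sol.cq.mul F.sol.cv).sub (F0.sol.cv.mul F.sol.cq))).mono hsub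
    · intro t ht
      rw [interior_Icc] at ht
      have htI := hsub (Ioo_subset_Icc_self ht)
      have hd := ((F0.dqI t htI).mul (F.dvI t htI)).sub ((F0.dvI t htI).mul (F.dqI t htI))
      have a1 := hpos t ht
      have a2 : 0 < v t := hpv t ⟨ht.1, ht.2.trans_le hs.2⟩
      have a3 := Real.exp_pos (2 * t)
      have a4 : 0 < gp p (v t) := by
        rw [gp_of_nonneg p _ a2.le]; exact Real.rpow_pos_of_pos a2 _
      have e : deriv (fun t => q0 t * v t - v0 t * q t) t = mu * Real.exp (2 * t) * v0 t * gp p (v t) := by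
        refine HasDerivAt.deriv (hd.congr_deriv ?_)
        simp only [v, v0, q, q0]
        ring
      rw [e]; positivity
  have h3 := hm (left_mem_Icc.2 hs.1.le) (right_mem_Icc.2 hs.1.le) hs.1
  simp only [show v 0 = 0 from F.v0, show v0 0 = 0 from F0.v0, show v0 s = 0 from hs0] at h3
  have hvs : 0 ≤ v s := by
    rcases hs.2.eq_or_lt with h | h
    · rw [h]; exact hvT.ge
    · exact (hpv s ⟨hs.1, h⟩).le
  change q0 s ≤ 0 at h2
  nlinarith

lemma cdo_parts {φ : ℝ → ℝ} (h : ContDiffOn ℝ 1 φ (Icc 1 2)) : ∃ g : ℝ → ℝ,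
    ContinuousOn g (Icc 1 2) ∧ ∀ r ∈ Ioo (1:ℝ) 2, HasDerivAt φ (g r) r := by
  refine ⟨derivWithin φ (Icc 1 2), h.continuousOn_derivWithin (uniqueDiffOn_Icc (by norm_num)) le_rfl, ?_⟩
  intro r hr
  have h1 := (h.differentiableOn one_ne_zero r (Ioo_subset_Icc_self hr)).hasDerivWithinAt
  exact h1.hasDerivAt (Icc_mem_nhds hr.1 hr.2)

/-- Rayleigh quotient in the logarithmic variable -/
lemma rayleigh_parts {φ g : ℝ → ℝ} (hφ : ContinuousOn φ (Icc 1 2)) (hg : ContinuousOn g (Icc 1 2))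
    (hd : ∀ r ∈ Ioo (1:ℝ) 2, HasDerivAt φ (g r) r) :
    (∫ r in (1:ℝ)..2, (deriv φ r) ^ 2 * r ^ (2 - 1)) =
      (∫ t in (0:ℝ)..TT, (g (Real.exp t) * Real.exp t) ^ 2) ∧
    (∫ r in (1:ℝ)..2, (φ r) ^ 2 * r ^ (2 - 1)) =
      (∫ t in (0:ℝ)..TT, φ (Real.exp t) ^ 2 * Real.exp (2 * t)) := by
  constructor
  · rw [int_congr_Ioo (g := fun r => g r ^ 2 * r) (by norm_num)
      (fun r hr => by rw [(hd r hr).deriv]; simp), int_subst (f := fun r => g r ^ 2 * r) ((hg.pow 2).mul continuousOn_id)]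
    congr 1; ext t; ring
  · rw [int_congr_Ioo (g := fun r => φ r ^ 2 * r) (by norm_num)
      (fun r hr => by simp), int_subst (f := fun r => φ r ^ 2 * r) ((hφ.pow 2).mul continuousOn_id)]
    congr 1; ext t; rw [two_mul, Real.exp_add]; ring

lemma picone (p : ℝ) (hp : 6 < p) (lam : ℝ) (h : PosP p lam 0) {ψ g : ℝ → ℝ}
    (cψ : ContinuousOn ψ (Icc 0 TT)) (cg : ContinuousOn g (Icc 0 TT))
    (hd : ∀ t ∈ Ioo 0 TT, HasDerivAt ψ (g t) t) (h0 : ψ 0 = 0) (hT : ψ TT = 0) :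
    0 ≤ ∫ t in (0:ℝ)..TT, (g t ^ 2 + lam * (ψ t ^ 2 * Real.exp (2 * t))) := by
  have F := flow_spec p hp lam 0 le_rfl
  have hpv := h
  unfold PosP at hpv
  set v := FV p lam 0
  set q := FQ p lam 0
  have hTp := TT_pos
  have hI0 := left_mem_Icc.2 hTp.le
  let G : ℝ → ℝ := fun t => ψ t * (ψ t / v t) * q t
  have hG0 : G 0 = 0 := by simp [G, h0]
  have hGT : G TT = 0 := by simp [G, hT]
  have cG : ContinuousOn G (Icc 0 TT) := by
    intro t ht
    rcases ht.1.eq_or_lt with he | hlt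
    · rw [← he]
      have hev : ∀ᶠ t in 𝓝[>] (0:ℝ), t ∈ Ioo 0 TT := Ioo_mem_nhdsGT hTp
      have c1 : Tendsto q (𝓝[>] 0) (𝓝 (q 0)) := (F.sol.cq 0 hI0).mono_left nhdsGT_le_Icc
      have c2 : Tendsto g (𝓝[>] 0) (𝓝 (g 0)) := (cg 0 hI0).mono_left nhdsGT_le_Icc
      have d1 : Tendsto v (𝓝[>] 0) (𝓝 0) := by
        have := (F.sol.cv 0 hI0).mono_left nhdsGT_le_Icc
        rwa [F.v0] at this
      have d2 : Tendsto ψ (𝓝[>] 0) (𝓝 0) := by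
        have := (cψ 0 hI0).mono_left nhdsGT_le_Icc; rwa [h0] at this
      have hq0 : q 0 ≠ 0 := by rw [show q 0 = 1 from F.q0]; norm_num
      have hl : Tendsto (fun t => ψ t / v t) (𝓝[>] 0) (𝓝 (g 0 / q 0)) :=
        HasDerivAt.lhopital_zero_nhdsGT (hev.mono fun t ht => hd t ht)
          (hev.mono fun t ht => F.sol.dv t ht) (c1.eventually_ne hq0) d2 d1 (c2.div c1 hq0)
      have hlim : Tendsto G (𝓝[>] 0) (𝓝 (G 0)) := by
        have := (d2.mul hl).mul c1
        rw [zero_mul, zero_mul] at this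
        rw [hG0]; exact this
      exact (continuousWithinAt_Ioi_iff_Ici.1 hlim).mono Icc_subset_Ici_self
    · exact ((cψ t ht).mul ((cψ t ht).div (F.sol.cv t ht) (hpv t ⟨hlt, ht.2⟩).ne')).mul (F.sol.cq t ht)
  have cf : ContinuousOn (fun t => g t ^ 2 + lam * (ψ t ^ 2 * Real.exp (2 * t))) (Icc 0 TT) := by
    fun_prop
  have := intervalIntegral.sub_le_integral_of_hasDeriv_right_of_le (g := G)
    (g' := fun t => (g t * (ψ t / v t) + ψ t * ((g t * v t - ψ t * q t) / v t ^ 2)) * q t +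
      ψ t * (ψ t / v t) * (Real.exp (2 * t) * (lam * v t - 0 * gp p (v t))))
    (φ := fun t => g t ^ 2 + lam * (ψ t ^ 2 * Real.exp (2 * t))) hTp.le cG (fun t ht => ?_)
    cf.integrableOn_Icc (fun t ht => ?_)
  · rw [hG0, hGT, sub_zero] at this; exact this
  · have hv := (hpv t ⟨ht.1, ht.2.le⟩).ne'
    have := ((hd t ht).mul ((hd t ht).div (F.sol.dv t ht) hv)).mul (F.sol.dq t ht)
    exact this.hasDerivWithinAt
  · have hv := (hpv t ⟨ht.1, ht.2.le⟩).ne'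
    have e : (g t * (ψ t / v t) + ψ t * ((g t * v t - ψ t * q t) / v t ^ 2)) * q t +
      ψ t * (ψ t / v t) * (Real.exp (2 * t) * (lam * v t - 0 * gp p (v t))) =
      g t ^ 2 + lam * (ψ t ^ 2 * Real.exp (2 * t)) - (g t - ψ t * (q t / v t)) ^ 2 := by
      field_simp; ring
    rw [e]
    nlinarith [sq_nonneg (g t - ψ t * (q t / v t))]

lemma neg_le_lambda1 (p : ℝ) (hp : 6 < p) (lam : ℝ) (h : PosP p lam 0) : -lam ≤ lambda1 2 := by
  have hT := TT_pos
  apply le_csInf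
  · refine ⟨_, fun r => (r - 1) * (2 - r), ?_, by norm_num, by norm_num, ⟨3 / 2, by norm_num, by norm_num⟩, rfl⟩
    fun_prop
  · rintro x ⟨φ, hφ, h1, h2, ⟨r, hr, hr0⟩, rfl⟩
    obtain ⟨g, cg, hd⟩ := cdo_parts hφ
    obtain ⟨e1, e2⟩ := rayleigh_parts hφ.continuousOn cg hd
    rw [e1, e2]
    have hmaps : MapsTo Real.exp (Icc 0 TT) (Icc 1 2) := fun t ht => exp_mem_Icc ht
    have cψ : ContinuousOn (fun t => φ (Real.exp t)) (Icc 0 TT) :=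
      hφ.continuousOn.comp Real.continuous_exp.continuousOn hmaps
    have cgg : ContinuousOn (fun t => g (Real.exp t) * Real.exp t) (Icc 0 TT) :=
      (cg.comp Real.continuous_exp.continuousOn hmaps).mul Real.continuous_exp.continuousOn
    have hp := picone p hp lam h cψ cgg
      (fun t ht => (hd _ (exp_mem_Ioo ht)).comp t (Real.hasDerivAt_exp t))
      (by simpa using h1) (by simpa [exp_TT] using h2)
    have cD : ContinuousOn (fun t => φ (Real.exp t) ^ 2 * Real.exp (2 * t)) (Icc 0 TT) :=
      (cψ.pow 2).mul (by fun_prop)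
    have cN : ContinuousOn (fun t => (g (Real.exp t) * Real.exp t) ^ 2) (Icc 0 TT) := cgg.pow 2
    rw [intervalIntegral.integral_add (ContinuousOn.intervalIntegrable_of_Icc hT.le cN)
      ((ContinuousOn.intervalIntegrable_of_Icc hT.le cD).const_mul _),
      intervalIntegral.integral_const_mul] at hp
    have hD : 0 < ∫ t in (0:ℝ)..TT, φ (Real.exp t) ^ 2 * Real.exp (2 * t) := by
      refine intervalIntegral.integral_pos hT cD (fun t _ => by positivity) ⟨Real.log r, log_mem_Icc hr, ?_⟩
      rw [Real.exp_log (by linarith [hr.1])]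
      positivity
    rw [le_div_iff₀ hD]
    linarith

lemma lambda1_le (p : ℝ) (hp : 6 < p) (lam : ℝ) (h : SolP p lam 0) : lambda1 2 ≤ -lam := by
  have hT := TT_pos
  have F := flow_spec p hp lam 0 le_rfl
  have hpv := h.1
  have hvT := h.2
  set v := FV p lam 0
  set q := FQ p lam 0
  apply csInf_le
  · refine ⟨0, ?_⟩
    rintro x ⟨φ, hφ, h1, h2, _, rfl⟩
    apply div_nonneg <;> apply intervalIntegral.integral_nonneg (by norm_num) <;> intro r hr <;>
      have : 0 ≤ r := by linarith [hr.1]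
    all_goals positivity
  · have hmaps : MapsTo Real.log (Icc 1 2) (Icc 0 TT) := fun t ht => log_mem_Icc ht
    have clog : ContinuousOn Real.log (Icc 1 2) := Real.continuousOn_log.mono (fun r hr => by
      have := hr.1; simp; linarith)
    have hd : ∀ r ∈ Ioo (1:ℝ) 2, HasDerivAt (fun r => v (Real.log r)) (q (Real.log r) * r⁻¹) r := by
      intro r hr
      exact (F.dvI _ (hmaps (Ioo_subset_Icc_self hr))).comp r (Real.hasDerivAt_log (by linarith [hr.1]))
    have cφ : ContinuousOn (fun r => v (Real.log r)) (Icc 1 2) := F.sol.cv.comp clog hmaps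
    have cg : ContinuousOn (fun r => q (Real.log r) * r⁻¹) (Icc 1 2) :=
      (F.sol.cq.comp clog hmaps).mul (continuousOn_id.inv₀ (fun r hr => by
        have := hr.1; simp; linarith))
    refine ⟨fun r => v (Real.log r), ?_, by simpa using F.v0, hvT, ⟨3 / 2, by norm_num, ?_⟩, ?_⟩
    · have h1 : ContDiffOn ℝ 1 v (Ioo (-1/10) (8/10)) := F.smooth.of_le (by norm_num)
      refine h1.comp (t := Ioo (-1/10) (8/10)) ?_ (fun r hr => Icc_sub_ext (hmaps hr))
      exact Real.contDiffOn_log.mono (fun r hr => by have := hr.1; simp; linarith)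
    · exact (hpv _ (log_mem_Ioo (by norm_num))).ne'
    · obtain ⟨e1, e2⟩ := rayleigh_parts cφ cg hd
      rw [e1, e2]
      simp only [Real.log_exp]
      have e3 : ∫ t in (0:ℝ)..TT, (q t * (Real.exp t)⁻¹ * Real.exp t) ^ 2 = ∫ t in (0:ℝ)..TT, q t ^ 2 := by
        congr 1; ext t; rw [mul_assoc, inv_mul_cancel₀ (Real.exp_pos t).ne', mul_one]
      rw [e3]
      have cD : ContinuousOn (fun t => v t ^ 2 * Real.exp (2 * t)) (Icc 0 TT) :=
        (F.sol.cv.pow 2).mul (by fun_prop)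
      have cN : ContinuousOn (fun t => q t ^ 2) (Icc 0 TT) := F.sol.cq.pow 2
      have hD : 0 < ∫ t in (0:ℝ)..TT, v t ^ 2 * Real.exp (2 * t) := by
        refine intervalIntegral.intervalIntegral_pos_of_pos_on
          (ContinuousOn.intervalIntegrable_of_Icc hT.le cD) (fun t ht => ?_) hT
        have : 0 < v t := hpv t ht
        positivity
      have hIntEq : ∫ t in (0:ℝ)..TT, (q t ^ 2 + lam * (v t ^ 2 * Real.exp (2 * t))) = 0 := by
        rw [intervalIntegral.integral_eq_sub_of_hasDerivAt_of_le (f := fun t => v t * q t) hT.le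
          (F.sol.cv.mul F.sol.cq)]
        · rw [show v TT = 0 from hvT, show v 0 = 0 from F.v0]; ring
        · intro t ht
          refine ((F.sol.dv t ht).mul (F.sol.dq t ht)).congr_deriv ?_
          simp only [v, q]
          ring
        · exact ContinuousOn.intervalIntegrable_of_Icc hT.le (cN.add (continuousOn_const.mul cD))
      rw [intervalIntegral.integral_add (ContinuousOn.intervalIntegrable_of_Icc hT.le cN)
        ((ContinuousOn.intervalIntegrable_of_Icc hT.le cD).const_mul _),
        intervalIntegral.integral_const_mul] at hIntEq
      rw [eq_div_iff hD.ne']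
      linarith

lemma posP_of_gt (p : ℝ) (hp : 6 < p) (lam : ℝ) (hl : -lambda1 2 < lam) : PosP p lam 0 := by
  by_contra hc
  obtain ⟨s, hs, hS⟩ := path_sol p hp (fun s => max lam 0 + s * (lam - max lam 0)) (fun _ => 0)
    (by fun_prop) (by fun_prop) (fun _ => le_rfl)
    (by simp only [zero_mul, add_zero]; exact posP_of_nonneg p hp _ (le_max_right _ _))
    (by simpa using hc)
  have h1 := lambda1_le p hp _ hS
  have : lam - max lam 0 ≤ 0 := by linarith [le_max_left lam 0]
  nlinarith [hs.2]

lemma mu_zero_of_edge (p : ℝ) (hp : 6 < p) (mu : ℝ) (hmu : 0 ≤ mu) (h : SolP p (-lambda1 2) mu) :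
    mu = 0 := by
  by_contra hc
  have hmu0 : 0 < mu := lt_of_le_of_ne hmu (Ne.symm hc)
  obtain ⟨d, hd0, hd⟩ := posP_open p hp _ 0 le_rfl (sturm p hp _ _ hmu0 h)
  have := neg_le_lambda1 p hp _ (hd (-lambda1 2 - d / 2) 0 le_rfl
    (by rw [abs_lt]; constructor <;> linarith) (by simpa using hd0))
  linarith

lemma ae_pow (p : ℝ) (hp : 6 < p) {mu : ℝ} (hmu : 0 ≤ mu) : (mu ^ (1 / (p - 2))) ^ (p - 2) = mu := by
  rw [← Real.rpow_mul hmu, one_div, inv_mul_cancel₀ (by linarith), Real.rpow_one]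

lemma solP_dir (p : ℝ) (hp : 6 < p) {lam mu : ℝ} (hmu : 0 < mu) (h : SolP p lam mu) :
    IsDir p lam (fun t => mu ^ (1 / (p - 2)) * FV p lam mu t)
      (fun t => mu ^ (1 / (p - 2)) * FQ p lam mu t) := by
  have F := flow_spec p hp lam mu hmu.le
  have ha : 0 < mu ^ (1 / (p - 2)) := Real.rpow_pos_of_pos hmu _
  exact ⟨F.sol.scale ha (ae_pow p hp hmu.le), by simp [F.v0], by simp [h.2],
    fun t ht => mul_pos ha (h.1 t ht)⟩

lemma solP_uniq (p : ℝ) (hp : 6 < p) {lam mu nu : ℝ} (hmu : 0 < mu) (hnu : 0 < nu)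
    (h1 : SolP p lam mu) (h2 : SolP p lam nu) : mu = nu := by
  have := ((solP_dir p hp hmu h1).uniq hp (solP_dir p hp hnu h2)).1
  simp only [(flow_spec p hp lam mu hmu.le).q0, (flow_spec p hp lam nu hnu.le).q0, mul_one] at this
  rw [← ae_pow p hp hmu.le, this, ae_pow p hp hnu.le]

lemma not_solP_of_posP {p lam mu : ℝ} (h : PosP p lam mu) : ¬ SolP p lam mu := by
  intro h2
  have := h TT ⟨TT_pos, le_rfl⟩
  rw [h2.2] at this
  exact lt_irrefl _ this

lemma exists_mu (p : ℝ) (hp : 6 < p) (lam : ℝ) (hl : -lambda1 2 < lam) :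
    ∃ mu : ℝ, 0 < mu ∧ SolP p lam mu := by
  have h0 := posP_of_gt p hp lam hl
  obtain ⟨M0, hM0, hM⟩ := bound_mu p hp |lam| (abs_nonneg _)
  obtain ⟨s, hs, hS⟩ := path_sol p hp (fun _ => lam) (fun s => |s| * (M0 + 1))
    (by fun_prop) (by fun_prop) (fun s => by positivity)
    (by simpa using h0)
    (by
      intro hc
      refine hM lam _ le_rfl ?_ (fun t ht => hc t ⟨ht.1, ht.2.le⟩)
      simp)
  refine ⟨_, ?_, hS⟩
  rcases eq_or_ne s 0 with h | h
  · exfalso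
    rw [h] at hS
    simp only [abs_zero, zero_mul] at hS
    exact not_solP_of_posP h0 hS
  · have := abs_pos.2 h
    positivity

lemma cluster (p : ℝ) (hp : 6 < p) (y m : ℕ → ℝ) (x : ℝ) (hy : Tendsto y atTop (𝓝 x))
    (hm : ∀ n, 0 ≤ m n) (h : ∀ n, SolP p (y n) (m n)) :
    ∃ a, 0 ≤ a ∧ SolP p x a ∧ ∃ φ : ℕ → ℕ, StrictMono φ ∧ Tendsto (m ∘ φ) atTop (𝓝 a) := by
  obtain ⟨B, hB⟩ := hy.abs.bddAbove_range
  have hB' : ∀ n, |y n| ≤ B := fun n => hB ⟨n, rfl⟩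
  obtain ⟨M0, hM0, hM⟩ := bound_mu p hp B ((abs_nonneg _).trans (hB' 0))
  have hmM : ∀ n, m n ∈ Icc 0 M0 := by
    intro n
    refine ⟨hm n, ?_⟩
    by_contra hc
    exact hM _ _ (hB' n) (not_le.1 hc) (h n).1
  obtain ⟨a, ha, φ, hφ, hlim⟩ := isCompact_Icc.tendsto_subseq hmM
  exact ⟨a, ha.1, solP_limit p hp (y ∘ φ) (m ∘ φ) x a (hy.comp hφ.tendsto_atTop) hlim
    (fun n => hm _) (fun n => h _), φ, hφ, hlim⟩

lemma solP_edge (p : ℝ) (hp : 6 < p) : SolP p (-lambda1 2) 0 := by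
  choose m hm0 hm using fun n : ℕ => exists_mu p hp (-lambda1 2 + 1 / ((n:ℝ) + 1))
    (by have : 0 < 1 / ((n:ℝ) + 1) := by positivity
        linarith)
  have hy : Tendsto (fun n : ℕ => -lambda1 2 + 1 / ((n:ℝ) + 1)) atTop (𝓝 (-lambda1 2)) := by
    simpa using tendsto_const_nhds.add (tendsto_one_div_add_atTop_nhds_zero_nat (𝕜 := ℝ))
  obtain ⟨a, ha, hS, _⟩ := cluster p hp _ m _ hy (fun n => (hm0 n).le) hm
  rwa [mu_zero_of_edge p hp a ha hS] at hS

open Classical in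
def muF (p lam : ℝ) : ℝ := if h : ∃ mu : ℝ, 0 < mu ∧ SolP p lam mu then h.choose else 0

lemma muF_nonneg (p lam : ℝ) : 0 ≤ muF p lam := by
  unfold muF
  split_ifs with h
  · exact h.choose_spec.1.le
  · exact le_rfl

lemma muF_gt (p : ℝ) (hp : 6 < p) (lam : ℝ) (hl : -lambda1 2 < lam) :
    0 < muF p lam ∧ SolP p lam (muF p lam) := by
  have h := exists_mu p hp lam hl
  unfold muF
  rw [dif_pos h]
  exact h.choose_spec

lemma muF_edge (p : ℝ) (hp : 6 < p) : muF p (-lambda1 2) = 0 := by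
  unfold muF
  rw [dif_neg]
  rintro ⟨mu, hmu, h⟩
  exact hmu.ne' (mu_zero_of_edge p hp mu hmu.le h)

lemma muF_sol (p : ℝ) (hp : 6 < p) (lam : ℝ) (hl : -lambda1 2 ≤ lam) : SolP p lam (muF p lam) := by
  rcases hl.eq_or_lt with h | h
  · rw [← h, muF_edge p hp]; exact solP_edge p hp
  · exact (muF_gt p hp lam h).2

lemma muF_unique (p : ℝ) (hp : 6 < p) (lam a : ℝ) (hl : -lambda1 2 ≤ lam) (ha : 0 ≤ a)
    (h : SolP p lam a) : a = muF p lam := by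
  rcases hl.eq_or_lt with hh | hh
  · rw [← hh, muF_edge p hp]
    rw [← hh] at h
    exact mu_zero_of_edge p hp a ha h
  · have h2 := muF_gt p hp lam hh
    have ha0 : 0 < a := by
      refine lt_of_le_of_ne ha ?_
      rintro rfl
      exact not_solP_of_posP (posP_of_gt p hp lam hh) h
    exact solP_uniq p hp ha0 h2.1 h h2.2

lemma muF_cont (p : ℝ) (hp : 6 < p) : ContinuousOn (muF p) (Ici (-lambda1 2)) := by
  intro x hx
  apply tendsto_of_subseq_tendsto
  intro ns hns
  rw [tendsto_nhdsWithin_iff] at hns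
  obtain ⟨N, hN⟩ := eventually_atTop.1 hns.2
  obtain ⟨a, ha, hS, φ, hφ, hlim⟩ := cluster p hp (fun n => ns (n + N)) (fun n => muF p (ns (n + N))) x
    (hns.1.comp (tendsto_add_atTop_nat N)) (fun n => muF_nonneg _ _)
    (fun n => muF_sol p hp _ (hN _ (by omega)))
  rw [muF_unique p hp x a hx ha hS] at hlim
  exact ⟨fun n => φ n + N, hlim⟩

def aF (p lam : ℝ) : ℝ := muF p lam ^ (1 / (p - 2))

def mF (p lam : ℝ) : ℝ := tmass (fun t => aF p lam * FV p lam (muF p lam) t)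

lemma mF_cont (p : ℝ) (hp : 6 < p) : ContinuousOn (mF p) (Ici (-lambda1 2)) := by
  intro x hx
  have hmu := muF_cont p hp x hx
  have ha : ContinuousWithinAt (aF p) (Ici (-lambda1 2)) x :=
    hmu.rpow_const (Or.inr (by have : 0 < p - 2 := by linarith
                               positivity))
  have hI : ContinuousWithinAt (fun l => tmass (FV p l (muF p l))) (Ici (-lambda1 2)) x := by
    unfold tmass
    apply intervalIntegral.continuousWithinAt_of_dominated_interval
      (bound := fun _ => Real.exp (|x| + 2) ^ 2 * 4)
    · refine Eventually.of_forall fun l => ?_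
      have F := flow_spec p hp l (muF p l) (muF_nonneg _ _)
      rw [uIoc_of_le TT_pos.le]
      have : ContinuousOn (fun t => FV p l (muF p l) t ^ 2 * Real.exp (2 * t)) (Icc 0 TT) :=
        (F.sol.cv.pow 2).mul (by fun_prop)
      exact (this.mono Ioc_subset_Icc_self).aestronglyMeasurable measurableSet_Ioc
    · have h1 : ∀ᶠ l in 𝓝[Ici (-lambda1 2)] x, |l - x| < 1 := by
        apply mem_nhdsWithin_of_mem_nhds
        have : Metric.ball x 1 ∈ 𝓝 x := Metric.ball_mem_nhds x one_pos
        filter_upwards [this] with l hl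
        rwa [Metric.mem_ball, Real.dist_eq] at hl
      filter_upwards [h1] with l hl
      refine Eventually.of_forall fun t ht => ?_
      rw [uIoc_of_le TT_pos.le] at ht
      have F := flow_spec p hp l (muF p l) (muF_nonneg _ _)
      have hb := F.bd t (Ioc_subset_Icc_self ht)
      have hl2 : |l| ≤ |x| + 1 := by
        have := abs_sub_abs_le_abs_sub l x; linarith
      have hb2 := hb.trans (Real.exp_le_exp.2 (show |l| + 1 ≤ |x| + 2 by linarith))
      rw [Real.norm_of_nonneg (by positivity), ← sq_abs]
      exact mul_le_mul (pow_le_pow_left₀ (abs_nonneg _) hb2 2) (exp2_le ht.2) (Real.exp_pos _).le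
        (by positivity)
    · simp
    · refine Eventually.of_forall fun t ht => ?_
      rw [uIoc_of_le TT_pos.le] at ht
      refine ContinuousWithinAt.mul (ContinuousWithinAt.pow ?_ 2) continuousWithinAt_const
      rw [Metric.continuousWithinAt_iff']
      intro e he
      obtain ⟨d, hd0, hd⟩ := flow_cont p hp x (muF p x) (muF_nonneg _ _) e he
      have h1 := Metric.continuousWithinAt_iff'.1 hmu d hd0
      have h2 := Metric.continuousWithinAt_iff'.1
        (continuousWithinAt_id (s := Ici (-lambda1 2)) (x := x)) d hd0
      filter_upwards [h1, h2] with l h1 h2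
      rw [Real.dist_eq] at h1 h2 ⊢
      exact (hd l _ (muF_nonneg _ _) h2 h1 t (Ioc_subset_Icc_self ht)).1
  have e : mF p = fun l => aF p l ^ 2 * tmass (FV p l (muF p l)) := by
    ext l
    unfold mF tmass
    rw [← intervalIntegral.integral_const_mul]
    congr 1; ext t; ring
  rw [e]
  exact (ha.pow 2).mul hI

lemma mF_edge (p : ℝ) (hp : 6 < p) : mF p (-lambda1 2) = 0 := by
  have : aF p (-lambda1 2) = 0 := by
    unfold aF
    rw [muF_edge p hp, Real.zero_rpow]
    have : 0 < p - 2 := by linarith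
    positivity
  unfold mF tmass
  simp [this]

lemma mF_dir (p : ℝ) (hp : 6 < p) (lam : ℝ) (hl : -lambda1 2 < lam) :
    IsDir p lam (fun t => aF p lam * FV p lam (muF p lam) t)
      (fun t => aF p lam * FQ p lam (muF p lam) t) :=
  solP_dir p hp (muF_gt p hp lam hl).1 (muF_gt p hp lam hl).2

lemma mF_pos (p : ℝ) (hp : 6 < p) (lam : ℝ) (hl : -lambda1 2 < lam) : 0 < mF p lam := by
  have h := mF_dir p hp lam hl
  unfold mF tmass
  refine intervalIntegral.intervalIntegral_pos_of_pos_on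
          (ContinuousOn.intervalIntegrable_of_Icc TT_pos.le
            ((h.sol.cv.pow 2).mul (by fun_prop))) (fun t ht => ?_) TT_pos
  have : 0 < aF p lam * FV p lam (muF p lam) t := h.pos t ht
  positivity

lemma mF_lim (p : ℝ) (hp : 6 < p) : Tendsto (mF p) atTop (𝓝 0) := by
  obtain ⟨C, hC, h⟩ := decay p hp
  have hth : 0 < 1 / 2 - 2 / (p - 2) := by
    have : 2 / (p - 2) < 1 / 2 := by rw [div_lt_iff₀ (by linarith)]; linarith
    linarith
  have h1 : Tendsto (fun lam : ℝ => C * lam ^ (2 / (p - 2) - 1 / 2)) atTop (𝓝 0) := by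
    have := (tendsto_rpow_neg_atTop hth).const_mul C
    rw [mul_zero] at this
    refine this.congr fun x => ?_
    congr 2; ring
  refine squeeze_zero' ?_ ?_ h1
  · filter_upwards [eventually_gt_atTop (-lambda1 2)] with l hl using (mF_pos p hp l hl).le
  · filter_upwards [eventually_gt_atTop (-lambda1 2), eventually_ge_atTop 1] with l hl hl1
    exact h l hl1 _ _ (mF_dir p hp l hl)

lemma mass_eq {u : ℝ → ℝ} (hu : ContinuousOn u (Icc 1 2)) :
    mass 2 u = tmass (fun t => u (Real.exp t)) := by
  unfold mass tmass
  rw [int_congr_Ioo (g := fun r => u r ^ 2 * r) (by norm_num)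
      (fun r hr => by simp), int_subst (f := fun r => u r ^ 2 * r) ((hu.pow 2).mul continuousOn_id)]
  congr 1; ext t; rw [two_mul, Real.exp_add]; ring

lemma dir_of_rad (p lam : ℝ) {u : ℝ → ℝ} (h : IsPosRadSol 2 p lam u) :
    ∃ q : ℝ → ℝ, IsDir p lam (fun t => u (Real.exp t)) q := by
  obtain ⟨hc, hpos, h1, h2, heq⟩ := h
  have hmaps : MapsTo Real.exp (Icc 0 TT) (Icc 1 2) := fun t ht => exp_mem_Icc ht
  obtain ⟨g, cg, hd⟩ := cdo_parts (hc.of_le (by norm_num))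
  have hco : ContDiffOn ℝ 1 (deriv u) (Ioo 1 2) :=
    (hc.mono Ioo_subset_Icc_self).deriv_of_isOpen isOpen_Ioo (by norm_num)
  have hdg : ∀ r ∈ Ioo (1:ℝ) 2, HasDerivAt g (deriv (deriv u) r) r := by
    intro r hr
    have h3 := ((hco.differentiableOn one_ne_zero r hr).differentiableAt
      (isOpen_Ioo.mem_nhds hr)).hasDerivAt
    refine h3.congr_of_eventuallyEq ?_
    filter_upwards [isOpen_Ioo.mem_nhds hr] with s hs using (hd s hs).deriv.symm
  refine ⟨fun t => g (Real.exp t) * Real.exp t, ⟨?_, ?_, ?_, ?_⟩, by simpa using h1,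
    by simpa [exp_TT] using h2, fun t ht => hpos _ (exp_mem_Ioo ht)⟩
  · exact hc.continuousOn.comp Real.continuous_exp.continuousOn hmaps
  · exact (cg.comp Real.continuous_exp.continuousOn hmaps).mul Real.continuous_exp.continuousOn
  · intro t ht
    exact (hd _ (exp_mem_Ioo ht)).comp t (Real.hasDerivAt_exp t)
  · intro t ht
    have hr := exp_mem_Ioo ht
    have h3 := ((hdg _ hr).comp t (Real.hasDerivAt_exp t)).mul (Real.hasDerivAt_exp t)
    refine h3.congr_deriv ?_
    have h4 := heq _ hr
    rw [gp_of_nonneg p _ (hpos _ hr).le, ← h4, (hd _ hr).deriv, two_mul, Real.exp_add]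
    have := (Real.exp_pos t).ne'
    simp only [Function.comp]
    push_cast
    field_simp
    ring

lemma rad_of_mF (p : ℝ) (hp : 6 < p) (lam : ℝ) (hl : -lambda1 2 < lam) :
    ∃ u : ℝ → ℝ, IsPosRadSol 2 p lam u ∧ mass 2 u = mF p lam := by
  have D := mF_dir p hp lam hl
  have F := flow_spec p hp lam (muF p lam) (muF_nonneg _ _)
  have hm : mF p lam = tmass (fun t => aF p lam * FV p lam (muF p lam) t) := rfl
  have hsm : ContDiffOn ℝ 2 (fun t => aF p lam * FV p lam (muF p lam) t) (Ioo (-1/10) (8/10)) :=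
    contDiffOn_const.mul F.smooth
  rw [hm]
  generalize (fun t => aF p lam * FV p lam (muF p lam) t) = v at *
  generalize (fun t => aF p lam * FQ p lam (muF p lam) t) = q at *
  have hmaps : MapsTo Real.log (Icc 1 2) (Icc 0 TT) := fun t ht => log_mem_Icc ht
  have hcd : ContDiffOn ℝ 2 (fun r => v (Real.log r)) (Icc 1 2) := by
    refine hsm.comp (t := Ioo (-1/10) (8/10)) ?_ (fun r hr => Icc_sub_ext (hmaps hr))
    exact Real.contDiffOn_log.mono (fun r hr => by have := hr.1; simp; linarith)
  have hd : ∀ r ∈ Ioo (1:ℝ) 2, HasDerivAt (fun r => v (Real.log r)) (q (Real.log r) * r⁻¹) r := by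
    intro r hr
    exact (D.sol.dv _ (log_mem_Ioo hr)).comp r (Real.hasDerivAt_log (by linarith [hr.1]))
  refine ⟨fun r => v (Real.log r), ⟨hcd, fun r hr => D.pos _ (log_mem_Ioo hr), by simpa using D.u0,
    D.uT, ?_⟩, ?_⟩
  · intro r hr
    have hr0 : r ≠ 0 := by linarith [hr.1]
    have hq := ((D.sol.dq _ (log_mem_Ioo hr)).comp r (Real.hasDerivAt_log hr0)).mul (hasDerivAt_inv hr0)
    have hdd : deriv (deriv (fun r => v (Real.log r))) r = _ :=
      (hq.congr_of_eventuallyEq (by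
        filter_upwards [isOpen_Ioo.mem_nhds hr] with s hs using (hd s hs).deriv)).deriv
    rw [hdd, (hd r hr).deriv, gp_of_nonneg p _ (D.pos _ (log_mem_Ioo hr)).le, two_mul, Real.exp_add,
      Real.exp_log (by linarith [hr.1])]
    simp only [Function.comp]
    push_cast
    field_simp
    ring
  · rw [mass_eq hcd.continuousOn]
    simp only [Real.log_exp]

lemma mass_of_rad (p : ℝ) (hp : 6 < p) (lam : ℝ) (hl : -lambda1 2 < lam) {u : ℝ → ℝ}
    (h : IsPosRadSol 2 p lam u) : mass 2 u = mF p lam := by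
  obtain ⟨q, hq⟩ := dir_of_rad p lam h
  have := (hq.uniq hp (mF_dir p hp lam hl)).2
  rw [mass_eq h.1.continuousOn]
  unfold mF tmass
  apply int_congr_Ioo TT_pos.le
  intro t ht
  have h1 := this t (Ioo_subset_Icc_self ht)
  beta_reduce; rw [h1]

theorem stmt2 (p : ℝ) (hp : 6 < p) :
    ∃ η₂ : ℝ, 0 < η₂ ∧
      (∀ c : ℝ, 0 < c → c < η₂ →
        ∃ lam lam' : ℝ, -lambda1 2 < lam ∧ -lambda1 2 < lam' ∧ lam ≠ lam' ∧
          ∃ u u' : ℝ → ℝ, IsPosRadSol 2 p lam u ∧ IsPosRadSol 2 p lam' u' ∧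
            mass 2 u = c ∧ mass 2 u' = c) ∧
      (∃ lam : ℝ, -lambda1 2 < lam ∧
        ∃ u : ℝ → ℝ, IsPosRadSol 2 p lam u ∧ mass 2 u = η₂) ∧
      (∀ c : ℝ, η₂ < c → ¬ ∃ lam : ℝ, -lambda1 2 < lam ∧
        ∃ u : ℝ → ℝ, IsPosRadSol 2 p lam u ∧ mass 2 u = c) := by
  set L := -lambda1 2 with hL
  have hcont : ContinuousOn (mF p) (Ici L) := mF_cont p hp
  have hedge : mF p L = 0 := mF_edge p hp
  have hpos : ∀ l, L < l → 0 < mF p l := mF_pos p hp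
  have hlim := mF_lim p hp
  -- a global maximiser
  obtain ⟨z, hz, hzmax⟩ : ∃ z, L < z ∧ ∀ l, L < l → mF p l ≤ mF p z := by
    have hev : ∀ᶠ l in atTop, mF p l < mF p (L + 1) :=
      hlim.eventually_lt_const (hpos _ (by linarith))
    obtain ⟨R, hR⟩ := eventually_atTop.1 hev
    set R' := max R (L + 1)
    have hR' : L + 1 ≤ R' := le_max_right _ _
    obtain ⟨z, hz, hzm⟩ := isCompact_Icc.exists_isMaxOn (nonempty_Icc.2 (show L ≤ R' by linarith))
      (hcont.mono Icc_subset_Ici_self)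
    have h1 : mF p (L + 1) ≤ mF p z := hzm (⟨by linarith, hR'⟩ : L + 1 ∈ Icc L R')
    refine ⟨z, ?_, ?_⟩
    · refine lt_of_le_of_ne hz.1 ?_
      intro h
      rw [← h, hedge] at h1
      linarith [hpos (L + 1) (by linarith)]
    · intro l hl
      rcases le_total l R' with h | h
      · exact hzm (⟨hl.le, h⟩ : l ∈ Icc L R')
      · exact (hR l ((le_max_left _ _).trans h)).le.trans h1
  refine ⟨mF p z, hpos z hz, ?_, ⟨z, hz, rad_of_mF p hp z hz⟩, ?_⟩
  · intro c hc0 hc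
    obtain ⟨l1, hl1, e1⟩ := intermediate_value_Ioo hz.le (hcont.mono Icc_subset_Ici_self)
      (show c ∈ Ioo (mF p L) (mF p z) from ⟨by rwa [hedge], hc⟩)
    obtain ⟨R, hRz, hR⟩ : ∃ R, z < R ∧ mF p R < c :=
      ((eventually_gt_atTop z).and (hlim.eventually_lt_const hc0)).exists
    obtain ⟨l2, hl2, e2⟩ := intermediate_value_Ioo' hRz.le
      (hcont.mono (Icc_subset_Ici_self.trans (Ici_subset_Ici.2 hz.le)))
      (show c ∈ Ioo (mF p R) (mF p z) from ⟨hR, hc⟩)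
    obtain ⟨u1, hu1, hm1⟩ := rad_of_mF p hp l1 hl1.1
    obtain ⟨u2, hu2, hm2⟩ := rad_of_mF p hp l2 (hz.trans hl2.1)
    exact ⟨l1, l2, hl1.1, hz.trans hl2.1, by linarith [hl1.2, hl2.1] |> fun (h : l1 < l2) => h.ne,
      u1, u2, hu1, hu2, hm1.trans e1, hm2.trans e2⟩
  · rintro c hc ⟨lam, hlam, u, hu, hm⟩
    rw [mass_of_rad p hp lam hlam hu] at hm
    linarith [hzmax lam hlam]
end
end

section
/- Let N ≥ 2, let p satisfy 2 < p < 2N/(N-2) if N ≥ 3 and 2 < p < ∞ if N = 2, let λ ∈ ℝ, and let u be a positive radial solution of (NLS_λ). Then there exists a unique r̄ ∈ (1,2) with u'(r̄) = 0; moreover u'(r) > 0 for all r ∈ (1, r̄) and u'(r) < 0 for all r ∈ (r̄, 2). In particular u attains its maximum on [1,2] exactly at r̄. -/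
open Set MeasureTheory Filter Topology

noncomputable section

lemma aux_right (v v' : ℝ → ℝ) (a b c : ℝ) (hv : ∀ r ∈ Ioo a b, HasDerivAt v (v' r) r)
    (hz : ∀ r ∈ Ioo a b, v r = 0 → v' r < 0) (hc : c ∈ Ioo a b) (hvc : v c = 0) :
    ∀ r ∈ Ioo c b, v r < 0 := by
  have hle : ∀ x ∈ Ioo c b, v x ≤ 0 := by
    intro x hx
    have hsub : ∀ t ∈ Icc c x, t ∈ Ioo a b := fun t ht =>
      ⟨lt_of_lt_of_le hc.1 ht.1, lt_of_le_of_lt ht.2 hx.2⟩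
    refine image_le_of_deriv_right_lt_deriv_boundary' (f := v) (f' := v') (a := c) (b := x)
      (B := fun _ => 0) (B' := fun _ => 0) ?_ ?_ (by simp [hvc]) continuousOn_const ?_ ?_
      (right_mem_Icc.2 hx.1.le)
    · intro t ht
      exact (hv t (hsub t ht)).continuousAt.continuousWithinAt
    · intro t ht
      exact (hv t (hsub t (Ico_subset_Icc_self ht))).hasDerivWithinAt
    · intro t _
      exact hasDerivWithinAt_const _ _ _
    · intro t ht h0
      exact hz t (hsub t (Ico_subset_Icc_self ht)) h0
  intro x hx
  refine lt_of_le_of_ne (hle x hx) fun h0 => ?_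
  have hx' : x ∈ Ioo a b := ⟨hc.1.trans hx.1, hx.2⟩
  have hmax : IsLocalMax v x := by
    filter_upwards [Ioo_mem_nhds hx.1 hx.2] with t ht
    rw [h0]; exact hle t ht
  have h1 := hmax.hasDerivAt_eq_zero (hv x hx')
  have h2 := hz x hx' h0
  linarith

lemma aux_left (v v' : ℝ → ℝ) (a b c : ℝ) (hv : ∀ r ∈ Ioo a b, HasDerivAt v (v' r) r)
    (hz : ∀ r ∈ Ioo a b, v r = 0 → v' r < 0) (hc : c ∈ Ioo a b) (hvc : v c = 0) :
    ∀ r ∈ Ioo a c, 0 < v r := by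
  intro r hr
  have hmem : ∀ t ∈ Ioo (-b) (-a), -t ∈ Ioo a b := fun t ht =>
    ⟨by linarith [ht.2], by linarith [ht.1]⟩
  have := aux_right (fun t => -v (-t)) (fun t => v' (-t)) (-b) (-a) (-c) ?_ ?_
    ⟨by linarith [hc.2], by linarith [hc.1]⟩ (by simp [hvc]) (-r)
    ⟨by linarith [hr.2], by linarith [hr.1]⟩
  · simpa using this
  · intro t ht
    have h := ((hv (-t) (hmem t ht)).comp t (hasDerivAt_neg t)).neg
    refine h.congr_deriv ?_
    simp
  · intro t ht h0
    exact hz (-t) (hmem t ht) (by simpa using h0)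

lemma aux_crit (N : ℕ) (hN : 2 ≤ N) (p : ℝ) (hp2 : 2 < p) (lam : ℝ) (u : ℝ → ℝ)
    (hu : IsPosRadSol N p lam u) (r : ℝ) (hr : r ∈ Ioo (1:ℝ) 2)
    (hd1 : ∀ r ∈ Ioo (1:ℝ) 2, HasDerivAt u (deriv u r) r)
    (hd2 : ∀ r ∈ Ioo (1:ℝ) 2, HasDerivAt (deriv u) (deriv (deriv u) r) r)
    (h0 : deriv u r = 0) : deriv (deriv u) r < 0 := by
  obtain ⟨hC, hpos, hu1, hu2, hode⟩ := hu
  have hNr : (2:ℝ) ≤ N := by exact_mod_cast hN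
  let F : ℝ → ℝ := fun s => u s ^ p / p - lam * u s ^ 2 / 2
  let E : ℝ → ℝ := fun s => deriv u s ^ 2 / 2 + F s
  have hE : ∀ s ∈ Ioo (1:ℝ) 2, HasDerivAt E (-(((N:ℝ) - 1) / s) * deriv u s ^ 2) s := by
    intro s hs
    have hup := hpos s hs
    have a1 := ((hd2 s hs).pow 2).div_const 2
    have a2 := ((hd1 s hs).rpow_const (p := p) (Or.inl hup.ne')).div_const p
    have a3 := (((hd1 s hs).pow 2).const_mul lam).div_const 2
    have a4 := a1.add (a2.sub a3)
    refine a4.congr_deriv ?_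
    have ho := hode s hs
    rw [← ho]
    have hp0 : p ≠ 0 := by linarith
    have hs0 : s ≠ 0 := by linarith [hs.1]
    field_simp
    ring
  have hmono : AntitoneOn E (Ico r 2) := by
    refine antitoneOn_of_deriv_nonpos (convex_Ico r 2) ?_ ?_ ?_
    · intro s hs
      exact (hE s ⟨hr.1.trans_le hs.1, hs.2⟩).continuousAt.continuousWithinAt
    · intro s hs
      rw [interior_Ico] at hs
      exact (hE s ⟨hr.1.trans hs.1, hs.2⟩).differentiableAt.differentiableWithinAt
    · intro s hs
      rw [interior_Ico] at hs
      have hs' : s ∈ Ioo (1:ℝ) 2 := ⟨hr.1.trans hs.1, hs.2⟩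
      rw [(hE s hs').deriv]
      have : 0 ≤ ((N:ℝ) - 1) / s := div_nonneg (by linarith) (by linarith [hs'.1])
      nlinarith [mul_nonneg this (sq_nonneg (deriv u s))]
  have hFc : ContinuousOn F (Icc 1 2) := by
    refine ((hC.continuousOn.rpow_const fun x _ => Or.inr (by linarith)).div_const p).sub
      ((continuousOn_const.mul (hC.continuousOn.pow 2)).div_const 2)
  have hF2 : F 2 = 0 := by
    simp [F, hu2, Real.zero_rpow (show p ≠ 0 by linarith)]
  have hEr : 0 ≤ E r := by
    have ht : Tendsto F (𝓝[Ioo r 2] 2) (𝓝 (F 2)) :=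
      ((hFc 2 (by simp)).mono (fun t ht => ⟨(hr.1.trans ht.1).le, ht.2.le⟩))
    rw [hF2] at ht
    have : (𝓝[Ioo r 2] (2:ℝ)).NeBot := by
      rw [← mem_closure_iff_nhdsWithin_neBot, closure_Ioo hr.2.ne]
      exact right_mem_Icc.2 hr.2.le
    refine le_of_tendsto ht ?_
    filter_upwards [self_mem_nhdsWithin] with s hs
    have h1 := hmono (left_mem_Ico.2 hr.2) (Ioo_subset_Ico_self hs) hs.1.le
    have h2 : E s = deriv u s ^ 2 / 2 + F s := rfl
    nlinarith [sq_nonneg (deriv u s)]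
  have hup := hpos r hr
  have hq : 0 < u r ^ (p - 2) := Real.rpow_pos_of_pos hup _
  have e1 : u r ^ (p - 1) = u r ^ (p - 2) * u r := by
    rw [← Real.rpow_add_one hup.ne']; congr 1; ring
  have e2 : u r ^ p = u r ^ (p - 2) * u r ^ 2 := by
    rw [← Real.rpow_natCast, ← Real.rpow_add hup]; congr 1; norm_num
  have hkey : lam < u r ^ (p - 2) := by
    by_contra hcon
    push Not at hcon
    have hlt : u r ^ (p - 2) / p < lam / 2 := by
      rw [div_lt_div_iff₀ (by linarith) (by norm_num)]
      nlinarith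
    have : E r = (u r ^ (p - 2) / p - lam / 2) * u r ^ 2 := by
      simp only [E, F, h0, e2]; ring
    have h3 : 0 < u r ^ 2 := by positivity
    nlinarith
  have ho := hode r hr
  rw [h0, e1] at ho
  nlinarith

/-- Lemma 2.1: any positive radial solution has a unique critical
point `r̄ ∈ (1,2)`, is strictly increasing before it and strictly decreasing
after it, and attains its maximum on `[1,2]` exactly at `r̄`. -/
theorem stmt3 (N : ℕ) (hN : 2 ≤ N) (p : ℝ) (hp2 : 2 < p)
    (hpc : 3 ≤ N → p < 2 * (N : ℝ) / ((N : ℝ) - 2))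
    (lam : ℝ) (u : ℝ → ℝ) (hu : IsPosRadSol N p lam u) :
    ∃ rb ∈ Ioo (1:ℝ) 2, deriv u rb = 0 ∧
      (∀ r ∈ Ioo (1:ℝ) 2, deriv u r = 0 → r = rb) ∧
      (∀ r ∈ Ioo (1:ℝ) rb, 0 < deriv u r) ∧
      (∀ r ∈ Ioo rb (2:ℝ), deriv u r < 0) ∧
      (∀ r ∈ Icc (1:ℝ) 2, u r ≤ u rb) ∧
      (∀ r ∈ Icc (1:ℝ) 2, u r = u rb → r = rb) := by
  have hC := hu.1
  have hC2 : ContDiffOn ℝ 2 u (Ioo 1 2) := hC.mono Ioo_subset_Icc_self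
  have hd1 : ∀ r ∈ Ioo (1:ℝ) 2, HasDerivAt u (deriv u r) r := fun r hr =>
    ((hC2.differentiableOn (by norm_num)).differentiableAt
      (isOpen_Ioo.mem_nhds hr)).hasDerivAt
  have hC1 : ContDiffOn ℝ 1 (deriv u) (Ioo 1 2) :=
    hC2.deriv_of_isOpen isOpen_Ioo (by norm_num)
  have hd2 : ∀ r ∈ Ioo (1:ℝ) 2, HasDerivAt (deriv u) (deriv (deriv u) r) r := fun r hr =>
    ((hC1.differentiableOn (by norm_num)).differentiableAt
      (isOpen_Ioo.mem_nhds hr)).hasDerivAt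
  have hz : ∀ r ∈ Ioo (1:ℝ) 2, deriv u r = 0 → deriv (deriv u) r < 0 := fun r hr h0 =>
    aux_crit N hN p hp2 lam u hu r hr hd1 hd2 h0
  obtain ⟨rb, hrb, h0⟩ := exists_deriv_eq_zero (f := u) (by norm_num : (1:ℝ) < 2)
    hC.continuousOn (hu.2.2.1.trans hu.2.2.2.1.symm)
  have hR := aux_right _ _ 1 2 rb hd2 hz hrb h0
  have hL := aux_left _ _ 1 2 rb hd2 hz hrb h0
  have hm : StrictMonoOn u (Icc 1 rb) := by
    refine strictMonoOn_of_deriv_pos (convex_Icc _ _)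
      (hC.continuousOn.mono (Icc_subset_Icc_right hrb.2.le)) ?_
    rw [interior_Icc]; exact hL
  have ha : StrictAntiOn u (Icc rb 2) := by
    refine strictAntiOn_of_deriv_neg (convex_Icc _ _)
      (hC.continuousOn.mono (Icc_subset_Icc_left hrb.1.le)) ?_
    rw [interior_Icc]; exact hR
  have hlt : ∀ r ∈ Icc (1:ℝ) 2, r ≠ rb → u r < u rb := by
    intro r hr hne
    rcases lt_or_gt_of_ne hne with h | h
    · exact hm ⟨hr.1, h.le⟩ (right_mem_Icc.2 hrb.1.le) h
    · exact ha (left_mem_Icc.2 hrb.2.le) ⟨h.le, hr.2⟩ h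
  refine ⟨rb, hrb, h0, ?_, hL, hR, ?_, ?_⟩
  · intro r hr hr0
    by_contra hne
    rcases lt_or_gt_of_ne hne with h | h
    · linarith [hL r ⟨hr.1, h⟩]
    · linarith [hR r ⟨h, hr.2⟩]
  · intro r hr
    by_cases h : r = rb
    · rw [h]
    · exact (hlt r hr h).le
  · intro r hr he
    by_contra h
    exact (hlt r hr h).ne he
end
end

section
/- Let p > 2. There is no function v ∈ C²(ℝ) satisfying -v''(r) = v(r)^{p-1} for all r ∈ ℝ, 0 ≤ v(r) ≤ 1 for all r ∈ ℝ, and v(0) = 1. -/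
open Set Filter Topology

/-- Lemma 2.4, whole-line case: for `p > 2` there is no
`v ∈ C²(ℝ)` with `-v'' = v^(p-1)` on `ℝ`, `0 ≤ v ≤ 1`, and `v 0 = 1`. -/
theorem stmt7 (p : ℝ) (hp : 2 < p) :
    ¬ ∃ v : ℝ → ℝ, ContDiff ℝ 2 v ∧
      (∀ r : ℝ, -(deriv (deriv v) r) = v r ^ (p - 1)) ∧
      (∀ r : ℝ, 0 ≤ v r ∧ v r ≤ 1) ∧ v 0 = 1 := by
  rintro ⟨v, hv, hode, hb, h0⟩
  have hd : Differentiable ℝ v := hv.differentiable (by norm_num)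
  have hd2 : Differentiable ℝ (deriv v) := by
    have h : ContDiff ℝ (1 + 1) v := by
      rw [one_add_one_eq_two]; exact hv
    exact ((contDiff_succ_iff_deriv.1 h).2.2).differentiable (by norm_num)
  have hanti : Antitone (deriv v) := by
    apply antitone_of_deriv_nonpos hd2
    intro r
    have := hode r
    have := Real.rpow_nonneg (hb r).1 (p - 1)
    linarith
  have hz : ∀ a, deriv v a = 0 := by
    intro a
    by_contra hne
    rcases lt_or_gt_of_ne hne with h | h
    · have hpos : 0 < 2 / (-deriv v a) := by
        apply div_pos <;> linarith
      obtain ⟨c, hc, he⟩ := exists_deriv_eq_slope v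
        (show a < a + 2 / (-deriv v a) by linarith)
        hd.continuous.continuousOn hd.differentiableOn
      have hle := hanti hc.1.le
      rw [he, add_sub_cancel_left, div_le_iff₀ hpos] at hle
      have e : deriv v a * (2 / (-deriv v a)) = -2 := by
        field_simp
      have h1 := hb a
      have h2 := hb (a + 2 / (-deriv v a))
      linarith
    · have hpos : 0 < 2 / deriv v a := by positivity
      obtain ⟨c, hc, he⟩ := exists_deriv_eq_slope v
        (show a - 2 / deriv v a < a by linarith)
        hd.continuous.continuousOn hd.differentiableOn
      have hle := hanti hc.2.le
      rw [he, sub_sub_cancel, le_div_iff₀ hpos] at hle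
      have e : deriv v a * (2 / deriv v a) = 2 := by
        field_simp
      have h1 := hb a
      have h2 := hb (a - 2 / deriv v a)
      linarith
  have h := hode 0
  rw [show deriv v = fun _ => 0 from funext hz, h0, Real.one_rpow] at h
  simp at h
end

section
/- Let p > 2. The function W(r) = (p/2)^{1/(p-2)} · (cosh((p-2)r/2))^{-2/(p-2)} satisfies -W'' + W = W^{p-1} on ℝ, W > 0, W(0) = max_ℝ W, and W(r) → 0 as |r| → +∞; moreover any function V ∈ C²(ℝ) satisfying -V'' + V = V^{p-1} on ℝ, V > 0, V(0) = max_ℝ V, and V(r) → 0 as |r| → +∞ equals W. -/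
open Set Filter Topology

noncomputable section

/-- The explicit soliton `W(r) = (p/2)^(1/(p-2)) · cosh((p-2)r/2)^(-2/(p-2))`. -/
def solW (p : ℝ) : ℝ → ℝ := fun r =>
  (p / 2) ^ ((1:ℝ) / (p - 2)) * Real.cosh ((p - 2) * r / 2) ^ (-(2 / (p - 2)))

lemma solW_hasDeriv (p : ℝ) (hp : 2 < p) (r : ℝ) :
    HasDerivAt (solW p) (-(Real.sinh ((p-2)*r/2) / Real.cosh ((p-2)*r/2)) * solW p r) r := by
  have hlin : HasDerivAt (fun r : ℝ => (p-2)*r/2) ((p-2)/2) r := by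
    simpa using ((hasDerivAt_id r).const_mul (p-2)).div_const 2
  have hc := Real.cosh_pos ((p-2)*r/2)
  have h := ((hlin.cosh).rpow_const (p := -(2/(p-2))) (Or.inl hc.ne')).const_mul
    ((p / 2) ^ ((1:ℝ) / (p - 2)))
  refine h.congr_deriv ?_
  rw [Real.rpow_sub_one hc.ne']
  have : p - 2 ≠ 0 := by linarith
  unfold solW
  field_simp

lemma solW_pos (p : ℝ) (hp : 2 < p) (r : ℝ) : 0 < solW p r := by
  unfold solW
  have := Real.cosh_pos ((p-2)*r/2)
  positivity

lemma solW_pow (p : ℝ) (hp : 2 < p) (r : ℝ) :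
    solW p r ^ (p - 1) = solW p r * (p / 2 / Real.cosh ((p-2)*r/2) ^ 2) := by
  have hc := Real.cosh_pos ((p-2)*r/2)
  have h2 : p - 2 ≠ 0 := by linarith
  have e : p - 1 = 1 + (p - 2) := by ring
  rw [e, Real.rpow_add (solW_pos p hp r), Real.rpow_one]
  congr 1
  unfold solW
  rw [Real.mul_rpow (by positivity) (by positivity), ← Real.rpow_mul (by positivity),
    ← Real.rpow_mul hc.le]
  have e1 : 1 / (p-2) * (p-2) = 1 := by field_simp
  have e2 : -(2 / (p-2)) * (p-2) = -(2:ℕ) := by push_cast; field_simp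
  rw [e1, e2, Real.rpow_one, Real.rpow_neg hc.le, Real.rpow_natCast]
  rfl

lemma solW_deriv (p : ℝ) (hp : 2 < p) :
    deriv (solW p) = fun r => -(Real.sinh ((p-2)*r/2) / Real.cosh ((p-2)*r/2)) * solW p r :=
  funext fun r => (solW_hasDeriv p hp r).deriv

lemma solW_ode (p : ℝ) (hp : 2 < p) (r : ℝ) :
    -(deriv (deriv (solW p)) r) + solW p r = solW p r ^ (p - 1) := by
  have hlin : HasDerivAt (fun r : ℝ => (p-2)*r/2) ((p-2)/2) r := by
    simpa using ((hasDerivAt_id r).const_mul (p-2)).div_const 2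
  have hc := Real.cosh_pos ((p-2)*r/2)
  have h := ((hlin.sinh.div hlin.cosh hc.ne').neg).mul (solW_hasDeriv p hp r)
  rw [solW_deriv p hp, solW_pow p hp]
  have h' := h.deriv
  have hs := Real.sinh_sq ((p-2)*r/2)
  erw [h']
  simp only [Pi.neg_apply, Pi.div_apply]
  field_simp
  ring_nf at hs ⊢
  rw [hs]
  ring

lemma cosh_top : Tendsto Real.cosh atTop atTop := by
  refine tendsto_atTop_mono (f := fun x => Real.exp x / 2) ?_
    (Real.tendsto_exp_atTop.atTop_div_const (by norm_num))
  intro x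
  rw [Real.cosh_eq]
  have := Real.exp_pos (-x)
  linarith

lemma solW_top (p : ℝ) (hp : 2 < p) : Tendsto (solW p) atTop (𝓝 0) := by
  have h1 : Tendsto (fun r : ℝ => (p-2)*r/2) atTop atTop :=
    (tendsto_id.const_mul_atTop (by linarith : 0 < p - 2)).atTop_div_const (by norm_num)
  have h2 := (tendsto_rpow_neg_atTop (y := 2/(p-2)) (div_pos two_pos (by linarith))).comp
    (cosh_top.comp h1)
  have h3 := h2.const_mul ((p / 2) ^ ((1:ℝ) / (p - 2)))
  rw [mul_zero] at h3
  exact h3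

lemma solW_even (p r : ℝ) : solW p (-r) = solW p r := by
  unfold solW
  rw [← Real.cosh_neg]
  congr 3
  ring

lemma uniq (p : ℝ) (hp : 2 < p) (V : ℝ → ℝ) (hV : ContDiff ℝ 2 V)
    (hode : ∀ r : ℝ, -(deriv (deriv V) r) + V r = V r ^ (p - 1))
    (hpos : ∀ r : ℝ, 0 < V r) (hmax : ∀ r : ℝ, V r ≤ V 0)
    (htop : Tendsto V atTop (𝓝 0)) : V = solW p := by
  have d1 : ∀ r, HasDerivAt V (deriv V r) r := fun r =>
    (hV.differentiable (by norm_num) r).hasDerivAt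
  have d2 : ∀ r, HasDerivAt (deriv V) (V r - V r ^ (p-1)) r := fun r => by
    have hd : ContDiff ℝ 1 (deriv V) := by
      have : ContDiff ℝ (1+1) V := by simpa [one_add_one_eq_two] using hV
      exact (contDiff_succ_iff_deriv.1 this).2.2
    refine ((hd.differentiable (by norm_num) r).hasDerivAt).congr_deriv ?_
    linarith [hode r]
  have hV0 : deriv V 0 = 0 :=
    IsLocalMax.deriv_eq_zero (Filter.Eventually.of_forall hmax)
  have hp0 : p ≠ 0 := by linarith
  have hp2 : p - 2 ≠ 0 := by linarith
  have pw1 : ∀ r, V r ^ (p-1) = V r * V r ^ (p-2) := fun r => by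
    rw [show p - 1 = 1 + (p-2) by ring, Real.rpow_add (hpos r), Real.rpow_one]
  have pw : ∀ r, V r ^ p = V r ^ 2 * V r ^ (p-2) := fun r => by
    rw [show V r ^ 2 = V r ^ (2:ℝ) by norm_cast, ← Real.rpow_add (hpos r)]
    congr 1; ring
  -- energy
  let E : ℝ → ℝ := fun r => deriv V r ^ 2 - V r ^ 2 + 2 / p * V r ^ p
  have dE : ∀ r, HasDerivAt E 0 r := fun r => by
    have h := (((d2 r).pow 2).sub ((d1 r).pow 2)).add
      (((d1 r).rpow_const (p := p) (Or.inl (hpos r).ne')).const_mul (2/p))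
    refine h.congr_deriv ?_
    field_simp
    ring
  have Ec : ∀ r, E r = E 0 := fun r =>
    is_const_of_deriv_eq_zero (fun x => (dE x).differentiableAt) (fun x => (dE x).deriv) r 0
  have mv : ∀ n : ℕ, ∃ x : ℝ, (n:ℝ) < x ∧ deriv V x = V (n+1) - V n := fun n => by
    obtain ⟨c, hc, h⟩ := exists_hasDerivAt_eq_slope V (deriv V)
      (show (n:ℝ) < n+1 by linarith) hV.continuous.continuousOn (fun x _ => d1 x)
    exact ⟨c, hc.1, by rw [h]; simp⟩
  choose x hx hxV using mv
  have nt := tendsto_natCast_atTop_atTop (R := ℝ)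
  have xt : Tendsto x atTop atTop := tendsto_atTop_mono (fun n => (hx n).le) nt
  have Vx : Tendsto (fun n => V (x n)) atTop (𝓝 0) := htop.comp xt
  have dVx : Tendsto (fun n => deriv V (x n)) atTop (𝓝 0) := by
    have := (htop.comp (tendsto_atTop_add_const_right _ (1:ℝ) nt)).sub (htop.comp nt)
    simp only [sub_zero] at this
    exact this.congr (fun n => (hxV n).symm)
  have Ex : Tendsto (fun n => E (x n)) atTop (𝓝 0) := by
    have h := ((dVx.pow 2).sub (Vx.pow 2)).add
      ((Vx.rpow_const (p := p) (Or.inr (by linarith))).const_mul (2/p))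
    simpa [Real.zero_rpow hp0] using h
  have E0 : ∀ r, E r = 0 := by
    have : Tendsto (fun n => E (x n)) atTop (𝓝 (E 0)) := by
      simp only [Ec]; exact tendsto_const_nhds
    intro r; rw [Ec, tendsto_nhds_unique this Ex]
  have en : ∀ r, deriv V r ^ 2 = V r ^ 2 * (1 - 2 / p * V r ^ (p-2)) := fun r => by
    have h := E0 r
    simp only [E, pw] at h
    linarith
  have v0 : V 0 ^ (p-2) = p/2 := by
    have h := en 0
    rw [hV0] at h
    have h3 := (hpos 0).ne'
    have : 1 - 2/p * V 0 ^ (p-2) = 0 := by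
      have : V 0 ^ 2 * (1 - 2 / p * V 0 ^ (p-2)) = 0 := by rw [← h]; norm_num
      simpa [h3] using this
    field_simp at this ⊢
    linarith
  have v0' : V 0 = (p/2) ^ (1/(p-2)) := by
    rw [← v0, ← Real.rpow_mul (hpos 0).le, mul_one_div_cancel hp2, Real.rpow_one]
  let a := (p-2)/2
  have ha : a ≠ 0 := by simp only [a]; positivity
  let u : ℝ → ℝ := fun r => deriv V r / V r
  let z : ℝ → ℝ := fun r => V r ^ (-a)
  have du : ∀ r, HasDerivAt u (a * (u r ^ 2 - 1)) r := fun r => by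
    refine ((d2 r).div (d1 r) (hpos r).ne').congr_deriv ?_
    have h := en r
    have h3 := (hpos r).ne'
    simp only [u, a, div_pow, pw1]
    have h4 : deriv V r * deriv V r = deriv V r ^ 2 := by ring
    rw [h4, h]
    field_simp
    ring
  have dz : ∀ r, HasDerivAt z (-a * u r * z r) r := fun r => by
    refine ((d1 r).rpow_const (p := -a) (Or.inl (hpos r).ne')).congr_deriv ?_
    rw [Real.rpow_sub_one (hpos r).ne']
    simp only [u, z]
    ring
  have dexp : ∀ s r : ℝ, HasDerivAt (fun r => Real.exp (s * r)) (Real.exp (s*r) * s) r :=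
    fun s r => by simpa using ((hasDerivAt_id r).const_mul s).exp
  have f1 : ∀ r, Real.exp (-a * r) * (z r * (1 - u r)) = z 0 := fun r => by
    have hd : ∀ r, HasDerivAt (fun r => Real.exp (-a * r) * (z r * (1 - u r))) 0 r := fun r => by
      refine ((dexp (-a) r).mul ((dz r).mul ((du r).const_sub 1))).congr_deriv ?_
      simp only [Pi.mul_apply]
      ring
    have := is_const_of_deriv_eq_zero (fun x => (hd x).differentiableAt)
      (fun x => (hd x).deriv) r 0
    simpa [u, hV0] using this
  have f2 : ∀ r, Real.exp (a * r) * (z r * (1 + u r)) = z 0 := fun r => by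
    have hd : ∀ r, HasDerivAt (fun r => Real.exp (a * r) * (z r * (1 + u r))) 0 r := fun r => by
      refine ((dexp a r).mul ((dz r).mul ((du r).const_add 1))).congr_deriv ?_
      simp only [Pi.mul_apply]
      ring
    have := is_const_of_deriv_eq_zero (fun x => (hd x).differentiableAt)
      (fun x => (hd x).deriv) r 0
    simpa [u, hV0] using this
  funext r
  have hz : z r = z 0 * Real.cosh (a * r) := by
    have h1 := f1 r
    have h2 := f2 r
    have h3 : Real.exp (a*r) * Real.exp (-a*r) = 1 := by rw [← Real.exp_add]; simp
    rw [Real.cosh_eq, show -(a*r) = -a*r by ring]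
    linear_combination (Real.exp (a*r)/2) * h1 + (Real.exp (-a*r)/2) * h2 - z r * h3
  have hVz : V r = z r ^ (-(1/a)) := by
    simp only [z]
    rw [← Real.rpow_mul (hpos r).le]
    field_simp
    simp
  have hVz0 : V 0 = z 0 ^ (-(1/a)) := by
    simp only [z]
    rw [← Real.rpow_mul (hpos 0).le]
    field_simp
    simp
  have hz0 : 0 ≤ z 0 := Real.rpow_nonneg (hpos 0).le _
  rw [hVz, hz, Real.mul_rpow hz0 (Real.cosh_pos _).le, ← hVz0, v0']
  unfold solW
  congr 2
  · congr 1; simp only [a]; ring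
  · simp only [a]; field_simp

/-- `solW p` solves `-W'' + W = W^(p-1)` on `ℝ`, is positive,
attains its maximum at `0`, decays to `0` at `±∞`, and is the unique `C²`
function with these properties. -/
theorem stmt10 (p : ℝ) (hp : 2 < p) :
    (ContDiff ℝ 2 (solW p) ∧
      (∀ r : ℝ, -(deriv (deriv (solW p)) r) + solW p r = solW p r ^ (p - 1)) ∧
      (∀ r : ℝ, 0 < solW p r) ∧ (∀ r : ℝ, solW p r ≤ solW p 0) ∧
      Tendsto (solW p) atTop (𝓝 0) ∧ Tendsto (solW p) atBot (𝓝 0)) ∧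
    ∀ V : ℝ → ℝ, ContDiff ℝ 2 V →
      (∀ r : ℝ, -(deriv (deriv V) r) + V r = V r ^ (p - 1)) →
      (∀ r : ℝ, 0 < V r) → (∀ r : ℝ, V r ≤ V 0) →
      Tendsto V atTop (𝓝 0) → Tendsto V atBot (𝓝 0) → V = solW p := by
  refine ⟨⟨?_, solW_ode p hp, solW_pos p hp, ?_, solW_top p hp, ?_⟩, ?_⟩
  · unfold solW
    refine contDiff_const.mul (ContDiff.rpow_const_of_ne ?_ fun r => (Real.cosh_pos _).ne')
    exact Real.contDiff_cosh.comp (by fun_prop)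
  · intro r
    unfold solW
    refine mul_le_mul_of_nonneg_left ?_ (by positivity)
    simp only [mul_zero, zero_div, Real.cosh_zero, Real.one_rpow]
    refine Real.rpow_le_one_of_one_le_of_nonpos (Real.one_le_cosh _) ?_
    have : 0 < 2 / (p-2) := div_pos two_pos (by linarith)
    linarith
  · exact ((solW_top p hp).comp tendsto_neg_atBot_atTop).congr (solW_even p)
  · intro V h1 h2 h3 h4 h5 _
    exact uniq p hp V h1 h2 h3 h4 h5
end
end
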